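/- Let n ≥ 1, K > 0, and let F : ℝⁿ → ℝ be a smooth solution of the special Lagrangian equation ∑ᵢ arctan λᵢ(x) = constant, where λ₁(x), …, λₙ(x) are the eigenvalues of D²F(x). Suppose that for every x ∈ ℝⁿ: (i) |λᵢ(x)| ≤ K for all i; (ii) for every trace-free symmetric 3-tensor h on ℝⁿ one has Q(h) := ∑_{i,j,k} h_{ijk}² + ∑_{k,i} λᵢ(x)² h_{iik}² + 2 ∑_{k} ∑_{i<j} λᵢ(x) λⱼ(x) h_{ijk}² ≥ 0, with Q(h) = 0 only when h = 0. Then F is a quadratic polynomial, i.e. D²F is constant. -/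

import Mathlib

/-- The Hessian matrix of `F : ℝⁿ → ℝ` at `x`, with entries `∂²F/∂xⁱ∂xʲ (x)`. -/
noncomputable def Hess (n : ℕ) (F : (Fin n → ℝ) → ℝ) (x : Fin n → ℝ) :
    Matrix (Fin n) (Fin n) ℝ :=
  fun i j => fderiv ℝ (fun y => fderiv ℝ F y (Pi.single j 1)) x (Pi.single i 1)

/-- The curvature quadratic form
`Q_λ(h) = ∑_{i,j,k} h_{ijk}² + ∑_{k,i} λᵢ² h_{iik}² + 2 ∑_k ∑_{i<j} λᵢ λⱼ h_{ijk}²`. -/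
noncomputable def Qform (n : ℕ) (lam : Fin n → ℝ) (h : Fin n → Fin n → Fin n → ℝ) : ℝ :=
  (∑ i, ∑ j, ∑ k, (h i j k) ^ 2) + (∑ k, ∑ i, (lam i) ^ 2 * (h i i k) ^ 2)
    + 2 * ∑ k, ∑ i, ∑ j ∈ Finset.Ioi i, lam i * lam j * (h i j k) ^ 2

section CurvatureForm

open Finset

/-- A 3-tensor that is invariant under all permutations of its indices. -/
def IsSymTensor {n : ℕ} (h : Fin n → Fin n → Fin n → ℝ) : Prop :=
  (∀ i j k, h i j k = h j i k) ∧ ∀ i j k, h i j k = h i k j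

/-- A 3-tensor all of whose traces over the first two indices vanish. -/
def IsTraceFree {n : ℕ} (h : Fin n → Fin n → Fin n → ℝ) : Prop :=
  ∀ k, ∑ i, h i i k = 0

/-- The symmetric bilinear form polarizing `Qform` on symmetric tensors. -/
noncomputable def curvForm {n : ℕ} (lam : Fin n → ℝ) (h w : Fin n → Fin n → Fin n → ℝ) : ℝ :=
  ∑ i, ∑ j, ∑ k, (1 + lam i * lam j) * (h i j k * w i j k)

/-- The slopes for which the curvature form is nonnegative on trace-free symmetric tensors. -/
def CurvNonneg {n : ℕ} (lam : Fin n → ℝ) : Prop :=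
  ∀ h : Fin n → Fin n → Fin n → ℝ, IsSymTensor h → IsTraceFree h → 0 ≤ curvForm lam h h

lemma sum_sum_eq_diag_add_offDiag {n : ℕ} (f : Fin n → Fin n → ℝ) (hf : ∀ i j, f i j = f j i) :
    ∑ i, ∑ j, f i j = ∑ i, f i i + 2 * ∑ i, ∑ j ∈ Ioi i, f i j := by
  have h1 : ∀ i, ∑ j, f i j = f i i + ∑ j ∈ Ioi i, f i j + ∑ j ∈ Iio i, f i j := by
    intro i
    have : (univ : Finset (Fin n)) = insert i (Ioi i ∪ Iio i) := by
      ext j; rcases lt_trichotomy i j with h | h | h <;> simp [h]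
    rw [this, sum_insert (by simp), sum_union, add_assoc]
    rw [Finset.disjoint_left]; intro a; simpa using fun h : i < a => h.le
  have h2 : ∑ i, ∑ j ∈ Iio i, f i j = ∑ i, ∑ j ∈ Ioi i, f i j := by
    rw [Finset.sum_comm' (t' := univ) (s' := fun j => Ioi j) (by simp)]
    exact sum_congr rfl fun i _ => sum_congr rfl fun j _ => hf _ _
  simp_rw [h1, sum_add_distrib, h2]; ring

lemma Qform_eq_curvForm {n : ℕ} (lam : Fin n → ℝ) {h : Fin n → Fin n → Fin n → ℝ}
    (hs : IsSymTensor h) : Qform n lam h = curvForm lam h h := by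
  have key : ∀ k, ∑ i, ∑ j, lam i * lam j * h i j k ^ 2 =
      ∑ i, lam i ^ 2 * h i i k ^ 2 + 2 * ∑ i, ∑ j ∈ Ioi i, lam i * lam j * h i j k ^ 2 := by
    intro k
    rw [sum_sum_eq_diag_add_offDiag]
    · simp only [sq]
    · intro i j; rw [hs.1 i j k]; ring
  have e : curvForm lam h h = ∑ i, ∑ j, ∑ k, h i j k ^ 2 +
      ∑ k, ∑ i, ∑ j, lam i * lam j * h i j k ^ 2 := by
    have : ∑ k, ∑ i, ∑ j, lam i * lam j * h i j k ^ 2 =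
        ∑ i, ∑ j, ∑ k, lam i * lam j * h i j k ^ 2 := by
      rw [sum_comm]; exact sum_congr rfl fun i _ => sum_comm
    rw [this]
    simp only [curvForm, ← sum_add_distrib]
    refine sum_congr rfl fun i _ => sum_congr rfl fun j _ => sum_congr rfl fun k _ => ?_
    ring
  rw [e, Qform]
  simp_rw [key, sum_add_distrib, mul_sum]
  ring

lemma curvForm_add_smul {n : ℕ} (lam : Fin n → ℝ) (h w : Fin n → Fin n → Fin n → ℝ) (t : ℝ) :
    curvForm lam (fun i j k => h i j k + t * w i j k) (fun i j k => h i j k + t * w i j k) =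
      curvForm lam h h + 2 * t * curvForm lam h w + t ^ 2 * curvForm lam w w := by
  simp only [curvForm, mul_sum, ← sum_add_distrib]
  refine sum_congr rfl fun i _ => sum_congr rfl fun j _ => sum_congr rfl fun k _ => ?_
  ring

lemma CurvNonneg.curvForm_eq_zero {n : ℕ} {lam : Fin n → ℝ} (hl : CurvNonneg lam)
    {h w : Fin n → Fin n → Fin n → ℝ} (hs : IsSymTensor h) (ht : IsTraceFree h)
    (h0 : curvForm lam h h = 0) (ws : IsSymTensor w) (wt : IsTraceFree w) :
    curvForm lam h w = 0 := by
  have key : ∀ t : ℝ, 0 ≤ curvForm lam w w * (t * t) + 2 * curvForm lam h w * t + 0 := by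
    intro t
    have := hl (fun i j k => h i j k + t * w i j k)
      ⟨fun i j k => by simp only [hs.1 i j, ws.1 i j], fun i j k => by simp only [hs.2 i j, ws.2 i j]⟩
      (fun k => by simp [sum_add_distrib, ← mul_sum, ht k, wt k])
    rw [curvForm_add_smul, h0] at this
    linarith
  have := discrim_le_zero key
  rw [discrim] at this
  nlinarith [sq_nonneg (curvForm lam h w)]

/-- The Kronecker delta. -/
def kdelta {n : ℕ} (a i : Fin n) : ℝ := if a = i then 1 else 0

/-- The symmetrization (sum over all six permutations) of `e_i ⊗ e_j ⊗ e_k`. -/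
def symBasis {n : ℕ} (i j k : Fin n) : Fin n → Fin n → Fin n → ℝ := fun a b c =>
  kdelta a i * kdelta b j * kdelta c k + kdelta a i * kdelta b k * kdelta c j +
  (kdelta a j * kdelta b i * kdelta c k + kdelta a j * kdelta b k * kdelta c i) +
  (kdelta a k * kdelta b i * kdelta c j + kdelta a k * kdelta b j * kdelta c i)

lemma isSymTensor_symBasis {n : ℕ} (i j k : Fin n) : IsSymTensor (symBasis i j k) :=
  ⟨fun a b c => by simp only [symBasis]; ring, fun a b c => by simp only [symBasis]; ring⟩

lemma sum_symBasis {n : ℕ} (i j k : Fin n) (f : Fin n → Fin n → Fin n → ℝ) :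
    ∑ a, ∑ b, ∑ c, f a b c * symBasis i j k a b c =
      f i j k + f i k j + (f j i k + f j k i) + (f k i j + f k j i) := by
  simp [symBasis, kdelta, mul_add, sum_add_distrib]

lemma trace_symBasis {n : ℕ} (i j k c : Fin n) :
    ∑ a, symBasis i j k a a c =
      2 * (kdelta i j * kdelta c k + kdelta i k * kdelta c j + kdelta j k * kdelta c i) := by
  simp only [symBasis, kdelta, sum_add_distrib, mul_ite, mul_one, mul_zero]
  simp [eq_comm]
  split_ifs <;> simp_all <;> ring

lemma curvForm_symBasis {n : ℕ} (lam : Fin n → ℝ) {h : Fin n → Fin n → Fin n → ℝ}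
    (hs : IsSymTensor h) (i j k : Fin n) :
    curvForm lam h (symBasis i j k) =
      2 * (3 + lam i * lam j + lam j * lam k + lam k * lam i) * h i j k := by
  have := sum_symBasis i j k fun a b c => (1 + lam a * lam b) * h a b c
  simp only [curvForm, ← mul_assoc]
  rw [this]
  rw [hs.2 i k j, hs.1 j i k, hs.2 j k i, hs.1 j i k, hs.1 k i j, hs.2 i k j, hs.1 k j i,
    hs.2 j k i, hs.1 j i k]
  ring

lemma curvForm_add_smul_right {n : ℕ} (lam : Fin n → ℝ) (h w z : Fin n → Fin n → Fin n → ℝ)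
    (s t : ℝ) :
    curvForm lam h (fun i j k => s * w i j k + t * z i j k) =
      s * curvForm lam h w + t * curvForm lam h z := by
  simp only [curvForm, mul_sum, ← sum_add_distrib]
  refine sum_congr rfl fun i _ => sum_congr rfl fun j _ => sum_congr rfl fun k _ => ?_
  ring

lemma IsSymTensor.add_smul {n : ℕ} {w z : Fin n → Fin n → Fin n → ℝ} (hw : IsSymTensor w)
    (hz : IsSymTensor z) (s t : ℝ) : IsSymTensor fun i j k => s * w i j k + t * z i j k :=
  ⟨fun i j k => by simp only [hw.1 i j, hz.1 i j], fun i j k => by simp only [hw.2 i j, hz.2 i j]⟩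

lemma CurvNonneg.distinct {n : ℕ} {lam : Fin n → ℝ} (hl : CurvNonneg lam) {i j k : Fin n}
    (hij : i ≠ j) (hjk : j ≠ k) (hik : i ≠ k) :
    0 ≤ 3 + lam i * lam j + lam j * lam k + lam k * lam i := by
  have := hl (symBasis i j k) (isSymTensor_symBasis i j k)
    (fun c => by simp [trace_symBasis, kdelta, hij, hjk, hik])
  rw [curvForm_symBasis lam (isSymTensor_symBasis i j k)] at this
  simp [symBasis, kdelta, hij, hjk, hik, hij.symm, hjk.symm, hik.symm] at this
  linarith

lemma CurvNonneg.pair {n : ℕ} {lam : Fin n → ℝ} (hl : CurvNonneg lam) {i m j : Fin n}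
    (him : i ≠ m) (hij : i ≠ j) (hmj : m ≠ j) :
    0 ≤ (3 + lam i ^ 2 + 2 * (lam i * lam j)) + (3 + lam m ^ 2 + 2 * (lam m * lam j)) := by
  have hs := (isSymTensor_symBasis i i j).add_smul (isSymTensor_symBasis m m j) 1 (-1)
  have := hl _ hs (fun c => by
    rw [sum_add_distrib, ← mul_sum, ← mul_sum, trace_symBasis, trace_symBasis]
    simp [kdelta, hij, hmj]; split_ifs <;> norm_num)
  rw [curvForm_add_smul_right, curvForm_symBasis lam hs, curvForm_symBasis lam hs] at this
  simp [symBasis, kdelta, hij, him, hmj, hij.symm, him.symm, hmj.symm] at this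
  linarith

section Degenerate

variable {n : ℕ} {lam : Fin n → ℝ} {h : Fin n → Fin n → Fin n → ℝ}

lemma CurvNonneg.eq_of_degenerate_distinct (hl : CurvNonneg lam) (hs : IsSymTensor h)
    (ht : IsTraceFree h) (h0 : curvForm lam h h = 0) {i j k : Fin n}
    (hij : i ≠ j) (hjk : j ≠ k) (hik : i ≠ k) :
    (3 + lam i * lam j + lam j * lam k + lam k * lam i) * h i j k = 0 := by
  have := hl.curvForm_eq_zero hs ht h0 (isSymTensor_symBasis i j k)
    (fun c => by simp [trace_symBasis, kdelta, hij, hjk, hik])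
  rw [curvForm_symBasis lam hs] at this
  linarith

lemma CurvNonneg.eq_of_degenerate_pair (hl : CurvNonneg lam) (hs : IsSymTensor h)
    (ht : IsTraceFree h) (h0 : curvForm lam h h = 0) {i j : Fin n} (hij : i ≠ j) :
    (3 + lam i ^ 2 + 2 * (lam i * lam j)) * h i i j = (1 + lam j ^ 2) * h j j j := by
  have ws := (isSymTensor_symBasis i i j).add_smul (isSymTensor_symBasis j j j) 3 (-1)
  have := hl.curvForm_eq_zero hs ht h0 ws (fun c => by
    rw [sum_add_distrib, ← mul_sum, ← mul_sum, trace_symBasis, trace_symBasis]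
    simp [kdelta, hij]; split_ifs <;> norm_num)
  rw [curvForm_add_smul_right, curvForm_symBasis lam hs, curvForm_symBasis lam hs] at this
  linarith

lemma three_le_sq_of_slopes {n : ℕ} {lam : Fin n → ℝ} {i m j : Fin n}
    (h1 : ∀ i j k, i ≠ j → j ≠ k → i ≠ k →
      0 ≤ 3 + lam i * lam j + lam j * lam k + lam k * lam i)
    (him : i ≠ m) (hij : i ≠ j) (hmj : m ≠ j) (hj : 0 < lam j)
    (hm : 3 + lam m ^ 2 + 2 * (lam m * lam j) < 0) (hi : lam i < lam m) (l : Fin n) :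
    3 ≤ lam l ^ 2 := by
  have hb : 3 < lam j ^ 2 := by nlinarith [sq_nonneg (lam m + lam j)]
  have hm0 : lam m < 0 := by nlinarith [sq_nonneg (lam m)]
  have hA := h1 m j i hmj hij.symm him.symm
  have hy : lam j < -lam m := by
    by_contra! hc
    nlinarith [mul_nonneg (sub_nonneg.2 hi.le) (by linarith : 0 ≤ lam m + lam j)]
  by_cases hlj : l = j
  · subst hlj; exact hb.le
  by_cases hlm : l = m
  · subst hlm; nlinarith
  have hB := h1 m j l hmj (Ne.symm hlj) (Ne.symm hlm)
  have hs3 : (Real.sqrt 3) ^ 2 = 3 := Real.sq_sqrt (by norm_num)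
  have hs0 : 0 < Real.sqrt 3 := by positivity
  have hbs : Real.sqrt 3 < lam j := by
    rw [Real.sqrt_lt' hj]; exact hb
  have hw : lam l ≤ -Real.sqrt 3 := by
    by_contra! hc
    nlinarith [mul_pos (sub_pos.2 hbs) (by linarith : 0 < -lam m + Real.sqrt 3),
      mul_pos (sub_pos.2 hc) (sub_pos.2 hy)]
  nlinarith

lemma three_le_sq_of_sum {n : ℕ} {lam c : Fin n → ℝ} {j : Fin n}
    (h1 : ∀ i j k, i ≠ j → j ≠ k → i ≠ k →
      0 ≤ 3 + lam i * lam j + lam j * lam k + lam k * lam i)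
    (h2 : ∀ i m j, i ≠ m → i ≠ j → m ≠ j →
      0 ≤ (3 + lam i ^ 2 + 2 * (lam i * lam j)) + (3 + lam m ^ 2 + 2 * (lam m * lam j)))
    (hc : ∀ i, i ≠ j → (3 + lam i ^ 2 + 2 * (lam i * lam j)) * c i = 1) (hcj : 0 < c j)
    (hsum : ∑ i, c i = 0) (hlsum : ∑ i, lam i * c i = 0) (hj : 0 ≤ lam j) (l : Fin n) :
    3 ≤ lam l ^ 2 := by
  obtain ⟨m, hm⟩ : ∃ m, c m < 0 := by
    by_contra! hcon
    have := Finset.sum_pos' (fun i _ => hcon i) ⟨j, mem_univ _, hcj⟩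
    linarith
  have hmj : m ≠ j := by rintro rfl; linarith
  have hcm : 3 + lam m ^ 2 + 2 * (lam m * lam j) < 0 := by
    by_contra! hcon; nlinarith [hc m hmj]
  have hj0 : 0 < lam j := by
    rcases hj.lt_or_eq with h | h
    · exact h
    · rw [← h] at hcm; nlinarith [sq_nonneg (lam m)]
  have hm0 : lam m < 0 := by nlinarith [sq_nonneg (lam m)]
  have hpos : ∀ i, i ≠ m → 0 < c i := by
    intro i him
    by_cases hij : i = j
    · rwa [hij]
    have := h2 i m j him hij hmj
    by_contra! hcon; nlinarith [hc i hij]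
  obtain ⟨i, him, hi⟩ : ∃ i, i ≠ m ∧ lam i < lam m := by
    by_contra! hcon
    have : 0 < ∑ i, (lam i - lam m) * c i := by
      refine Finset.sum_pos' (fun i _ => ?_) ⟨j, mem_univ _, mul_pos (by linarith) hcj⟩
      by_cases him : i = m
      · simp [him]
      · exact mul_nonneg (sub_nonneg.2 (hcon i him)) (hpos i him).le
    simp only [sub_mul, sum_sub_distrib, ← mul_sum, hsum, hlsum] at this
    simp at this
  have hij : i ≠ j := by rintro rfl; linarith
  exact three_le_sq_of_slopes h1 him hij hmj hj0 hcm hi l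

lemma CurvNonneg.degenerate_dichotomy (hl : CurvNonneg lam) (hs : IsSymTensor h)
    (ht : IsTraceFree h) (h0 : curvForm lam h h = 0) (hg : ∀ k, ∑ i, lam i * h i i k = 0) :
    (∀ i j k, h i j k = 0 ∨ 3 + lam i * lam j + lam j * lam k + lam k * lam i = 0) ∨
      ∀ l, 3 ≤ lam l ^ 2 := by
  by_cases hd : ∀ j, h j j j = 0
  · left
    have hp : ∀ i j, h i i j = 0 ∨ 3 + lam i * lam i + lam i * lam j + lam j * lam i = 0 := by
      intro i j
      by_cases hij : i = j
      · left; rw [hij]; exact hd j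
      have := hl.eq_of_degenerate_pair hs ht h0 hij
      rw [hd j, mul_zero, mul_eq_zero] at this
      rcases this with h | h
      · right; linarith
      · left; exact h
    intro i j k
    by_cases hij : i = j
    · subst hij; exact hp i k
    by_cases hjk : j = k
    · subst hjk
      rw [hs.1, hs.2]
      rcases hp j i with h | h
      · left; exact h
      · right; linarith
    by_cases hik : i = k
    · subst hik
      rw [hs.2]
      rcases hp i j with h | h
      · left; exact h
      · right; linarith
    have := hl.eq_of_degenerate_distinct hs ht h0 hij hjk hik
    rw [mul_eq_zero] at this
    exact this.symm
  · right
    push Not at hd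
    obtain ⟨j, hj⟩ := hd
    set μ := (1 + lam j ^ 2) * h j j j with hμ
    have hμ0 : μ ≠ 0 := mul_ne_zero (by positivity) hj
    have hcj : 0 < h j j j / μ := by
      rw [hμ, mul_comm, ← div_div, div_self hj]; positivity
    have hc : ∀ i, i ≠ j → (3 + lam i ^ 2 + 2 * (lam i * lam j)) * (h i i j / μ) = 1 := by
      intro i hij
      rw [← mul_div_assoc, hl.eq_of_degenerate_pair hs ht h0 hij, ← hμ, div_self hμ0]
    have hsum : ∑ i, h i i j / μ = 0 := by rw [← sum_div, ht j, zero_div]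
    have hlsum : ∑ i, lam i * (h i i j / μ) = 0 := by
      simp_rw [← mul_div_assoc]; rw [← sum_div, hg j, zero_div]
    intro l
    rcases le_total 0 (lam j) with hj0 | hj0
    · exact three_le_sq_of_sum (fun i j k => hl.distinct) (fun i m j => hl.pair) hc hcj hsum hlsum
        hj0 l
    · have := three_le_sq_of_sum (lam := fun i => - lam i) (c := fun i => h i i j / μ) (j := j)
        (fun i j k a b c => by simpa using hl.distinct a b c)
        (fun i m j a b c => by simpa using hl.pair a b c)
        (fun i hij => by simpa using hc i hij) hcj hsum (by simpa using hlsum) (by simpa using hj0) l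
      simpa using this

end Degenerate

end CurvatureForm

section GradientEstimates

open Finset

/-- `Σ h_{ijk}²`. -/
def tensorSq {n : ℕ} (h : Fin n → Fin n → Fin n → ℝ) : ℝ := ∑ i, ∑ j, ∑ k, h i j k ^ 2

/-- Squared length of `k ↦ Σᵢ λᵢ h_{iik}`. -/
def gradSq {n : ℕ} (lam : Fin n → ℝ) (h : Fin n → Fin n → Fin n → ℝ) : ℝ :=
  ∑ k, (∑ i, lam i * h i i k) ^ 2

/-- The Laplacian of `½ tr (1 + H²)⁻¹` in an eigenframe. -/
noncomputable def metricLap {n : ℕ} (lam : Fin n → ℝ) (h : Fin n → Fin n → Fin n → ℝ) : ℝ :=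
  ∑ i, ∑ j, ∑ k, (lam i ^ 2 * lam j ^ 2 - 1) *
    ((1 + lam i ^ 2)⁻¹ * (1 + lam j ^ 2)⁻¹) * h i j k ^ 2

/-- The weighted divergence of the slope field in an eigenframe. -/
noncomputable def slopeDiv {n : ℕ} (lam : Fin n → ℝ) (h : Fin n → Fin n → Fin n → ℝ) : ℝ :=
  ∑ k, (1 + lam k ^ 2) * (∑ i, lam i * h i i k) ^ 2 +
    ∑ i, ∑ j, ∑ k, (1 - lam i * lam j) * (1 + lam k ^ 2) * h i j k ^ 2

/-- The slope field in an eigenframe, up to the factor `√(1 + λₖ²)`. -/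
noncomputable def slopeField {n : ℕ} (lam : Fin n → ℝ) (h : Fin n → Fin n → Fin n → ℝ)
    (k : Fin n) : ℝ :=
  ∑ i, lam i * h i i k - lam k * (1 + lam k ^ 2)⁻¹ * ∑ i, (1 + lam i ^ 2) * h i i k

/-- The weight `Σ (3 / (1 + λᵢ²))^ν`. -/
noncomputable def slopeWeight {n : ℕ} (ν : ℕ) (lam : Fin n → ℝ) : ℝ :=
  ∑ i, (3 * (1 + lam i ^ 2)⁻¹) ^ ν

/-- The gradient of the weight in an eigenframe, up to the factor `√(1 + λₖ²)`. -/
noncomputable def slopeWeightGrad {n : ℕ} (ν : ℕ) (lam : Fin n → ℝ)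
    (h : Fin n → Fin n → Fin n → ℝ) (k : Fin n) : ℝ :=
  -2 * ν * ∑ i, lam i * (3 * (1 + lam i ^ 2)⁻¹) ^ ν * h i i k

/-- The density that has to dominate `|h|²` modulo the curvature form. -/
noncomputable def slopeDensity {n : ℕ} (κ : ℝ) (ν : ℕ) (lam : Fin n → ℝ)
    (h : Fin n → Fin n → Fin n → ℝ) : ℝ :=
  metricLap lam h + (slopeWeight ν lam * slopeDiv lam h +
    ∑ k, (1 + lam k ^ 2) * (slopeWeightGrad ν lam h k * slopeField lam h k)) -
    κ * slopeWeight ν lam ^ 2 * ∑ k, (1 + lam k ^ 2) * slopeField lam h k ^ 2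

lemma IsCompact.exists_add_const_mul_nonneg {X : Type*} [TopologicalSpace X] {S : Set X}
    (hS : IsCompact S) {p d : X → ℝ} (hp : Continuous p) (hd : Continuous d)
    (hd0 : ∀ x ∈ S, 0 ≤ d x) (h : ∀ x ∈ S, d x = 0 → 0 < p x) :
    ∃ C, 0 ≤ C ∧ ∀ x ∈ S, 0 ≤ p x + C * d x := by
  have hT : IsCompact (S ∩ {x | p x ≤ 0}) := hS.inter_right (isClosed_le hp continuous_const)
  rcases (S ∩ {x | p x ≤ 0}).eq_empty_or_nonempty with he | hne
  · refine ⟨0, le_rfl, fun x hx => ?_⟩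
    have : x ∉ S ∩ {x | p x ≤ 0} := by rw [he]; simp
    simp [hx] at this
    linarith
  · obtain ⟨a, ha, hamin⟩ := hT.exists_isMinOn hne hd.continuousOn
    obtain ⟨b, hb, hbmin⟩ := hT.exists_isMinOn hne hp.continuousOn
    have hda : 0 < d a := by
      rcases (hd0 a ha.1).lt_or_eq with h1 | h1
      · exact h1
      · exact absurd (h a ha.1 h1.symm) (not_lt.2 ha.2)
    have hpb : p b ≤ 0 := hb.2
    refine ⟨-p b / d a, div_nonneg (by linarith) hda.le, fun x hx => ?_⟩
    by_cases hxp : p x ≤ 0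
    · have h1 : d a ≤ d x := hamin ⟨hx, hxp⟩
      have h2 : p b ≤ p x := hbmin ⟨hx, hxp⟩
      have : -p b ≤ -p b / d a * d x := by
        rw [div_mul_eq_mul_div, le_div_iff₀ hda]
        exact mul_le_mul_of_nonneg_left h1 (by linarith)
      linarith
    · have := mul_nonneg (div_nonneg (by linarith : 0 ≤ -p b) hda.le) (hd0 x hx)
      linarith

section Degenerate

variable {n : ℕ} {lam : Fin n → ℝ} {h : Fin n → Fin n → Fin n → ℝ}

lemma IsSymTensor.sum_rotate (hs : IsSymTensor h) (f : Fin n → Fin n → Fin n → ℝ) :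
    ∑ i, ∑ j, ∑ k, f i j k * h i j k ^ 2 = ∑ i, ∑ j, ∑ k, f j k i * h i j k ^ 2 := by
  have : ∑ i, ∑ j, ∑ k, f j k i * h i j k ^ 2 = ∑ k, ∑ i, ∑ j, f i j k * h k i j ^ 2 := rfl
  rw [this]
  symm
  rw [sum_comm]
  refine sum_congr rfl fun i _ => ?_
  rw [sum_comm]
  refine sum_congr rfl fun j _ => sum_congr rfl fun k _ => ?_
  rw [hs.1 k i j, hs.2 i k j]

lemma sum_mul_sq_le {f g : Fin n → Fin n → Fin n → ℝ} (h : Fin n → Fin n → Fin n → ℝ)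
    (hfg : ∀ i j k, f i j k * h i j k ^ 2 ≤ g i j k * h i j k ^ 2) :
    ∑ i, ∑ j, ∑ k, f i j k * h i j k ^ 2 ≤ ∑ i, ∑ j, ∑ k, g i j k * h i j k ^ 2 :=
  sum_le_sum fun i _ => sum_le_sum fun j _ => sum_le_sum fun k _ => hfg i j k

lemma const_mul_tensorSq (c : ℝ) (h : Fin n → Fin n → Fin n → ℝ) :
    c * tensorSq h = ∑ i, ∑ j, ∑ k, c * h i j k ^ 2 := by
  simp only [tensorSq, mul_sum]

lemma tensorSq_nonneg (h : Fin n → Fin n → Fin n → ℝ) : 0 ≤ tensorSq h :=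
  sum_nonneg fun _ _ => sum_nonneg fun _ _ => sum_nonneg fun _ _ => sq_nonneg _

lemma sq_le_tensorSq (h : Fin n → Fin n → Fin n → ℝ) (i j k : Fin n) :
    h i j k ^ 2 ≤ tensorSq h := by
  refine le_trans ?_ (single_le_sum (f := fun i => ∑ j, ∑ k, h i j k ^ 2)
    (fun _ _ => sum_nonneg fun _ _ => sum_nonneg fun _ _ => sq_nonneg _) (mem_univ i))
  refine le_trans ?_ (single_le_sum (f := fun j => ∑ k, h i j k ^ 2)
    (fun j _ => sum_nonneg fun k _ => sq_nonneg _) (mem_univ j))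
  exact single_le_sum (f := fun k => h i j k ^ 2) (fun k _ => sq_nonneg _) (mem_univ k)

lemma three_le_slopeDiv (hs : IsSymTensor h)
    (hd : ∀ i j k, h i j k = 0 ∨ 3 + lam i * lam j + lam j * lam k + lam k * lam i = 0) :
    3 * tensorSq h ≤ slopeDiv lam h := by
  have h1 : 9 * tensorSq h ≤
      3 * ∑ i, ∑ j, ∑ k, (1 - lam i * lam j) * (1 + lam k ^ 2) * h i j k ^ 2 := by
    have e1 := hs.sum_rotate fun i j k => (1 - lam i * lam j) * (1 + lam k ^ 2)
    have e2 := hs.sum_rotate fun i j k => (1 - lam j * lam k) * (1 + lam i ^ 2)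
    have : 3 * ∑ i, ∑ j, ∑ k, (1 - lam i * lam j) * (1 + lam k ^ 2) * h i j k ^ 2 =
        ∑ i, ∑ j, ∑ k, ((1 - lam i * lam j) * (1 + lam k ^ 2) +
          (1 - lam j * lam k) * (1 + lam i ^ 2) +
          (1 - lam k * lam i) * (1 + lam j ^ 2)) * h i j k ^ 2 := by
      simp only [add_mul _ _ (h _ _ _ ^ 2), sum_add_distrib]
      rw [← e2, ← e1]; ring
    rw [this, const_mul_tensorSq]
    refine sum_mul_sq_le h fun i j k => ?_
    rcases hd i j k with h0 | h0
    · simp [h0]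
    · refine mul_le_mul_of_nonneg_right ?_ (sq_nonneg _)
      have e : lam i * lam j + lam j * lam k + lam k * lam i = -3 := by linarith
      have h3 : 3 * ((lam i + lam j + lam k) * (lam i * lam j * lam k)) ≤
          (lam i * lam j + lam j * lam k + lam k * lam i) ^ 2 := by
        nlinarith [sq_nonneg (lam i * lam j - lam j * lam k),
          sq_nonneg (lam j * lam k - lam k * lam i), sq_nonneg (lam k * lam i - lam i * lam j)]
      rw [e] at h3
      have h4 : lam i ^ 2 + lam j ^ 2 + lam k ^ 2 = (lam i + lam j + lam k) ^ 2 + 6 := by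
        linear_combination (-2) * e
      nlinarith [sq_nonneg (lam i + lam j + lam k)]
  have h2 : 0 ≤ ∑ k, (1 + lam k ^ 2) * (∑ i, lam i * h i i k) ^ 2 :=
    sum_nonneg fun k _ => by positivity
  rw [slopeDiv]
  linarith

lemma slopeField_eq_zero (ht : IsTraceFree h) (hg : ∀ k, ∑ i, lam i * h i i k = 0)
    (hd : ∀ i j k, h i j k = 0 ∨ 3 + lam i * lam j + lam j * lam k + lam k * lam i = 0)
    (k : Fin n) : slopeField lam h k = 0 := by
  have : ∑ i, (1 + lam i ^ 2) * h i i k = ∑ i, (-2 * h i i k - 2 * lam k * (lam i * h i i k)) := by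
    refine sum_congr rfl fun i _ => ?_
    rcases hd i i k with h0 | h0
    · simp [h0]
    · linear_combination h i i k * h0
  rw [slopeField, this, sum_sub_distrib, ← mul_sum, ← mul_sum, ht k, hg k]
  simp

lemma metricLap_ge {K a : ℝ} (ha : 1 ≤ a) (hK : ∀ i, lam i ^ 2 ≤ K)
    (hl : ∀ i, a ≤ lam i ^ 2) (h : Fin n → Fin n → Fin n → ℝ) :
    (a ^ 2 - 1) * ((1 + K) ^ 2)⁻¹ * tensorSq h ≤ metricLap lam h := by
  rw [const_mul_tensorSq, metricLap]
  refine sum_mul_sq_le h fun i j k => mul_le_mul_of_nonneg_right ?_ (sq_nonneg _)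
  have h1 : a ^ 2 ≤ lam i ^ 2 * lam j ^ 2 := by
    rw [sq]; exact mul_le_mul (hl i) (hl j) (by linarith) (by positivity)
  refine mul_le_mul (by linarith) ?_ (by positivity) (by nlinarith)
  rw [← mul_inv]
  refine inv_anti₀ (by positivity) ?_
  rw [sq (1 + K)]
  exact mul_le_mul (by linarith [hK i]) (by linarith [hK j]) (by positivity)
    (by linarith [sq_nonneg (lam i), hK i])

lemma neg_tensorSq_le_metricLap (lam : Fin n → ℝ) (h : Fin n → Fin n → Fin n → ℝ) :
    -tensorSq h ≤ metricLap lam h := by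
  rw [← neg_one_mul, const_mul_tensorSq, metricLap]
  refine sum_mul_sq_le h fun i j k => mul_le_mul_of_nonneg_right ?_ (sq_nonneg _)
  rw [← mul_inv, ← div_eq_mul_inv, le_div_iff₀ (by positivity)]
  nlinarith [sq_nonneg (lam i * lam j), sq_nonneg (lam i), sq_nonneg (lam j)]

lemma slopeWeight_nonneg (ν : ℕ) (lam : Fin n → ℝ) : 0 ≤ slopeWeight ν lam :=
  sum_nonneg fun i _ => by positivity

lemma slopeDensity_case_sum {K κ : ℝ} {ν : ℕ} (hs : IsSymTensor h) (ht : IsTraceFree h)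
    (hg : ∀ k, ∑ i, lam i * h i i k = 0) (hK : ∀ i, lam i ^ 2 ≤ K) (hK0 : 0 ≤ K)
    (hd : ∀ i j k, h i j k = 0 ∨ 3 + lam i * lam j + lam j * lam k + lam k * lam i = 0) :
    2 * ((1 + K) ^ 2)⁻¹ * tensorSq h ≤ slopeDensity κ ν lam h := by
  have hX := slopeField_eq_zero ht hg hd
  have hq := three_le_slopeDiv hs hd
  have hN := tensorSq_nonneg h
  have hm := slopeWeight_nonneg ν lam
  simp only [slopeDensity, hX]
  simp only [mul_zero, sum_const_zero, ne_eq, OfNat.ofNat_ne_zero, not_false_eq_true, zero_pow,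
    add_zero, sub_zero]
  have hc : ((1 + K) ^ 2)⁻¹ ≤ 1 := inv_le_one_of_one_le₀ (by nlinarith)
  have hc0 : 0 < ((1 + K) ^ 2)⁻¹ := by positivity
  by_cases hex : ∃ i, lam i ^ 2 ≤ 2
  · obtain ⟨i, hi⟩ := hex
    have hm1 : 1 ≤ slopeWeight ν lam := by
      refine le_trans ?_ (single_le_sum (f := fun i => (3 * (1 + lam i ^ 2)⁻¹) ^ ν)
        (fun i _ => by positivity) (mem_univ i))
      refine one_le_pow₀ ?_
      rw [← div_eq_mul_inv, one_le_div (by positivity)]; linarith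
    have := neg_tensorSq_le_metricLap lam h
    nlinarith [mul_le_mul_of_nonneg_right hc hN]
  · push Not at hex
    have := metricLap_ge (by norm_num : (1 : ℝ) ≤ 2) hK (fun i => (hex i).le) h
    have h2 : 0 ≤ slopeWeight ν lam * slopeDiv lam h := mul_nonneg hm (by linarith)
    nlinarith [mul_nonneg hc0.le hN]

lemma slopeDiv_ge {K : ℝ} (hK : ∀ i, lam i ^ 2 ≤ K) (hK0 : 0 ≤ K)
    (h : Fin n → Fin n → Fin n → ℝ) : -(1 + K) ^ 2 * tensorSq h ≤ slopeDiv lam h := by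
  have h2 : 0 ≤ ∑ k, (1 + lam k ^ 2) * (∑ i, lam i * h i i k) ^ 2 :=
    sum_nonneg fun k _ => by positivity
  have : -(1 + K) ^ 2 * tensorSq h ≤
      ∑ i, ∑ j, ∑ k, (1 - lam i * lam j) * (1 + lam k ^ 2) * h i j k ^ 2 := by
    rw [const_mul_tensorSq]
    refine sum_mul_sq_le h fun i j k => mul_le_mul_of_nonneg_right ?_ (sq_nonneg _)
    have h3 : lam i * lam j ≤ K := by nlinarith [sq_nonneg (lam i - lam j), hK i, hK j]
    nlinarith [hK k, mul_nonneg hK0 (sub_nonneg.2 (hK k)),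
      mul_nonneg (sub_nonneg.2 h3) (by positivity : 0 ≤ 1 + lam k ^ 2)]
  rw [slopeDiv]; linarith

end Degenerate

end GradientEstimates

section Degeneration

open Finset

section Degenerate

variable {n : ℕ} {lam : Fin n → ℝ} {h : Fin n → Fin n → Fin n → ℝ}

lemma abs_sum_le_card_mul {f : Fin n → ℝ} {B : ℝ} (hf : ∀ i, |f i| ≤ B) :
    |∑ i, f i| ≤ n * B := by
  refine (abs_sum_le_sum_abs _ _).trans ((sum_le_sum fun i _ => hf i).trans ?_)
  simp

lemma abs_le_one_add_sq (a : ℝ) : |a| ≤ 1 + a ^ 2 := by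
  rw [← sq_abs]; nlinarith [sq_nonneg (|a| - 1), abs_nonneg a]

lemma slopeWeight_term_le (hl : ∀ l, 3 ≤ lam l ^ 2) (ν : ℕ) (i : Fin n) :
    (3 * (1 + lam i ^ 2)⁻¹) ^ ν ≤ (3 / 4 : ℝ) ^ ν := by
  refine pow_le_pow_left₀ (by positivity) ?_ ν
  rw [← div_eq_mul_inv]
  exact div_le_div_of_nonneg_left (by norm_num) (by norm_num) (by linarith [hl i])

/-- The error made by dropping the weighted terms of `slopeDensity` for large slopes. -/
noncomputable def slopeError (n : ℕ) (L κ : ℝ) (ν : ℕ) : ℝ :=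
  n * (3 / 4 : ℝ) ^ ν * (1 + L) ^ 2 +
    n * ((1 + L) * (2 * ν * (n * ((1 + L) * (3 / 4 : ℝ) ^ ν)) * (n * (1 + L)))) +
    κ * (n * (3 / 4 : ℝ) ^ ν) ^ 2 * (n * ((1 + L) * (n * (1 + L)) ^ 2))

lemma tendsto_slopeError (n : ℕ) (L κ : ℝ) :
    Filter.Tendsto (slopeError n L κ) Filter.atTop (nhds 0) := by
  have h1 : Filter.Tendsto (fun ν : ℕ => (3 / 4 : ℝ) ^ ν) Filter.atTop (nhds 0) :=
    tendsto_pow_atTop_nhds_zero_of_lt_one (by norm_num) (by norm_num)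
  have h2 : Filter.Tendsto (fun ν : ℕ => (ν : ℝ) * (3 / 4 : ℝ) ^ ν) Filter.atTop (nhds 0) :=
    tendsto_self_mul_const_pow_of_lt_one (by norm_num) (by norm_num)
  have h3 := ((h1.const_mul (n * (1 + L) ^ 2)).add
    (h2.const_mul (2 * n ^ 3 * (1 + L) ^ 3))).add
    ((h1.pow 2).const_mul (κ * n ^ 5 * (1 + L) ^ 3))
  simp only [mul_zero, ne_eq, OfNat.ofNat_ne_zero, not_false_eq_true, zero_pow, add_zero] at h3
  refine h3.congr fun ν => ?_
  rw [slopeError]; ring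

lemma slopeDensity_case_large {L κ : ℝ} {ν : ℕ} (hκ : 0 ≤ κ)
    (hg : ∀ k, ∑ i, lam i * h i i k = 0) (hL : ∀ i, lam i ^ 2 ≤ L) (hL0 : 0 ≤ L)
    (hN : tensorSq h = 1) (hl : ∀ l, 3 ≤ lam l ^ 2) :
    8 * ((1 + L) ^ 2)⁻¹ - slopeError n L κ ν ≤ slopeDensity κ ν lam h := by
  set t := (3 / 4 : ℝ) ^ ν with ht
  have ht0 : 0 ≤ t := by positivity
  have hh : ∀ i j k, |h i j k| ≤ 1 := fun i j k => by
    rw [← sq_le_one_iff_abs_le_one, ← hN]; exact sq_le_tensorSq h i j k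
  have hmet := metricLap_ge (by norm_num : (1 : ℝ) ≤ 3) hL hl h
  have hdiv := slopeDiv_ge hL hL0 h
  rw [hN] at hmet hdiv
  have hm0 := slopeWeight_nonneg ν lam
  have hm : slopeWeight ν lam ≤ n * t := by
    have := abs_sum_le_card_mul (f := fun i => (3 * (1 + lam i ^ 2)⁻¹) ^ ν) (B := t) fun i => by
      rw [abs_of_nonneg (by positivity)]; exact slopeWeight_term_le hl ν i
    exact (le_abs_self _).trans this
  have hla : ∀ i, |lam i| ≤ 1 + L := fun i => (abs_le_one_add_sq _).trans (by linarith [hL i])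
  have hM : ∀ k, |slopeWeightGrad ν lam h k| ≤ 2 * ν * (n * ((1 + L) * t)) := by
    intro k
    rw [slopeWeightGrad, abs_mul, abs_mul, abs_neg, abs_two, Nat.abs_cast]
    refine mul_le_mul_of_nonneg_left (abs_sum_le_card_mul fun i => ?_) (by positivity)
    rw [abs_mul, abs_mul, abs_of_nonneg (by positivity : 0 ≤ (3 * (1 + lam i ^ 2)⁻¹) ^ ν)]
    calc |lam i| * (3 * (1 + lam i ^ 2)⁻¹) ^ ν * |h i i k|
        ≤ |lam i| * (3 * (1 + lam i ^ 2)⁻¹) ^ ν * 1 :=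
          mul_le_mul_of_nonneg_left (hh i i k) (by positivity)
      _ ≤ (1 + L) * t := by
          rw [mul_one]
          exact mul_le_mul (hla i) (slopeWeight_term_le hl ν i) (by positivity) (by linarith)
  have hX : ∀ k, |slopeField lam h k| ≤ n * (1 + L) := by
    intro k
    rw [slopeField, hg k, zero_sub, abs_neg, abs_mul]
    have h1 : |lam k * (1 + lam k ^ 2)⁻¹| ≤ 1 := by
      rw [abs_mul, abs_of_nonneg (by positivity : 0 ≤ (1 + lam k ^ 2)⁻¹), ← div_eq_mul_inv,
        div_le_one (by positivity)]
      exact abs_le_one_add_sq _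
    have h2 : |∑ i, (1 + lam i ^ 2) * h i i k| ≤ n * (1 + L) := by
      refine abs_sum_le_card_mul fun i => ?_
      rw [abs_mul, abs_of_nonneg (by positivity : 0 ≤ 1 + lam i ^ 2)]
      nlinarith [hh i i k, hL i, sq_nonneg (lam i), abs_nonneg (h i i k)]
    nlinarith [abs_nonneg (∑ i, (1 + lam i ^ 2) * h i i k)]
  have hMX : |∑ k, (1 + lam k ^ 2) * (slopeWeightGrad ν lam h k * slopeField lam h k)| ≤
      n * ((1 + L) * (2 * ν * (n * ((1 + L) * t)) * (n * (1 + L)))) := by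
    refine abs_sum_le_card_mul fun k => ?_
    rw [abs_mul, abs_mul, abs_of_nonneg (by positivity : 0 ≤ 1 + lam k ^ 2)]
    exact mul_le_mul (by linarith [hL k]) (mul_le_mul (hM k) (hX k) (abs_nonneg _)
      (by positivity)) (by positivity) (by linarith)
  have hXX : |∑ k, (1 + lam k ^ 2) * slopeField lam h k ^ 2| ≤
      n * ((1 + L) * (n * (1 + L)) ^ 2) := by
    refine abs_sum_le_card_mul fun k => ?_
    rw [abs_mul, abs_of_nonneg (by positivity : 0 ≤ 1 + lam k ^ 2), abs_pow]
    exact mul_le_mul (by linarith [hL k]) (pow_le_pow_left₀ (abs_nonneg _) (hX k) 2)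
      (by positivity) (by linarith)
  have e1 : -(n * t * (1 + L) ^ 2) ≤ slopeWeight ν lam * slopeDiv lam h := by
    nlinarith [mul_le_mul_of_nonneg_left hdiv hm0, mul_le_mul_of_nonneg_right hm
      (sq_nonneg (1 + L))]
  have e2 : κ * slopeWeight ν lam ^ 2 * ∑ k, (1 + lam k ^ 2) * slopeField lam h k ^ 2 ≤
      κ * (n * t) ^ 2 * (n * ((1 + L) * (n * (1 + L)) ^ 2)) := by
    refine mul_le_mul (mul_le_mul_of_nonneg_left (pow_le_pow_left₀ hm0 hm 2) hκ)
      ((le_abs_self _).trans hXX) (sum_nonneg fun k _ => by positivity) (by positivity)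
  have e3 := (abs_le.1 hMX).1
  rw [slopeDensity, slopeError, ← ht]
  norm_num at hmet
  linarith

lemma CurvNonneg.slopeDensity_pos_of_degenerate {L κ : ℝ} {ν : ℕ} (hκ : 0 ≤ κ) (hL0 : 0 ≤ L)
    (hν : slopeError n L κ ν ≤ ((1 + L) ^ 2)⁻¹) (hl : CurvNonneg lam)
    (hL : ∀ i, lam i ^ 2 ≤ L) (hs : IsSymTensor h) (ht : IsTraceFree h) (hN : tensorSq h = 1)
    (h0 : curvForm lam h h + gradSq lam h = 0) :
    ((1 + L) ^ 2)⁻¹ < slopeDensity κ ν lam h := by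
  have hq := hl h hs ht
  have hg0 : 0 ≤ gradSq lam h := sum_nonneg fun k _ => sq_nonneg _
  have hq0 : curvForm lam h h = 0 := by linarith
  have hg : ∀ k, ∑ i, lam i * h i i k = 0 := by
    have : gradSq lam h = 0 := by linarith
    rw [gradSq, sum_eq_zero_iff_of_nonneg fun k _ => sq_nonneg _] at this
    intro k
    simpa using this k (mem_univ k)
  have hc : 0 < ((1 + L) ^ 2)⁻¹ := by positivity
  rcases hl.degenerate_dichotomy hs ht hq0 hg with hd | hd
  · have := slopeDensity_case_sum (κ := κ) (ν := ν) hs ht hg hL hL0 hd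
    rw [hN] at this; linarith
  · have := slopeDensity_case_large (ν := ν) hκ hg hL hL0 hN hd
    linarith

end Degenerate

section Scaling

variable {n : ℕ} (lam : Fin n → ℝ) (h : Fin n → Fin n → Fin n → ℝ) (t : ℝ)

lemma slopeField_smul (k : Fin n) :
    slopeField lam (fun i j k => t * h i j k) k = t * slopeField lam h k := by
  simp only [slopeField, mul_left_comm _ t, ← mul_sum]; ring

lemma slopeWeightGrad_smul (ν : ℕ) (k : Fin n) :
    slopeWeightGrad ν lam (fun i j k => t * h i j k) k = t * slopeWeightGrad ν lam h k := by
  simp only [slopeWeightGrad, mul_left_comm _ t, ← mul_sum]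

lemma slopeDiv_smul : slopeDiv lam (fun i j k => t * h i j k) = t ^ 2 * slopeDiv lam h := by
  simp only [slopeDiv, mul_left_comm _ t, ← mul_sum, mul_pow, mul_left_comm _ (t ^ 2)]; ring

lemma slopeDensity_smul (κ : ℝ) (ν : ℕ) :
    slopeDensity κ ν lam (fun i j k => t * h i j k) = t ^ 2 * slopeDensity κ ν lam h := by
  have h1 : metricLap lam (fun i j k => t * h i j k) = t ^ 2 * metricLap lam h := by
    simp only [metricLap, mul_pow, mul_left_comm _ (t ^ 2), ← mul_sum]
  have h2 : ∀ a b c : ℝ, a * (t * b * (t * c)) = t ^ 2 * (a * (b * c)) := fun a b c => by ring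
  simp only [slopeDensity, h1, slopeDiv_smul, slopeField_smul, slopeWeightGrad_smul, h2, mul_pow,
    mul_left_comm _ (t ^ 2), ← mul_sum]
  ring

lemma curvForm_add_gradSq_smul :
    curvForm lam (fun i j k => t * h i j k) (fun i j k => t * h i j k) +
      gradSq lam (fun i j k => t * h i j k) =
    t ^ 2 * (curvForm lam h h + gradSq lam h) := by
  rw [mul_add]
  congr 1
  · simp only [curvForm, mul_sum]
    refine sum_congr rfl fun i _ => sum_congr rfl fun j _ => sum_congr rfl fun k _ => ?_
    ring
  · simp only [gradSq, mul_left_comm _ t, mul_pow, ← mul_sum]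

lemma tensorSq_smul : tensorSq (fun i j k => t * h i j k) = t ^ 2 * tensorSq h := by
  simp only [tensorSq, mul_pow, ← mul_sum]

end Scaling

lemma isCompact_normalized_tensors (n : ℕ) (L : ℝ) :
    IsCompact {p : (Fin n → ℝ) × (Fin n → Fin n → Fin n → ℝ) |
      (∀ i, p.1 i ^ 2 ≤ L) ∧ CurvNonneg p.1 ∧ IsSymTensor p.2 ∧ IsTraceFree p.2 ∧
        tensorSq p.2 = 1} := by
  refine Metric.isCompact_of_isClosed_isBounded ?_ ?_
  · simp only [IsSymTensor, IsTraceFree, tensorSq, Set.ofPred_and, Set.ofPred_forall, CurvNonneg,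
      curvForm]
    refine IsClosed.inter (isClosed_iInter fun i => isClosed_le (by fun_prop) (by fun_prop)) ?_
    refine IsClosed.inter (isClosed_iInter fun w => isClosed_iInter fun _ => isClosed_iInter
      fun _ => isClosed_le (by fun_prop) (by fun_prop)) ?_
    refine IsClosed.inter (IsClosed.inter ?_ ?_) (IsClosed.inter ?_ ?_)
    · exact isClosed_iInter fun i => isClosed_iInter fun j => isClosed_iInter fun k =>
        isClosed_eq (by fun_prop) (by fun_prop)
    · exact isClosed_iInter fun i => isClosed_iInter fun j => isClosed_iInter fun k =>
        isClosed_eq (by fun_prop) (by fun_prop)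
    · exact isClosed_iInter fun i => isClosed_eq (by fun_prop) (by fun_prop)
    · exact isClosed_eq (by fun_prop) (by fun_prop)
  · refine (Metric.isBounded_closedBall (x := 0) (r := 1 + |L|)).subset ?_
    rintro ⟨a, h⟩ ⟨ha, -, -, -, hN⟩
    simp only at ha hN
    rw [mem_closedBall_zero_iff, Prod.norm_def]
    have h0 : 0 ≤ 1 + |L| := by positivity
    refine max_le ((pi_norm_le_iff_of_nonneg h0).2 fun i => ?_)
      ((pi_norm_le_iff_of_nonneg h0).2 fun i => (pi_norm_le_iff_of_nonneg h0).2 fun j =>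
        (pi_norm_le_iff_of_nonneg h0).2 fun k => ?_)
    · exact (abs_le_one_add_sq _).trans (by linarith [ha i, le_abs_self L])
    · have : |h i j k| ≤ 1 := by
        rw [← sq_le_one_iff_abs_le_one, ← hN]; exact sq_le_tensorSq h i j k
      exact this.trans (by linarith [abs_nonneg L])

lemma continuous_slopeDensity (n : ℕ) (κ : ℝ) (ν : ℕ) :
    Continuous fun p : (Fin n → ℝ) × (Fin n → Fin n → Fin n → ℝ) =>
      slopeDensity κ ν p.1 p.2 := by
  have hinv : ∀ i, Continuous fun p : (Fin n → ℝ) × (Fin n → Fin n → Fin n → ℝ) =>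
      (1 + p.1 i ^ 2)⁻¹ := fun i =>
    Continuous.inv₀ (by fun_prop) fun p => by positivity
  simp only [slopeDensity, metricLap, slopeWeight, slopeDiv, slopeWeightGrad, slopeField]
  fun_prop

/-- On slopes with nonnegative curvature form, `slopeDensity` controls `|h|²` up to the
curvature form and the gradient. -/
theorem exists_slopeDensity_bound (n : ℕ) {L κ : ℝ} (hL : 0 ≤ L) (hκ : 0 ≤ κ) :
    ∃ ν : ℕ, ∃ C : ℝ, 0 ≤ C ∧ ∀ lam : Fin n → ℝ, (∀ i, lam i ^ 2 ≤ L) → CurvNonneg lam →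
      ∀ h, IsSymTensor h → IsTraceFree h →
        ((1 + L) ^ 2)⁻¹ * tensorSq h ≤
          slopeDensity κ ν lam h + C * (curvForm lam h h + gradSq lam h) := by
  have hc : 0 < ((1 + L) ^ 2)⁻¹ := by positivity
  obtain ⟨ν, hν⟩ := ((tendsto_slopeError n L κ).eventually_le_const hc).exists
  refine ⟨ν, ?_⟩
  obtain ⟨C, hC, H⟩ := (isCompact_normalized_tensors n L).exists_add_const_mul_nonneg
    (p := fun p => slopeDensity κ ν p.1 p.2 - ((1 + L) ^ 2)⁻¹)
    (d := fun p => curvForm p.1 p.2 p.2 + gradSq p.1 p.2)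
    ((continuous_slopeDensity n κ ν).sub continuous_const)
    (by simp only [curvForm, gradSq]; fun_prop)
    (fun p hp => add_nonneg (hp.2.1 p.2 hp.2.2.1 hp.2.2.2.1) (sum_nonneg fun k _ => sq_nonneg _))
    (fun p hp h0 => sub_pos.2 (hp.2.1.slopeDensity_pos_of_degenerate hκ hL hν hp.1 hp.2.2.1
      hp.2.2.2.1 hp.2.2.2.2 h0))
  refine ⟨C, hC, fun lam hlam hcurv h hs ht => ?_⟩
  rcases (tensorSq_nonneg h).lt_or_eq with hN | hN
  · set t := (Real.sqrt (tensorSq h))⁻¹ with htdef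
    have ht2 : t ^ 2 = (tensorSq h)⁻¹ := by rw [htdef, inv_pow, Real.sq_sqrt hN.le]
    have hNt : t ^ 2 * tensorSq h = 1 := by rw [ht2]; exact inv_mul_cancel₀ hN.ne'
    have := H (lam, fun i j k => t * h i j k) ⟨hlam, hcurv,
      ⟨fun i j k => by simp only [hs.1 i j], fun i j k => by simp only [hs.2 i j]⟩,
      fun k => by simp only [← mul_sum, ht k, mul_zero], by
        simp only [tensorSq_smul, hNt]⟩
    simp only [slopeDensity_smul, curvForm_add_gradSq_smul] at this
    have h3 := mul_nonneg hN.le this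
    have : tensorSq h * (t ^ 2 * slopeDensity κ ν lam h - ((1 + L) ^ 2)⁻¹ +
        C * (t ^ 2 * (curvForm lam h h + gradSq lam h))) =
        (t ^ 2 * tensorSq h) * (slopeDensity κ ν lam h + C * (curvForm lam h h + gradSq lam h)) -
          ((1 + L) ^ 2)⁻¹ * tensorSq h := by ring
    rw [this, hNt] at h3
    linarith
  · have h0 : h = fun i j k => 0 * h i j k := by
      funext i j k
      have := sq_le_tensorSq h i j k
      rw [← hN] at this
      rw [zero_mul]
      nlinarith
    rw [← hN]
    have e1 := slopeDensity_smul lam h 0 κ ν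
    have e2 := curvForm_add_gradSq_smul lam h 0
    rw [← h0] at e1 e2
    rw [e1, e2]; simp

end Degeneration

section PartialDerivatives

open Finset
open scoped ContDiff

/-- The partial derivative in the `k`-th coordinate direction. -/
noncomputable def pd {n : ℕ} {V : Type*} [NormedAddCommGroup V] [NormedSpace ℝ V] (k : Fin n)
    (f : (Fin n → ℝ) → V) (x : Fin n → ℝ) : V :=
  fderiv ℝ f x (Pi.single k 1)

section PartialDeriv

variable {n : ℕ} {V : Type*} [NormedAddCommGroup V] [NormedSpace ℝ V]
  {R : Type*} [NormedCommRing R] [NormedAlgebra ℝ R] (k : Fin n)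

lemma ContDiff.pd {f : (Fin n → ℝ) → V} (hf : ContDiff ℝ ∞ f) : ContDiff ℝ ∞ (pd k f) :=
  (hf.fderiv_right (m := ∞) le_rfl).clm_apply contDiff_const

lemma ContDiff.differentiable_of_top {f : (Fin n → ℝ) → V} (hf : ContDiff ℝ ∞ f) :
    Differentiable ℝ f :=
  hf.differentiable (by simp)

lemma pd_add {f g : (Fin n → ℝ) → V} (hf : ContDiff ℝ ∞ f) (hg : ContDiff ℝ ∞ g)
    (x : Fin n → ℝ) : pd k (fun y => f y + g y) x = pd k f x + pd k g x := by
  simp only [pd]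
  rw [fderiv_fun_add (hf.differentiable_of_top x) (hg.differentiable_of_top x)]; rfl

lemma pd_sub {f g : (Fin n → ℝ) → V} (hf : ContDiff ℝ ∞ f) (hg : ContDiff ℝ ∞ g)
    (x : Fin n → ℝ) : pd k (fun y => f y - g y) x = pd k f x - pd k g x := by
  simp only [pd]
  rw [fderiv_fun_sub (hf.differentiable_of_top x) (hg.differentiable_of_top x)]; rfl

lemma pd_mul {f g : (Fin n → ℝ) → R} (hf : ContDiff ℝ ∞ f) (hg : ContDiff ℝ ∞ g)
    (x : Fin n → ℝ) : pd k (fun y => f y * g y) x = pd k f x * g x + f x * pd k g x := by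
  simp only [pd]
  rw [fderiv_fun_mul (hf.differentiable_of_top x) (hg.differentiable_of_top x)]
  simp; ring

lemma pd_sum {ι : Type*} (s : Finset ι) {f : ι → (Fin n → ℝ) → V}
    (hf : ∀ i ∈ s, ContDiff ℝ ∞ (f i)) (x : Fin n → ℝ) :
    pd k (fun y => ∑ i ∈ s, f i y) x = ∑ i ∈ s, pd k (f i) x := by
  simp only [pd]
  rw [fderiv_fun_sum fun i hi => (hf i hi).differentiable_of_top x]; simp

@[simp] lemma pd_const (c : V) (x : Fin n → ℝ) : pd k (fun _ => c) x = 0 := by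
  simp [pd]

lemma pd_const_mul (c : R) {f : (Fin n → ℝ) → R} (hf : ContDiff ℝ ∞ f) (x : Fin n → ℝ) :
    pd k (fun y => c * f y) x = c * pd k f x := by
  rw [pd_mul k contDiff_const hf]; simp

lemma pd_prod {ι : Type*} [DecidableEq ι] (s : Finset ι) {f : ι → (Fin n → ℝ) → R}
    (hf : ∀ i ∈ s, ContDiff ℝ ∞ (f i)) (x : Fin n → ℝ) :
    pd k (fun y => ∏ i ∈ s, f i y) x = ∑ i ∈ s, (∏ j ∈ s.erase i, f j x) * pd k (f i) x := by
  simp only [pd]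
  rw [fderiv_finsetProd (fun i hi => (hf i hi).differentiable_of_top x)]; simp

lemma pd_comm {f : (Fin n → ℝ) → V} (hf : ContDiff ℝ ∞ f) (l : Fin n) (x : Fin n → ℝ) :
    pd k (pd l f) x = pd l (pd k f) x := by
  have h1 : ∀ a b : Fin n, pd a (pd b f) x =
      fderiv ℝ (fderiv ℝ f) x (Pi.single a 1) (Pi.single b 1) := by
    intro a b
    have hd : DifferentiableAt ℝ (fderiv ℝ f) x :=
      (hf.fderiv_right (m := ∞) le_rfl).differentiable_of_top x
    have : pd b f = fun y => fderiv ℝ f y (Pi.single b 1) := rfl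
    rw [pd, this, fderiv_clm_apply hd (differentiableAt_const _)]
    simp
  rw [h1, h1]
  exact (hf.contDiffAt.isSymmSndFDerivAt (by simp; exact WithTop.coe_le_coe.2 le_top)).eq _ _

lemma pd_congr {f g : (Fin n → ℝ) → V} (h : ∀ x, f x = g x) (x : Fin n → ℝ) :
    pd k f x = pd k g x := by rw [funext h]

/-- A matrix-valued function with smooth entries. -/
def MSmooth (A : (Fin n → ℝ) → Matrix (Fin n) (Fin n) R) : Prop :=
  ∀ i j, ContDiff ℝ ∞ fun y => A y i j

/-- The entrywise partial derivative of a matrix-valued function. -/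
noncomputable def mpd (A : (Fin n → ℝ) → Matrix (Fin n) (Fin n) R) (x : Fin n → ℝ) :
    Matrix (Fin n) (Fin n) R :=
  Matrix.of fun i j => pd k (fun y => A y i j) x

variable {A B : (Fin n → ℝ) → Matrix (Fin n) (Fin n) R}

lemma MSmooth.add (hA : MSmooth A) (hB : MSmooth B) : MSmooth fun y => A y + B y :=
  fun i j => (hA i j).add (hB i j)

lemma MSmooth.mul (hA : MSmooth A) (hB : MSmooth B) : MSmooth fun y => A y * B y :=
  fun i j => by
    simp only [Matrix.mul_apply]
    exact ContDiff.sum fun l _ => (hA i l).mul (hB l j)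

lemma MSmooth.const (M : Matrix (Fin n) (Fin n) R) :
    MSmooth fun _ => M := fun _ _ => contDiff_const

lemma MSmooth.pow (hA : MSmooth A) (m : ℕ) : MSmooth fun y => A y ^ m := by
  induction m with
  | zero => simpa using MSmooth.const (1 : Matrix (Fin n) (Fin n) R)
  | succ m ih => simpa only [pow_succ] using ih.mul hA

lemma MSmooth.mpd (hA : MSmooth A) : MSmooth (mpd k A) := fun i j => (hA i j).pd k

lemma MSmooth.trace (hA : MSmooth A) : ContDiff ℝ ∞ fun y => (A y).trace := by
  simp only [Matrix.trace, Matrix.diag]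
  exact ContDiff.sum fun i _ => hA i i

lemma MSmooth.det (hA : MSmooth A) : ContDiff ℝ ∞ fun y => (A y).det := by
  simp only [Matrix.det_apply']
  exact ContDiff.sum fun σ _ => contDiff_const.mul (contDiff_prod fun i _ => hA _ _)

lemma MSmooth.adjugate (hA : MSmooth A) : MSmooth fun y => (A y).adjugate := by
  intro i j
  simp only [Matrix.adjugate_apply]
  refine MSmooth.det fun a b => ?_
  by_cases h : a = j
  · subst h; simp only [Matrix.updateRow_self]; exact contDiff_const
  · simp only [Matrix.updateRow_ne h]; exact hA a b

lemma MSmooth.inv {A : (Fin n → ℝ) → Matrix (Fin n) (Fin n) ℝ} (hA : MSmooth A)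
    (h : ∀ x, (A x).det ≠ 0) : MSmooth fun y => (A y)⁻¹ := by
  intro i j
  simp only [Matrix.inv_def, Ring.inverse_eq_inv', Matrix.smul_apply, smul_eq_mul]
  exact (hA.det.inv h).mul (hA.adjugate i j)

lemma mpd_add (hA : MSmooth A) (hB : MSmooth B) (x : Fin n → ℝ) :
    mpd k (fun y => A y + B y) x = mpd k A x + mpd k B x := by
  ext i j; exact pd_add k (hA i j) (hB i j) x

lemma mpd_const (M : Matrix (Fin n) (Fin n) R) (x : Fin n → ℝ) :
    mpd k (fun _ => M) x = 0 := by
  ext i j; exact pd_const k _ x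

lemma mpd_mul (hA : MSmooth A) (hB : MSmooth B) (x : Fin n → ℝ) :
    mpd k (fun y => A y * B y) x = mpd k A x * B x + A x * mpd k B x := by
  ext i j
  simp only [mpd, Matrix.of_apply, Matrix.mul_apply, Matrix.add_apply, ← sum_add_distrib]
  rw [pd_sum k _ fun l _ => (hA i l).mul (hB l j)]
  exact sum_congr rfl fun l _ => pd_mul k (hA i l) (hB l j) x

lemma pd_trace (hA : MSmooth A) (x : Fin n → ℝ) :
    pd k (fun y => (A y).trace) x = (mpd k A x).trace := by
  simp only [Matrix.trace, Matrix.diag]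
  exact pd_sum k _ (fun i _ => hA i i) x

lemma pd_det (hA : MSmooth A) (x : Fin n → ℝ) :
    pd k (fun y => (A y).det) x = ((A x).adjugate * mpd k A x).trace := by
  have h1 : ∀ M N : Matrix (Fin n) (Fin n) R,
      (M.adjugate * N).trace = ∑ i, (M.updateCol i fun l => N l i).det := by
    intro M N
    simp only [Matrix.trace, Matrix.diag]
    refine sum_congr rfl fun i _ => ?_
    rw [← Matrix.cramer_apply, Matrix.cramer_eq_adjugate_mulVec]; rfl
  rw [h1]
  simp only [Matrix.det_apply']
  rw [pd_sum k _ fun σ _ => contDiff_const.mul (contDiff_prod fun i _ => hA _ _), sum_comm]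
  refine sum_congr rfl fun σ _ => ?_
  rw [pd_const_mul k _ (contDiff_prod fun i _ => hA _ _), pd_prod k _ fun i _ => hA _ _,
    mul_sum]
  refine sum_congr rfl fun i _ => ?_
  rw [← mul_prod_erase univ _ (mem_univ i), Matrix.updateCol_self, mul_comm (mpd k A x _ _)]
  congr 2
  refine prod_congr rfl fun j hj => ?_
  rw [Matrix.updateCol_ne (ne_of_mem_erase hj)]

lemma mpd_inv {A : (Fin n → ℝ) → Matrix (Fin n) (Fin n) ℝ} (hA : MSmooth A)
    (h : ∀ x, (A x).det ≠ 0) (x : Fin n → ℝ) :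
    mpd k (fun y => (A y)⁻¹) x = -((A x)⁻¹ * mpd k A x * (A x)⁻¹) := by
  have hu : ∀ y, IsUnit (A y).det := fun y => isUnit_iff_ne_zero.2 (h y)
  have h1 := mpd_mul k (hA.inv h) hA x
  have h2 : mpd k (fun y => (A y)⁻¹ * A y) x = 0 := by
    simp only [fun y => Matrix.nonsing_inv_mul (A y) (hu y)]
    exact mpd_const k _ x
  rw [h2] at h1
  have h3 := congrArg (· * (A x)⁻¹) h1
  simp only [zero_mul, add_mul, mul_assoc, Matrix.mul_nonsing_inv (A x) (hu x), mul_one] at h3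
  rw [mul_assoc]
  exact eq_neg_of_add_eq_zero_left h3.symm

end PartialDeriv

end PartialDerivatives

section HessianCalculus

open Finset
open scoped ContDiff

/-- The inverse of the graph metric `1 + H²`. -/
noncomputable def gInv {n : ℕ} (H : (Fin n → ℝ) → Matrix (Fin n) (Fin n) ℝ) (x : Fin n → ℝ) :
    Matrix (Fin n) (Fin n) ℝ :=
  (1 + H x * H x)⁻¹

/-- The differential consequences of the special Lagrangian equation for a Hessian field `H`
with volume density `W`. -/
structure IsSLHessian {n : ℕ} (H : (Fin n → ℝ) → Matrix (Fin n) (Fin n) ℝ)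
    (W : (Fin n → ℝ) → ℝ) : Prop where
  smooth : MSmooth H
  symm : ∀ x i j, H x i j = H x j i
  third : ∀ x i j k, mpd k H x i j = mpd i H x k j
  W_smooth : ContDiff ℝ ∞ W
  W_pos : ∀ x, 0 < W x
  det_ne : ∀ x, (1 + H x * H x).det ≠ 0
  pde : ∀ k x, (gInv H x * mpd k H x).trace = 0
  W_pd : ∀ k x, pd k W x = W x * (H x * gInv H x * mpd k H x).trace

namespace IsSLHessian

variable {n : ℕ} {H : (Fin n → ℝ) → Matrix (Fin n) (Fin n) ℝ} {W : (Fin n → ℝ) → ℝ}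

lemma isUnit_det (hH : IsSLHessian H W) (x : Fin n → ℝ) : IsUnit (1 + H x * H x).det :=
  isUnit_iff_ne_zero.2 (hH.det_ne x)

lemma gInv_mul (hH : IsSLHessian H W) (x : Fin n → ℝ) : gInv H x * (1 + H x * H x) = 1 :=
  Matrix.nonsing_inv_mul _ (hH.isUnit_det x)

lemma mul_gInv (hH : IsSLHessian H W) (x : Fin n → ℝ) : (1 + H x * H x) * gInv H x = 1 :=
  Matrix.mul_nonsing_inv _ (hH.isUnit_det x)

lemma gInv_comm (hH : IsSLHessian H W) (x : Fin n → ℝ) :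
    gInv H x * H x = H x * gInv H x := by
  have h1 : H x * (1 + H x * H x) = (1 + H x * H x) * H x := by noncomm_ring
  calc gInv H x * H x = gInv H x * (H x * ((1 + H x * H x) * gInv H x)) := by
        rw [hH.mul_gInv, mul_one]
    _ = (gInv H x * (1 + H x * H x)) * H x * gInv H x := by
        rw [← mul_assoc (H x), h1]; simp only [mul_assoc]
    _ = H x * gInv H x := by rw [hH.gInv_mul, one_mul]

lemma mul_gInv_mul (hH : IsSLHessian H W) (x : Fin n → ℝ) :
    H x * gInv H x * H x = 1 - gInv H x := by
  have h := hH.mul_gInv x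
  rw [mul_assoc, hH.gInv_comm, ← mul_assoc]
  rw [add_mul, one_mul] at h
  exact eq_sub_of_add_eq' h

lemma smooth_metric (hH : IsSLHessian H W) : MSmooth fun y => 1 + H y * H y :=
  (MSmooth.const 1).add (hH.smooth.mul hH.smooth)

lemma smooth_gInv (hH : IsSLHessian H W) : MSmooth (gInv H) := hH.smooth_metric.inv hH.det_ne

lemma transpose_eq (hH : IsSLHessian H W) (x : Fin n → ℝ) : (H x).transpose = H x := by
  ext i j; exact hH.symm x j i

lemma gInv_transpose (hH : IsSLHessian H W) (x : Fin n → ℝ) :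
    (gInv H x).transpose = gInv H x := by
  rw [gInv, Matrix.transpose_nonsing_inv, Matrix.transpose_add, Matrix.transpose_mul,
    hH.transpose_eq, Matrix.transpose_one]

lemma gInv_symm (hH : IsSLHessian H W) (x : Fin n → ℝ) (i j : Fin n) :
    gInv H x i j = gInv H x j i := by
  conv_lhs => rw [← hH.gInv_transpose]
  rfl

lemma mpd_symm (hH : IsSLHessian H W) (k : Fin n) (x : Fin n → ℝ) (i j : Fin n) :
    mpd k H x i j = mpd k H x j i :=
  pd_congr k (fun y => hH.symm y i j) x

lemma mpd_gInv (hH : IsSLHessian H W) (k : Fin n) (x : Fin n → ℝ) :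
    mpd k (gInv H) x =
      -(gInv H x * (mpd k H x * H x + H x * mpd k H x) * gInv H x) := by
  have h1 := mpd_inv k hH.smooth_metric hH.det_ne x
  rw [mpd_add k (MSmooth.const 1) (hH.smooth.mul hH.smooth), mpd_const, zero_add,
    mpd_mul k hH.smooth hH.smooth] at h1
  exact h1

lemma sum_mul_mpd_mul (hH : IsSLHessian H W) (x : Fin n → ℝ) (P Q : Matrix (Fin n) (Fin n) ℝ)
    (i : Fin n) : ∑ k, (P * mpd k H x * Q) i k = ∑ a, P i a * (Q * mpd a H x).trace := by
  simp only [Matrix.mul_apply, Matrix.trace, Matrix.diag, sum_mul, mul_sum]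
  have h1 : ∀ k b a, P i a * mpd k H x a b * Q b k = P i a * (Q b k * mpd a H x k b) := by
    intro k b a; rw [hH.third x a b k]; ring
  simp only [h1]
  rw [sum_comm]
  rw [sum_comm' (t' := univ) (s' := fun _ => univ) (by simp)]
  have : ∀ b, ∑ k, ∑ a, P i a * (Q b k * mpd a H x k b) =
      ∑ a, ∑ k, P i a * (Q b k * mpd a H x k b) := fun b => sum_comm
  calc _ = ∑ k, ∑ b, ∑ a, P i a * (Q b k * mpd a H x k b) := rfl
    _ = ∑ b, ∑ k, ∑ a, P i a * (Q b k * mpd a H x k b) := sum_comm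
    _ = ∑ b, ∑ a, ∑ k, P i a * (Q b k * mpd a H x k b) := sum_congr rfl fun b _ => this b
    _ = _ := sum_comm

lemma pd_log (hH : IsSLHessian H W) (k : Fin n) (x : Fin n → ℝ) :
    pd k (fun y => Real.log (W y)) x = (H x * gInv H x * mpd k H x).trace := by
  simp only [pd]
  rw [fderiv.log (hH.W_smooth.differentiable_of_top x) (hH.W_pos x).ne']
  have := hH.W_pd k x
  simp only [pd] at this
  rw [smul_apply, this, smul_eq_mul, inv_mul_cancel_left₀ (hH.W_pos x).ne']

lemma smooth_logGrad (hH : IsSLHessian H W) (k : Fin n) :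
    ContDiff ℝ ∞ fun y => (H y * gInv H y * mpd k H y).trace :=
  ((hH.smooth.mul hH.smooth_gInv).mul (hH.smooth.mpd k)).trace

/-- The rows of `W G` are divergence free. -/
lemma div_gInv (hH : IsSLHessian H W) (x : Fin n → ℝ) (i : Fin n) :
    ∑ k, pd k (fun y => W y * gInv H y i k) x = 0 := by
  have h1 : ∀ k, pd k (fun y => W y * gInv H y i k) x =
      W x * (gInv H x i k * (H x * gInv H x * mpd k H x).trace) -
        W x * ((gInv H x * mpd k H x * (H x * gInv H x)) i k +
          ((gInv H x * H x) * mpd k H x * gInv H x) i k) := by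
    intro k
    rw [pd_mul k hH.W_smooth (hH.smooth_gInv i k), hH.W_pd]
    have : pd k (fun y => gInv H y i k) x = mpd k (gInv H) x i k := rfl
    rw [this, hH.mpd_gInv]
    have : gInv H x * (mpd k H x * H x + H x * mpd k H x) * gInv H x =
        gInv H x * mpd k H x * (H x * gInv H x) + (gInv H x * H x) * mpd k H x * gInv H x := by
      noncomm_ring
    rw [this, Matrix.neg_apply, Matrix.add_apply]; ring
  simp only [h1, sum_sub_distrib, ← mul_sum, sum_add_distrib, hH.sum_mul_mpd_mul, hH.pde]
  simp

/-- The rows of `W G H` are divergence free. -/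
lemma div_gInv_mul (hH : IsSLHessian H W) (x : Fin n → ℝ) (i : Fin n) :
    ∑ k, pd k (fun y => W y * (gInv H y * H y) i k) x = 0 := by
  have hs := hH.smooth_gInv.mul hH.smooth
  have h1 : ∀ k, pd k (fun y => W y * (gInv H y * H y) i k) x =
      W x * ((gInv H x * H x) i k * (H x * gInv H x * mpd k H x).trace) -
        W x * ((gInv H x * mpd k H x * (H x * gInv H x * H x)) i k +
          ((gInv H x * H x) * mpd k H x * (gInv H x * H x)) i k -
          (gInv H x * mpd k H x * (1 : Matrix (Fin n) (Fin n) ℝ)) i k) := by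
    intro k
    rw [pd_mul k hH.W_smooth (hs i k), hH.W_pd]
    have : pd k (fun y => (gInv H y * H y) i k) x = mpd k (fun y => gInv H y * H y) x i k := rfl
    rw [this, mpd_mul k hH.smooth_gInv hH.smooth, hH.mpd_gInv]
    have : -(gInv H x * (mpd k H x * H x + H x * mpd k H x) * gInv H x) * H x
          + gInv H x * mpd k H x =
        gInv H x * mpd k H x * 1 - (gInv H x * mpd k H x * (H x * gInv H x * H x)
          + (gInv H x * H x) * mpd k H x * (gInv H x * H x)) := by
      noncomm_ring
    rw [this]
    simp only [Matrix.sub_apply, Matrix.add_apply]; ring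
  simp only [h1, sum_sub_distrib, ← mul_sum, sum_add_distrib, hH.sum_mul_mpd_mul]
  simp only [hH.mul_gInv_mul, sub_mul, Matrix.trace_sub, hH.pde, hH.gInv_comm]
  simp

lemma pd_pde (hH : IsSLHessian H W) (x : Fin n → ℝ) (k l : Fin n) :
    (mpd l (gInv H) x * mpd k H x).trace + (gInv H x * mpd l (mpd k H) x).trace = 0 := by
  have h1 := pd_trace l (hH.smooth_gInv.mul (hH.smooth.mpd k)) x
  rw [pd_congr l (hH.pde k) x, mpd_mul l hH.smooth_gInv (hH.smooth.mpd k), Matrix.trace_add,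
    pd_const] at h1
  exact h1.symm

lemma fourth (hH : IsSLHessian H W) (x : Fin n → ℝ) (a b i j : Fin n) :
    mpd b (mpd a H) x j i = mpd j (mpd i H) x b a := by
  calc mpd b (mpd a H) x j i = pd b (fun y => mpd a H y j i) x := rfl
    _ = pd b (fun y => mpd j H y a i) x := pd_congr b (fun y => hH.third y j i a) x
    _ = pd j (pd b fun y => H y a i) x := pd_comm b (hH.smooth a i) j x
    _ = pd j (fun y => mpd b H y i a) x := pd_congr j (fun y => hH.mpd_symm b y a i) x
    _ = pd j (fun y => mpd i H y b a) x := pd_congr j (fun y => hH.third y i a b) x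
    _ = _ := rfl

lemma sum_trace_swap (hH : IsSLHessian H W) (x : Fin n → ℝ) (M B : Matrix (Fin n) (Fin n) ℝ) :
    ∑ a, ∑ b, M a b * (B * mpd b (mpd a H) x).trace =
      ∑ i, ∑ j, B i j * (M * mpd j (mpd i H) x).trace := by
  simp only [Matrix.mul_apply, Matrix.trace, Matrix.diag, mul_sum]
  have e : ∀ a b i j, M a b * (B i j * mpd b (mpd a H) x j i) =
      B i j * (M a b * mpd j (mpd i H) x b a) := fun a b i j => by
    rw [hH.fourth x a b i j]; ring
  simp only [e]
  calc _ = ∑ a, ∑ i, ∑ b, ∑ j, B i j * (M a b * mpd j (mpd i H) x b a) :=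
        sum_congr rfl fun a _ => sum_comm
    _ = ∑ i, ∑ a, ∑ b, ∑ j, B i j * (M a b * mpd j (mpd i H) x b a) := sum_comm
    _ = ∑ i, ∑ a, ∑ j, ∑ b, B i j * (M a b * mpd j (mpd i H) x b a) :=
        sum_congr rfl fun i _ => sum_congr rfl fun a _ => sum_comm
    _ = _ := sum_congr rfl fun i _ => sum_comm

/-- The metric Laplacian of a function whose gradient is `tr (B ∂H)`. -/
lemma laplacian_of_grad (hH : IsSLHessian H W) {f : (Fin n → ℝ) → ℝ}
    {B : (Fin n → ℝ) → Matrix (Fin n) (Fin n) ℝ} (hB : MSmooth B)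
    (hf : ∀ a x, pd a f x = (B x * mpd a H x).trace) (x : Fin n → ℝ) :
    ∑ a, ∑ b, gInv H x a b * pd b (pd a f) x =
      ∑ a, ∑ b, gInv H x a b * (mpd b B x * mpd a H x).trace -
        ∑ i, ∑ j, B x i j * (mpd j (gInv H) x * mpd i H x).trace := by
  have h1 : ∀ a b, pd b (pd a f) x =
      (mpd b B x * mpd a H x).trace + (B x * mpd b (mpd a H) x).trace := by
    intro a b
    rw [pd_congr b (hf a) x, pd_trace b (hB.mul (hH.smooth.mpd a)),
      mpd_mul b hB (hH.smooth.mpd a), Matrix.trace_add]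
  simp only [h1, mul_add, sum_add_distrib]
  rw [hH.sum_trace_swap]
  have h2 : ∀ i j, (gInv H x * mpd j (mpd i H) x).trace =
      -(mpd j (gInv H) x * mpd i H x).trace := fun i j => by
    linarith [hH.pd_pde x i j]
  simp only [h2, mul_neg, sum_neg_distrib]
  ring

/-- The slope vector field `∇v - G H ∇(tr H)`. -/
noncomputable def _root_.slopeVec (H : (Fin n → ℝ) → Matrix (Fin n) (Fin n) ℝ) (i : Fin n)
    (x : Fin n → ℝ) : ℝ :=
  (H x * gInv H x * mpd i H x).trace - ∑ j, (gInv H x * H x) i j * (mpd j H x).trace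

lemma smooth_slopeVec (hH : IsSLHessian H W) (i : Fin n) : ContDiff ℝ ∞ (slopeVec H i) :=
  (hH.smooth_logGrad i).sub
    (ContDiff.sum fun j _ => ((hH.smooth_gInv.mul hH.smooth) i j).mul (hH.smooth.mpd j).trace)

lemma div_slopeVec (hH : IsSLHessian H W) (x : Fin n → ℝ) :
    ∑ i, pd i (fun y => W y * slopeVec H i y) x =
      W x * (∑ i, (H x * gInv H x * mpd i H x).trace ^ 2 +
        ∑ i, (mpd i (fun y => H y * gInv H y) x * mpd i H x).trace) := by
  have hHG := hH.smooth.mul hH.smooth_gInv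
  have hGH := hH.smooth_gInv.mul hH.smooth
  have h1 : ∀ i, pd i (fun y => W y * slopeVec H i y) x =
      W x * (H x * gInv H x * mpd i H x).trace ^ 2 +
      W x * (mpd i (fun y => H y * gInv H y) x * mpd i H x).trace +
      W x * (H x * gInv H x * mpd i (mpd i H) x).trace -
      ∑ j, (pd i (fun y => W y * (gInv H y * H y) i j) x * (mpd j H x).trace +
        W x * (gInv H x * H x) i j * (mpd i (mpd j H) x).trace) := by
    intro i
    have e : ∀ y, W y * slopeVec H i y = W y * (H y * gInv H y * mpd i H y).trace -
        ∑ j, (W y * (gInv H y * H y) i j) * (mpd j H y).trace := fun y => by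
      rw [slopeVec, mul_sub, mul_sum]
      simp only [mul_assoc]
    rw [pd_congr i e, pd_sub i (hH.W_smooth.mul (hH.smooth_logGrad i)) (ContDiff.sum fun j _ =>
      (hH.W_smooth.mul (hGH i j)).mul (hH.smooth.mpd j).trace),
      pd_mul i hH.W_smooth (hH.smooth_logGrad i), hH.W_pd, pd_trace i (hHG.mul (hH.smooth.mpd i)),
      mpd_mul i hHG (hH.smooth.mpd i), Matrix.trace_add, pd_sum i _ fun j _ =>
      (hH.W_smooth.mul (hGH i j)).mul (hH.smooth.mpd j).trace]
    have e2 : ∀ j, pd i (fun y => W y * (gInv H y * H y) i j * (mpd j H y).trace) x =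
        pd i (fun y => W y * (gInv H y * H y) i j) x * (mpd j H x).trace +
        W x * (gInv H x * H x) i j * (mpd i (mpd j H) x).trace := fun j => by
      rw [pd_mul i (hH.W_smooth.mul (hGH i j)) (hH.smooth.mpd j).trace,
        pd_trace i (hH.smooth.mpd j)]
    simp only [e2]; ring
  simp only [h1, sum_sub_distrib, sum_add_distrib, ← mul_sum]
  have hsym : ∀ y i j, (gInv H y * H y) i j = (gInv H y * H y) j i := by
    intro y i j
    have : (gInv H y * H y).transpose = gInv H y * H y := by
      rw [Matrix.transpose_mul, hH.transpose_eq, hH.gInv_transpose, hH.gInv_comm]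
    conv_lhs => rw [← this]
    rfl
  have h2 : ∑ i, ∑ j, pd i (fun y => W y * (gInv H y * H y) i j) x * (mpd j H x).trace = 0 := by
    rw [sum_comm]
    refine sum_eq_zero fun j _ => ?_
    rw [← sum_mul]
    simp only [fun i => pd_congr i (fun y => congrArg (W y * ·) (hsym y i j)) x]
    rw [hH.div_gInv_mul, zero_mul]
  have h3 : ∑ i, (H x * gInv H x * mpd i (mpd i H) x).trace =
      ∑ i, ∑ j, (gInv H x * H x) i j * (mpd i (mpd j H) x).trace := by
    have := hH.sum_trace_swap x 1 (H x * gInv H x)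
    simp only [Matrix.one_apply, ite_mul, one_mul, zero_mul, sum_ite_eq, mem_univ, if_true] at this
    rw [this, sum_comm]
    refine sum_congr rfl fun i _ => sum_congr rfl fun j _ => ?_
    rw [← hH.gInv_comm, hsym x j i]
  have h4 : ∀ i, ∑ j, W x * (gInv H x * H x) i j * (mpd i (mpd j H) x).trace =
      W x * ∑ j, (gInv H x * H x) i j * (mpd i (mpd j H) x).trace := fun i => by
    rw [mul_sum]; simp only [mul_assoc]
  rw [h2, h3]
  simp only [h4, ← mul_sum]
  ring

end IsSLHessian

end HessianCalculus

section EigenFrames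

open Finset
open scoped ContDiff

section Frame

variable {n : ℕ} {R : Type*} [CommRing R]

/-- The matrix with eigenvalues `d` in the frame `U`. -/
def inFrame (U : Matrix (Fin n) (Fin n) R) (d : Fin n → R) : Matrix (Fin n) (Fin n) R :=
  U * Matrix.diagonal d * U.transpose

lemma inFrame_mul {U : Matrix (Fin n) (Fin n) R} (hU : U.transpose * U = 1) (d e : Fin n → R) :
    inFrame U d * inFrame U e = inFrame U fun i => d i * e i := by
  rw [inFrame, inFrame, inFrame, ← Matrix.diagonal_mul_diagonal]
  calc _ = U * Matrix.diagonal d * (U.transpose * U) * Matrix.diagonal e * U.transpose := by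
        simp only [mul_assoc]
    _ = _ := by rw [hU, mul_one]; simp only [mul_assoc]

lemma inFrame_one {U : Matrix (Fin n) (Fin n) R} (hU : U * U.transpose = 1) :
    inFrame U (fun _ => 1) = 1 := by
  rw [inFrame, Matrix.diagonal_one, mul_one, hU]

lemma inFrame_add (U : Matrix (Fin n) (Fin n) R) (d e : Fin n → R) :
    inFrame U d + inFrame U e = inFrame U fun i => d i + e i := by
  rw [inFrame, inFrame, inFrame, ← Matrix.diagonal_add, mul_add, add_mul]

lemma inFrame_smul (U : Matrix (Fin n) (Fin n) R) (c : R) (d : Fin n → R) :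
    c • inFrame U d = inFrame U fun i => c * d i := by
  have : Matrix.diagonal (fun i => c * d i) = c • Matrix.diagonal d := by
    rw [← Matrix.diagonal_smul]; rfl
  rw [inFrame, inFrame, this, Matrix.mul_smul, Matrix.smul_mul]

lemma inFrame_neg (U : Matrix (Fin n) (Fin n) R) (d : Fin n → R) :
    -inFrame U d = inFrame U fun i => -d i := by
  rw [inFrame, inFrame, ← Matrix.diagonal_neg, mul_neg, neg_mul]

lemma inFrame_pow {U : Matrix (Fin n) (Fin n) R} (hU : U.transpose * U = 1)
    (hU' : U * U.transpose = 1) (d : Fin n → R) (m : ℕ) :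
    inFrame U d ^ m = inFrame U fun i => d i ^ m := by
  induction m with
  | zero => simp [inFrame_one hU']
  | succ m ih => simp only [pow_succ, ih, inFrame_mul hU]

lemma inFrame_det {U : Matrix (Fin n) (Fin n) R} (hU : U.transpose * U = 1) (d : Fin n → R) :
    (inFrame U d).det = ∏ i, d i := by
  have h := congrArg Matrix.det hU
  rw [Matrix.det_mul, Matrix.det_one] at h
  rw [inFrame, Matrix.det_mul, Matrix.det_mul, Matrix.det_diagonal, mul_right_comm,
    mul_comm U.det, h, one_mul]

lemma trace_inFrame_mul (U : Matrix (Fin n) (Fin n) R) (d : Fin n → R)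
    (D : Matrix (Fin n) (Fin n) R) :
    (inFrame U d * D).trace = ∑ i, d i * (U.transpose * D * U) i i := by
  rw [inFrame, mul_assoc, Matrix.trace_mul_comm, ← mul_assoc, Matrix.trace_mul_comm]
  simp only [Matrix.trace, Matrix.diag, Matrix.diagonal_mul]

lemma inFrame_trace {U : Matrix (Fin n) (Fin n) R} (hU : U.transpose * U = 1) (d : Fin n → R) :
    (inFrame U d).trace = ∑ i, d i := by
  have := trace_inFrame_mul U d 1
  simpa [hU] using this

lemma inFrame_apply (U : Matrix (Fin n) (Fin n) R) (d : Fin n → R) (a b : Fin n) :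
    inFrame U d a b = ∑ c, d c * (U a c * U b c) := by
  rw [inFrame, Matrix.mul_apply]
  refine sum_congr rfl fun c _ => ?_
  rw [Matrix.mul_diagonal, Matrix.transpose_apply]; ring

lemma trace_inFrame_mul_mul (U : Matrix (Fin n) (Fin n) R) (α β : Fin n → R)
    (D E : Matrix (Fin n) (Fin n) R) :
    (inFrame U α * D * inFrame U β * E).trace =
      ∑ i, ∑ j, α i * β j * ((U.transpose * D * U) i j * (U.transpose * E * U) j i) := by
  have : inFrame U α * D * inFrame U β * E =
      inFrame U α * (D * (inFrame U β * E)) := by simp only [mul_assoc]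
  rw [this, trace_inFrame_mul]
  refine sum_congr rfl fun i _ => ?_
  have : U.transpose * (D * (inFrame U β * E)) * U =
      (U.transpose * D * U) * Matrix.diagonal β * (U.transpose * E * U) := by
    simp only [inFrame, mul_assoc]
  rw [this, Matrix.mul_apply, mul_sum]
  refine sum_congr rfl fun j _ => ?_
  rw [Matrix.mul_diagonal]; ring

end Frame

section FrameTensor

variable {n : ℕ}

/-- The components in the frame `U` of the 3-tensor with slices `D`. -/
def frameTensor (U : Matrix (Fin n) (Fin n) ℝ) (D : Fin n → Matrix (Fin n) (Fin n) ℝ)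
    (c i j : Fin n) : ℝ :=
  ∑ a, U a c * (U.transpose * D a * U) i j

variable (U : Matrix (Fin n) (Fin n) ℝ) (D : Fin n → Matrix (Fin n) (Fin n) ℝ)

lemma frameTensor_eq (c i j : Fin n) :
    frameTensor U D c i j = ∑ a, ∑ b, ∑ d, U a c * U b i * U d j * D a b d := by
  simp only [frameTensor, Matrix.mul_apply, Matrix.transpose_apply, mul_sum, sum_mul]
  refine sum_congr rfl fun a _ => ?_
  rw [sum_comm]
  exact sum_congr rfl fun b _ => sum_congr rfl fun d _ => by ring

lemma frameTensor_swap_right (hD : ∀ a b d, D a b d = D a d b) (c i j : Fin n) :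
    frameTensor U D c i j = frameTensor U D c j i := by
  rw [frameTensor_eq, frameTensor_eq]
  refine sum_congr rfl fun a _ => ?_
  rw [sum_comm]
  refine sum_congr rfl fun b _ => sum_congr rfl fun d _ => ?_
  rw [hD]; ring

lemma frameTensor_swap_left (hD : ∀ a b d, D a b d = D b a d) (c i j : Fin n) :
    frameTensor U D c i j = frameTensor U D i c j := by
  rw [frameTensor_eq, frameTensor_eq, sum_comm]
  refine sum_congr rfl fun a _ => sum_congr rfl fun b _ => sum_congr rfl fun d _ => ?_
  rw [hD]; ring

lemma sum_mul_trace_inFrame (β : Fin n → ℝ) (c : Fin n) :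
    ∑ a, U a c * (inFrame U β * D a).trace = ∑ i, β i * frameTensor U D c i i := by
  simp only [trace_inFrame_mul, frameTensor, mul_sum]
  rw [sum_comm]
  exact sum_congr rfl fun i _ => sum_congr rfl fun a _ => by ring

lemma sum_inFrame_mul_mul (μ : Fin n → ℝ) (p q : Fin n → ℝ) :
    ∑ a, ∑ b, inFrame U μ a b * (p a * q b) =
      ∑ c, μ c * ((∑ a, U a c * p a) * ∑ a, U a c * q a) := by
  simp only [inFrame_apply, sum_mul, mul_sum]
  calc _ = ∑ a, ∑ c, ∑ b, μ c * (U a c * U b c) * (p a * q b) :=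
        sum_congr rfl fun a _ => sum_comm
    _ = ∑ c, ∑ a, ∑ b, μ c * (U a c * U b c) * (p a * q b) := sum_comm
    _ = _ := by
      refine sum_congr rfl fun c _ => ?_
      rw [sum_comm]
      exact sum_congr rfl fun a _ => sum_congr rfl fun b _ => by ring

lemma sum_inFrame_trace (μ α β : Fin n → ℝ) (hD : ∀ a b d, D a b d = D a d b) :
    ∑ a, ∑ b, inFrame U μ a b * (inFrame U α * D b * inFrame U β * D a).trace =
      ∑ c, ∑ i, ∑ j, μ c * α i * β j * frameTensor U D c i j ^ 2 := by
  simp only [trace_inFrame_mul_mul]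
  calc _ = ∑ a, ∑ b, ∑ i, ∑ j, α i * β j * (inFrame U μ a b *
        ((U.transpose * D a * U) j i * (U.transpose * D b * U) i j)) := by
        simp only [mul_sum]
        exact sum_congr rfl fun a _ => sum_congr rfl fun b _ => sum_congr rfl fun i _ =>
          sum_congr rfl fun j _ => by ring
    _ = ∑ i, ∑ j, ∑ a, ∑ b, α i * β j * (inFrame U μ a b *
        ((U.transpose * D a * U) j i * (U.transpose * D b * U) i j)) := by
        calc _ = ∑ a, ∑ i, ∑ b, ∑ j, α i * β j * (inFrame U μ a b *
              ((U.transpose * D a * U) j i * (U.transpose * D b * U) i j)) :=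
              sum_congr rfl fun a _ => sum_comm
          _ = ∑ a, ∑ i, ∑ j, ∑ b, α i * β j * (inFrame U μ a b *
              ((U.transpose * D a * U) j i * (U.transpose * D b * U) i j)) :=
              sum_congr rfl fun a _ => sum_congr rfl fun i _ => sum_comm
          _ = ∑ i, ∑ a, ∑ j, ∑ b, α i * β j * (inFrame U μ a b *
              ((U.transpose * D a * U) j i * (U.transpose * D b * U) i j)) := sum_comm
          _ = _ := sum_congr rfl fun i _ => sum_comm
    _ = ∑ i, ∑ j, ∑ c, μ c * α i * β j * frameTensor U D c i j ^ 2 := by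
        refine sum_congr rfl fun i _ => sum_congr rfl fun j _ => ?_
        simp only [← mul_sum]
        rw [sum_inFrame_mul_mul U μ (fun a => (U.transpose * D a * U) j i)
          (fun a => (U.transpose * D a * U) i j), mul_sum]
        refine sum_congr rfl fun c _ => ?_
        change α i * β j * (μ c * (frameTensor U D c j i * frameTensor U D c i j)) = _
        rw [frameTensor_swap_right U D hD c j i]; ring
    _ = ∑ i, ∑ c, ∑ j, μ c * α i * β j * frameTensor U D c i j ^ 2 :=
        sum_congr rfl fun i _ => sum_comm
    _ = _ := sum_comm

end FrameTensor

section EigenFrame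

variable {n : ℕ} {H : (Fin n → ℝ) → Matrix (Fin n) (Fin n) ℝ} {W : (Fin n → ℝ) → ℝ}
  {x : Fin n → ℝ} {U : Matrix (Fin n) (Fin n) ℝ} {lam : Fin n → ℝ}

/-- An orthonormal eigenframe of `H x`. -/
structure IsEigenFrame (H : (Fin n → ℝ) → Matrix (Fin n) (Fin n) ℝ) (x : Fin n → ℝ)
    (U : Matrix (Fin n) (Fin n) ℝ) (lam : Fin n → ℝ) : Prop where
  left : U.transpose * U = 1
  right : U * U.transpose = 1
  eq : H x = inFrame U lam

/-- The third derivative in an eigenframe that is orthonormal for the graph metric. -/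
noncomputable def frameThird (H : (Fin n → ℝ) → Matrix (Fin n) (Fin n) ℝ) (x : Fin n → ℝ)
    (U : Matrix (Fin n) (Fin n) ℝ) (lam : Fin n → ℝ) (i j k : Fin n) : ℝ :=
  √((1 + lam i ^ 2)⁻¹) * √((1 + lam j ^ 2)⁻¹) * √((1 + lam k ^ 2)⁻¹) *
    frameTensor U (fun a => mpd a H x) k i j

namespace IsEigenFrame

lemma gInv_eq (hU : IsEigenFrame H x U lam) :
    gInv H x = inFrame U fun i => (1 + lam i ^ 2)⁻¹ := by
  refine Matrix.inv_eq_right_inv ?_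
  rw [hU.eq, inFrame_mul hU.left, ← inFrame_one hU.right, inFrame_add, inFrame_mul hU.left]
  congr 1; funext i
  have : 1 + lam i ^ 2 ≠ 0 := by positivity
  rw [← sq, mul_inv_cancel₀ this]

lemma mul_gInv_eq (hU : IsEigenFrame H x U lam) :
    H x * gInv H x = inFrame U fun i => lam i * (1 + lam i ^ 2)⁻¹ := by
  rw [hU.gInv_eq, hU.eq, inFrame_mul hU.left]

lemma gInv_mul_eq (hU : IsEigenFrame H x U lam) :
    gInv H x * H x = inFrame U fun i => (1 + lam i ^ 2)⁻¹ * lam i := by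
  rw [hU.gInv_eq, hU.eq, inFrame_mul hU.left]

lemma frame_swap_right (hH : IsSLHessian H W) (c i j : Fin n) :
    frameTensor U (fun a => mpd a H x) c i j = frameTensor U (fun a => mpd a H x) c j i :=
  frameTensor_swap_right U _ (fun a b d => hH.mpd_symm a x b d) c i j

lemma frame_swap_left (hH : IsSLHessian H W) (c i j : Fin n) :
    frameTensor U (fun a => mpd a H x) c i j = frameTensor U (fun a => mpd a H x) i c j :=
  frameTensor_swap_left U _ (fun a b d => hH.third x b d a) c i j

lemma isSymTensor (hH : IsSLHessian H W) : IsSymTensor (frameThird H x U lam) := by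
  constructor
  · intro i j k
    simp only [frameThird]
    rw [frame_swap_right hH]; ring
  · intro i j k
    simp only [frameThird]
    rw [frame_swap_right hH, frame_swap_left hH, frame_swap_right hH]; ring

lemma frameThird_diag (i c : Fin n) : frameThird H x U lam i i c =
    √((1 + lam c ^ 2)⁻¹) * ((1 + lam i ^ 2)⁻¹ * frameTensor U (fun a => mpd a H x) c i i) := by
  have : √((1 + lam i ^ 2)⁻¹) * √((1 + lam i ^ 2)⁻¹) = (1 + lam i ^ 2)⁻¹ :=
    Real.mul_self_sqrt (by positivity)
  rw [frameThird, this]; ring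

lemma frameThird_sq (i j c : Fin n) : frameThird H x U lam i j c ^ 2 =
    (1 + lam i ^ 2)⁻¹ * (1 + lam j ^ 2)⁻¹ * (1 + lam c ^ 2)⁻¹ *
      frameTensor U (fun a => mpd a H x) c i j ^ 2 := by
  have this : ∀ i, √((1 + lam i ^ 2)⁻¹) ^ 2 = (1 + lam i ^ 2)⁻¹ := fun i => Real.sq_sqrt (by positivity)
  rw [frameThird, mul_pow, mul_pow, mul_pow, this, this, this]

lemma sum_mul_trace (c : Fin n) (b : Fin n → ℝ) :
    √((1 + lam c ^ 2)⁻¹) *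
      ∑ a, U a c * (inFrame U (fun i => b i * (1 + lam i ^ 2)⁻¹) * mpd a H x).trace =
      ∑ i, b i * frameThird H x U lam i i c := by
  rw [sum_mul_trace_inFrame U (fun a => mpd a H x), mul_sum]
  refine sum_congr rfl fun i _ => ?_
  rw [frameThird_diag]; ring

lemma isTraceFree (hH : IsSLHessian H W) (hU : IsEigenFrame H x U lam) :
    IsTraceFree (frameThird H x U lam) := by
  intro c
  have := sum_mul_trace (H := H) (x := x) (U := U) (lam := lam) c fun _ => 1
  simp only [one_mul, ← hU.gInv_eq, hH.pde, mul_zero, sum_const_zero] at this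
  exact this.symm

lemma sum_trace (hH : IsSLHessian H W) (μ α β : Fin n → ℝ) :
    ∑ a, ∑ b, inFrame U μ a b *
      (inFrame U α * mpd b H x * inFrame U β * mpd a H x).trace =
    ∑ i, ∑ j, ∑ k, μ k * α i * β j * ((1 + lam i ^ 2) * (1 + lam j ^ 2) * (1 + lam k ^ 2)) *
      frameThird H x U lam i j k ^ 2 := by
  rw [sum_inFrame_trace U (fun a => mpd a H x) μ α β fun a b d => hH.mpd_symm a x b d]
  rw [sum_comm]
  refine sum_congr rfl fun i _ => ?_
  rw [sum_comm]
  refine sum_congr rfl fun j _ => sum_congr rfl fun k _ => ?_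
  rw [frameThird_sq]
  have this : ∀ i, 1 + lam i ^ 2 ≠ 0 := fun i => by positivity
  have h1 := this i
  have h2 := this j
  have h3 := this k
  field_simp

end IsEigenFrame

lemma Matrix.IsHermitian.exists_isEigenFrame (hx : (H x).IsHermitian) :
    ∃ U, IsEigenFrame H x U hx.eigenvalues := by
  have h := hx.spectral_theorem
  rw [Unitary.conjStarAlgAut_apply] at h
  exact ⟨hx.eigenvectorUnitary, Unitary.coe_star_mul_self hx.eigenvectorUnitary,
    Unitary.coe_mul_star_self hx.eigenvectorUnitary, h⟩

lemma IsSymTensor.sum_swap_left {h : Fin n → Fin n → Fin n → ℝ} (hs : IsSymTensor h)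
    (f : Fin n → Fin n → Fin n → ℝ) :
    ∑ i, ∑ j, ∑ k, f i j k * h i j k ^ 2 = ∑ i, ∑ j, ∑ k, f j i k * h i j k ^ 2 := by
  rw [sum_comm]
  exact sum_congr rfl fun i _ => sum_congr rfl fun j _ => sum_congr rfl fun k _ => by
    rw [hs.1 j i k]

lemma IsSymTensor.sum_swap_right {h : Fin n → Fin n → Fin n → ℝ} (hs : IsSymTensor h)
    (f : Fin n → Fin n → Fin n → ℝ) :
    ∑ i, ∑ j, ∑ k, f i j k * h i j k ^ 2 = ∑ i, ∑ j, ∑ k, f i k j * h i j k ^ 2 := by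
  refine sum_congr rfl fun i _ => ?_
  rw [sum_comm]
  exact sum_congr rfl fun j _ => sum_congr rfl fun k _ => by rw [hs.2 i k j]

end EigenFrame

end EigenFrames

section FrameLaplacian

open Finset
open scoped ContDiff

variable {n : ℕ} {H : (Fin n → ℝ) → Matrix (Fin n) (Fin n) ℝ} {W : (Fin n → ℝ) → ℝ}
  {x : Fin n → ℝ} {U : Matrix (Fin n) (Fin n) ℝ} {lam : Fin n → ℝ}

/-- The Laplacian-type operator `Σ Gᵢⱼ ∂ᵢ∂ⱼ`. -/
noncomputable def gLap (H : (Fin n → ℝ) → Matrix (Fin n) (Fin n) ℝ) (f : (Fin n → ℝ) → ℝ)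
    (x : Fin n → ℝ) : ℝ :=
  ∑ a, ∑ b, gInv H x a b * pd b (pd a f) x

lemma IsEigenFrame.one_apply (hU : IsEigenFrame H x U lam) :
    (1 : Matrix (Fin n) (Fin n) ℝ) = inFrame U fun _ => 1 := (inFrame_one hU.right).symm

lemma IsSLHessian.mpd_mul_gInv (hH : IsSLHessian H W) (b : Fin n) (x : Fin n → ℝ) :
    mpd b (fun y => H y * gInv H y) x = mpd b H x * gInv H x -
      (H x * gInv H x * mpd b H x * (H x * gInv H x) +
        H x * gInv H x * H x * mpd b H x * gInv H x) := by
  rw [mpd_mul b hH.smooth hH.smooth_gInv, hH.mpd_gInv]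
  noncomm_ring

lemma IsEigenFrame.trace_mpd_gInv_mul (hH : IsSLHessian H W) (hU : IsEigenFrame H x U lam)
    (μ : Fin n → ℝ) :
    ∑ a, ∑ b, inFrame U μ a b * (mpd b (gInv H) x * mpd a H x).trace =
      -∑ i, ∑ j, ∑ k, μ k * (lam i + lam j) * (1 + lam k ^ 2) *
        frameThird H x U lam i j k ^ 2 := by
  have h1 : ∀ a b, inFrame U μ a b * (mpd b (gInv H) x * mpd a H x).trace =
      -(inFrame U μ a b * (gInv H x * mpd b H x * (H x * gInv H x) * mpd a H x).trace +
        inFrame U μ a b * (gInv H x * H x * mpd b H x * gInv H x * mpd a H x).trace) := by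
    intro a b
    rw [hH.mpd_gInv, ← mul_add, ← Matrix.trace_add, neg_mul, Matrix.trace_neg, mul_neg]
    congr 3; noncomm_ring
  simp only [h1, sum_neg_distrib, sum_add_distrib, hU.eq, hU.gInv_eq,
    inFrame_mul hU.left, IsEigenFrame.sum_trace (lam := lam) hH]
  simp only [← sum_add_distrib]
  refine congrArg _ (sum_congr rfl fun i _ => sum_congr rfl fun j _ => sum_congr rfl fun k _ => ?_)
  have h1 : 1 + lam i ^ 2 ≠ 0 := by positivity
  have h2 : 1 + lam j ^ 2 ≠ 0 := by positivity
  field_simp; ring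

lemma IsEigenFrame.gLap_log (hH : IsSLHessian H W) (hU : IsEigenFrame H x U lam) :
    gLap H (fun y => Real.log (W y)) x =
      curvForm lam (frameThird H x U lam) (frameThird H x U lam) := by
  rw [gLap, hH.laplacian_of_grad (hH.smooth.mul hH.smooth_gInv) hH.pd_log]
  simp only [hH.mpd_mul_gInv, sub_mul, add_mul, Matrix.trace_sub, Matrix.trace_add, mul_sub,
    mul_add, sum_sub_distrib, sum_add_distrib]
  have h0 : ∀ a b, mpd b H x * gInv H x * mpd a H x =
      1 * mpd b H x * gInv H x * mpd a H x := fun a b => by rw [one_mul]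
  simp only [h0, hU.one_apply]
  simp only [hU.eq, hU.gInv_eq, inFrame_mul hU.left]
  simp only [hU.trace_mpd_gInv_mul hH, IsEigenFrame.sum_trace (lam := lam) hH]
  have hs := IsEigenFrame.isSymTensor (lam := lam) (U := U) (x := x) hH
  set h := frameThird H x U lam
  have e1 := hs.sum_swap_right fun i j k => lam i * lam k
  have e2 := hs.sum_swap_left fun i j k => lam j * lam k
  have h1 : ∀ i, 1 + lam i ^ 2 ≠ 0 := fun i => by positivity
  calc _ = ∑ i, ∑ j, ∑ k, (1 - lam i * lam j) * h i j k ^ 2 +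
        ∑ i, ∑ j, ∑ k, lam i * lam k * h i j k ^ 2 +
        ∑ i, ∑ j, ∑ k, lam j * lam k * h i j k ^ 2 := by
        simp only [← sum_sub_distrib, ← sum_add_distrib, sub_neg_eq_add]
        refine sum_congr rfl fun i _ => sum_congr rfl fun j _ => sum_congr rfl fun k _ => ?_
        have := h1 i; have := h1 j; have := h1 k
        field_simp; ring
    _ = _ := by
        rw [e2, e1]
        simp only [← sum_add_distrib, curvForm]
        exact sum_congr rfl fun i _ => sum_congr rfl fun j _ => sum_congr rfl fun k _ => by ring

lemma IsEigenFrame.gLap_half_trace (hH : IsSLHessian H W) (hU : IsEigenFrame H x U lam) :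
    gLap H (fun y => 2⁻¹ * (gInv H y).trace) x = metricLap lam (frameThird H x U lam) := by
  have hf : ∀ a y, pd a (fun y => 2⁻¹ * (gInv H y).trace) y =
      ((-1 : Matrix (Fin n) (Fin n) ℝ) * (H y * gInv H y * gInv H y) * mpd a H y).trace := by
    intro a y
    rw [pd_const_mul a _ hH.smooth_gInv.trace, pd_trace a hH.smooth_gInv, hH.mpd_gInv,
      Matrix.trace_neg, mul_add, add_mul, Matrix.trace_add]
    have h1 : (gInv H y * (mpd a H y * H y) * gInv H y).trace =
        (H y * gInv H y * gInv H y * mpd a H y).trace := by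
      rw [Matrix.trace_mul_comm, ← mul_assoc, ← mul_assoc, Matrix.trace_mul_comm]
      simp only [mul_assoc]
    have h2 : (gInv H y * (H y * mpd a H y) * gInv H y).trace =
        (H y * gInv H y * gInv H y * mpd a H y).trace := by
      rw [Matrix.trace_mul_comm, ← hH.gInv_comm, mul_assoc (gInv H y), ← hH.gInv_comm]
      simp only [mul_assoc]
    rw [h1, h2, neg_one_mul, neg_mul, Matrix.trace_neg]; ring
  have hHG := hH.smooth.mul hH.smooth_gInv
  rw [gLap, hH.laplacian_of_grad ((MSmooth.const (-1)).mul (hHG.mul hH.smooth_gInv)) hf]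
  have hd : ∀ a b, (mpd b (fun y => (-1 : Matrix (Fin n) (Fin n) ℝ) *
      (H y * gInv H y * gInv H y)) x * mpd a H x).trace =
      -(1 * mpd b H x * (gInv H x * gInv H x) * mpd a H x).trace +
      (H x * gInv H x * mpd b H x * (H x * gInv H x * gInv H x) * mpd a H x).trace +
      (H x * gInv H x * H x * mpd b H x * (gInv H x * gInv H x) * mpd a H x).trace +
      (H x * gInv H x * gInv H x * mpd b H x * (H x * gInv H x) * mpd a H x).trace +
      (H x * gInv H x * gInv H x * H x * mpd b H x * gInv H x * mpd a H x).trace := by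
    intro a b
    rw [mpd_mul b (MSmooth.const (-1)) (hHG.mul hH.smooth_gInv), mpd_const,
      mpd_mul b hHG hH.smooth_gInv, hH.mpd_mul_gInv, hH.mpd_gInv]
    simp only [← Matrix.trace_add, ← Matrix.trace_neg]
    congr 1
    noncomm_ring
  simp only [hd, mul_add, mul_neg, sum_add_distrib, sum_neg_distrib]
  simp only [hU.one_apply]
  simp only [hU.eq, hU.gInv_eq, inFrame_mul hU.left, inFrame_neg]
  simp only [hU.trace_mpd_gInv_mul hH, IsEigenFrame.sum_trace (lam := lam) hH]
  have hs := IsEigenFrame.isSymTensor (lam := lam) (U := U) (x := x) hH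
  set h := frameThird H x U lam
  have e1 := hs.sum_swap_right fun i j k => lam i * lam k * (1 + lam k ^ 2)⁻¹
  have e2 := hs.sum_swap_left fun i j k => lam j * lam k * (1 + lam k ^ 2)⁻¹
  have e3 := hs.sum_swap_left fun i j k => lam i * lam j * (1 + lam j ^ 2)⁻¹
  have h1 : ∀ i, 1 + lam i ^ 2 ≠ 0 := fun i => by positivity
  calc _ = metricLap lam h +
        (∑ i, ∑ j, ∑ k, lam i * lam j * (1 + lam j ^ 2)⁻¹ * h i j k ^ 2 +
        ∑ i, ∑ j, ∑ k, lam j * lam i * (1 + lam i ^ 2)⁻¹ * h i j k ^ 2) -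
        (∑ i, ∑ j, ∑ k, lam i * lam k * (1 + lam k ^ 2)⁻¹ * h i j k ^ 2 +
        ∑ i, ∑ j, ∑ k, lam j * lam k * (1 + lam k ^ 2)⁻¹ * h i j k ^ 2) := by
        simp only [← sum_sub_distrib, ← sum_add_distrib, sub_neg_eq_add, ← sum_neg_distrib,
          metricLap]
        refine sum_congr rfl fun i _ => sum_congr rfl fun j _ => sum_congr rfl fun k _ => ?_
        have := h1 i; have := h1 j; have := h1 k
        field_simp; ring
    _ = _ := by
        rw [e2, e1, e3]; ring

/-- The divergence of the slope field, divided by the volume density. -/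
noncomputable def slopeDensityDiv (H : (Fin n → ℝ) → Matrix (Fin n) (Fin n) ℝ)
    (x : Fin n → ℝ) : ℝ :=
  ∑ i, (H x * gInv H x * mpd i H x).trace ^ 2 +
    ∑ i, (mpd i (fun y => H y * gInv H y) x * mpd i H x).trace

lemma sum_one_apply (f : Fin n → Fin n → ℝ) :
    ∑ a, ∑ b, (1 : Matrix (Fin n) (Fin n) ℝ) a b * f a b = ∑ a, f a a := by
  simp [Matrix.one_apply]

lemma IsEigenFrame.sum_sq_mul (hU : IsEigenFrame H x U lam) (p q : Fin n → ℝ) :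
    ∑ a, p a * q a = ∑ c, (1 + lam c ^ 2) * ((√((1 + lam c ^ 2)⁻¹) * ∑ a, U a c * p a) *
      (√((1 + lam c ^ 2)⁻¹) * ∑ a, U a c * q a)) := by
  rw [← sum_one_apply fun a b => p a * q b, hU.one_apply, sum_inFrame_mul_mul]
  refine sum_congr rfl fun c _ => ?_
  have h1 : √((1 + lam c ^ 2)⁻¹) * √((1 + lam c ^ 2)⁻¹) = (1 + lam c ^ 2)⁻¹ :=
    Real.mul_self_sqrt (by positivity)
  have h2 : (1 + lam c ^ 2) * (1 + lam c ^ 2)⁻¹ = 1 := mul_inv_cancel₀ (by positivity)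
  linear_combination (-(1 + lam c ^ 2) * ((∑ a, U a c * p a) * ∑ a, U a c * q a)) * h1 -
    ((∑ a, U a c * p a) * ∑ a, U a c * q a) * h2

lemma IsEigenFrame.slopeDensityDiv_eq (hH : IsSLHessian H W) (hU : IsEigenFrame H x U lam) :
    slopeDensityDiv H x = slopeDiv lam (frameThird H x U lam) := by
  rw [slopeDensityDiv, slopeDiv]
  congr 1
  · simp only [sq]
    rw [hU.sum_sq_mul, hU.mul_gInv_eq]
    simp only [IsEigenFrame.sum_mul_trace, ← sq]
  · rw [← sum_one_apply fun a b => (mpd b (fun y => H y * gInv H y) x * mpd a H x).trace]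
    simp only [hH.mpd_mul_gInv, sub_mul, add_mul, Matrix.trace_sub, Matrix.trace_add, mul_sub,
      mul_add, sum_sub_distrib, sum_add_distrib]
    have h0 : ∀ a b, mpd b H x * gInv H x * mpd a H x =
        1 * mpd b H x * gInv H x * mpd a H x := fun a b => by rw [one_mul]
    simp only [h0, hU.one_apply]
    simp only [hU.eq, hU.gInv_eq, inFrame_mul hU.left, IsEigenFrame.sum_trace (lam := lam) hH]
    simp only [← sum_sub_distrib, ← sum_add_distrib]
    refine sum_congr rfl fun i _ => sum_congr rfl fun j _ => sum_congr rfl fun k _ => ?_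
    have h1 : ∀ i, 1 + lam i ^ 2 ≠ 0 := fun i => by positivity
    have := h1 i; have := h1 j; have := h1 k
    field_simp; ring

end FrameLaplacian

section DensityInequality

open Finset
open scoped ContDiff

variable {n : ℕ} {H : (Fin n → ℝ) → Matrix (Fin n) (Fin n) ℝ} {W : (Fin n → ℝ) → ℝ}
  {x : Fin n → ℝ} {U : Matrix (Fin n) (Fin n) ℝ} {lam : Fin n → ℝ}

lemma trace_mul_mpd_pow (k : Fin n) {A : (Fin n → ℝ) → Matrix (Fin n) (Fin n) ℝ} (hA : MSmooth A)
    (x : Fin n → ℝ) (m : ℕ) (C : Matrix (Fin n) (Fin n) ℝ) (hC : C * A x = A x * C) :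
    (C * A x * mpd k (fun y => A y ^ m) x).trace = m * (C * A x ^ m * mpd k A x).trace := by
  induction m generalizing C with
  | zero => simp [mpd_const]
  | succ m ih =>
    have h1 := ih (A x * C) (by rw [mul_assoc, hC])
    have h2 : (C * A x * (mpd k (fun y => A y ^ m) x * A x)).trace =
        (A x * C * A x * mpd k (fun y => A y ^ m) x).trace := by
      rw [← mul_assoc, Matrix.trace_mul_comm]; simp only [mul_assoc]
    have h3 : A x * C * A x ^ m = C * A x ^ (m + 1) := by
      rw [← hC, mul_assoc, ← pow_succ']
    simp only [pow_succ]
    rw [mpd_mul k (hA.pow m) hA, mul_add, Matrix.trace_add, h2, h1, h3, pow_succ]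
    have h5 : C * A x * (A x ^ m * mpd k A x) = C * (A x ^ m * A x) * mpd k A x := by
      rw [← pow_succ, pow_succ']; simp only [mul_assoc]
    rw [h5]
    push_cast; ring

/-- The weight `tr (3 (1 + H²)⁻¹)^ν`. -/
noncomputable def traceWeight (ν : ℕ) (H : (Fin n → ℝ) → Matrix (Fin n) (Fin n) ℝ)
    (x : Fin n → ℝ) : ℝ :=
  (((3 : ℝ) • gInv H x) ^ ν).trace

lemma IsSLHessian.smooth_smul_gInv (hH : IsSLHessian H W) :
    MSmooth fun y => (3 : ℝ) • gInv H y :=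
  fun i j => contDiff_const.mul (hH.smooth_gInv i j)

lemma IsSLHessian.smooth_traceWeight (hH : IsSLHessian H W) (ν : ℕ) :
    ContDiff ℝ ∞ (traceWeight ν H) :=
  (hH.smooth_smul_gInv.pow ν).trace

lemma IsEigenFrame.traceWeight_eq (hU : IsEigenFrame H x U lam) (ν : ℕ) :
    traceWeight ν H x = slopeWeight ν lam := by
  rw [traceWeight, hU.gInv_eq, inFrame_smul, inFrame_pow hU.left hU.right, inFrame_trace hU.left,
    slopeWeight]

lemma IsEigenFrame.pd_traceWeight (hH : IsSLHessian H W) (hU : IsEigenFrame H x U lam) (ν : ℕ)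
    (a : Fin n) : pd a (traceWeight ν H) x = -2 * ν *
      (inFrame U (fun i => lam i * (3 * (1 + lam i ^ 2)⁻¹) ^ ν * (1 + lam i ^ 2)⁻¹) *
        mpd a H x).trace := by
  have hp : ∀ i, 1 + lam i ^ 2 ≠ 0 := fun i => by positivity
  have hA : (3 : ℝ) • gInv H x = inFrame U fun i => 3 * (1 + lam i ^ 2)⁻¹ := by
    rw [hU.gInv_eq, inFrame_smul]
  have hCA : (inFrame U fun i => 3⁻¹ * (1 + lam i ^ 2)) * (3 : ℝ) • gInv H x = 1 := by
    rw [hA, inFrame_mul hU.left, ← inFrame_one hU.right]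
    congr 1; funext i
    have := hp i
    field_simp
  have h1 := trace_mul_mpd_pow a hH.smooth_smul_gInv x ν _
    (by rw [hCA, hA, inFrame_mul hU.left, ← inFrame_one hU.right]
        congr 1; funext i
        have := hp i
        field_simp)
  rw [hCA, one_mul] at h1
  have h2 : mpd a (fun y => (3 : ℝ) • gInv H y) x = (3 : ℝ) • mpd a (gInv H) x := by
    ext i j; exact pd_const_mul a 3 (hH.smooth_gInv i j) x
  have h3 : traceWeight ν H = fun y => (((3 : ℝ) • gInv H y) ^ ν).trace := rfl
  rw [h3, pd_trace a (hH.smooth_smul_gInv.pow ν), h1, h2, hH.mpd_gInv, hA,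
    inFrame_pow hU.left hU.right, inFrame_mul hU.left]
  set P := inFrame U fun i => 3⁻¹ * (1 + lam i ^ 2) * (3 * (1 + lam i ^ 2)⁻¹) ^ ν with hP
  have h4 : (P * (3 : ℝ) • -(gInv H x * (mpd a H x * H x + H x * mpd a H x) * gInv H x)).trace =
      -3 * ((H x * gInv H x * P * gInv H x * mpd a H x).trace +
        (gInv H x * P * gInv H x * H x * mpd a H x).trace) := by
    have e1 : (P * (gInv H x * (mpd a H x * H x) * gInv H x)).trace =
        (H x * gInv H x * P * gInv H x * mpd a H x).trace := by
      have : P * (gInv H x * (mpd a H x * H x) * gInv H x) =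
        (P * gInv H x * mpd a H x) * (H x * gInv H x) := by simp only [mul_assoc]
      rw [this, Matrix.trace_mul_comm]; simp only [mul_assoc]
    have e2 : (P * (gInv H x * (H x * mpd a H x) * gInv H x)).trace =
        (gInv H x * P * gInv H x * H x * mpd a H x).trace := by
      have : P * (gInv H x * (H x * mpd a H x) * gInv H x) =
        (P * gInv H x * H x * mpd a H x) * gInv H x := by simp only [mul_assoc]
      rw [this, Matrix.trace_mul_comm]; simp only [mul_assoc]
    rw [Matrix.mul_smul, Matrix.trace_smul, mul_neg, Matrix.trace_neg, mul_add, add_mul, mul_add,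
      Matrix.trace_add, e1, e2, smul_eq_mul]; ring
  rw [h4]
  have h5 : H x * gInv H x * P * gInv H x =
      inFrame U fun i => 3⁻¹ * (lam i * (3 * (1 + lam i ^ 2)⁻¹) ^ ν * (1 + lam i ^ 2)⁻¹) := by
    rw [hU.mul_gInv_eq, hU.gInv_eq, hP, inFrame_mul hU.left, inFrame_mul hU.left]
    congr 1; funext i
    have := hp i
    field_simp
  have h6 : gInv H x * P * gInv H x * H x =
      inFrame U fun i => 3⁻¹ * (lam i * (3 * (1 + lam i ^ 2)⁻¹) ^ ν * (1 + lam i ^ 2)⁻¹) := by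
    rw [hU.gInv_eq, hU.eq, hP, inFrame_mul hU.left, inFrame_mul hU.left, inFrame_mul hU.left]
    congr 1; funext i
    have := hp i
    field_simp
  rw [h5, h6, ← inFrame_smul, Matrix.smul_mul, Matrix.trace_smul, smul_eq_mul]
  ring

lemma IsEigenFrame.sum_slopeVec (hU : IsEigenFrame H x U lam) (c : Fin n) :
    √((1 + lam c ^ 2)⁻¹) * ∑ a, U a c * slopeVec H a x =
      slopeField lam (frameThird H x U lam) c := by
  have h1 := IsEigenFrame.sum_mul_trace (H := H) (x := x) (U := U) (lam := lam) c lam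
  have h2 := IsEigenFrame.sum_mul_trace (H := H) (x := x) (U := U) (lam := lam) c
    fun i => 1 + lam i ^ 2
  have h3 : (fun i => (1 + lam i ^ 2) * (1 + lam i ^ 2)⁻¹) = fun _ => 1 := by
    funext i; exact mul_inv_cancel₀ (by positivity)
  rw [h3, inFrame_one hU.right] at h2
  simp only [one_mul] at h2
  rw [← hU.mul_gInv_eq] at h1
  have h4 : ∑ a, U a c * ∑ j, (gInv H x * H x) a j * (mpd j H x).trace =
      lam c * (1 + lam c ^ 2)⁻¹ * ∑ j, U j c * (mpd j H x).trace := by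
    have e : U.transpose * (gInv H x * H x) =
        Matrix.diagonal (fun i => lam i * (1 + lam i ^ 2)⁻¹) * U.transpose := by
      rw [hU.gInv_mul_eq, inFrame, ← mul_assoc, ← mul_assoc, hU.left, one_mul]
      simp only [mul_comm]
    have e' : ∀ j, ∑ a, U a c * (gInv H x * H x) a j =
        lam c * (1 + lam c ^ 2)⁻¹ * U j c := by
      intro j
      have := congrFun (congrFun e c) j
      rw [Matrix.diagonal_mul, Matrix.mul_apply] at this
      exact this
    simp only [mul_sum, ← mul_assoc]
    rw [sum_comm]
    exact sum_congr rfl fun j _ => by rw [← sum_mul, e' j]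
  simp only [slopeVec, mul_sub, sum_sub_distrib, h1, h4]
  rw [slopeField, ← h2]; ring


/-- The bounded function `½ tr G + C (v + ½ v²)`, with `v = log W`. -/
noncomputable def potential (C : ℝ) (H : (Fin n → ℝ) → Matrix (Fin n) (Fin n) ℝ)
    (W : (Fin n → ℝ) → ℝ) (x : Fin n → ℝ) : ℝ :=
  2⁻¹ * (gInv H x).trace + C * (Real.log (W x) + 2⁻¹ * Real.log (W x) ^ 2)

lemma IsSLHessian.smooth_log (hH : IsSLHessian H W) :
    ContDiff ℝ ∞ fun y => Real.log (W y) :=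
  hH.W_smooth.log fun y => (hH.W_pos y).ne'

lemma IsSLHessian.smooth_potential (hH : IsSLHessian H W) (C : ℝ) :
    ContDiff ℝ ∞ (potential C H W) :=
  (contDiff_const.mul hH.smooth_gInv.trace).add
    (contDiff_const.mul (hH.smooth_log.add (contDiff_const.mul (hH.smooth_log.pow 2))))

lemma gLap_add {f g : (Fin n → ℝ) → ℝ} (hf : ContDiff ℝ ∞ f) (hg : ContDiff ℝ ∞ g)
    (x : Fin n → ℝ) : gLap H (fun y => f y + g y) x = gLap H f x + gLap H g x := by
  simp only [gLap, ← sum_add_distrib]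
  refine sum_congr rfl fun a _ => sum_congr rfl fun b _ => ?_
  rw [pd_congr b (fun y => pd_add a hf hg y), pd_add b (hf.pd a) (hg.pd a), mul_add]

lemma gLap_const_mul (c : ℝ) {f : (Fin n → ℝ) → ℝ} (hf : ContDiff ℝ ∞ f)
    (x : Fin n → ℝ) : gLap H (fun y => c * f y) x = c * gLap H f x := by
  simp only [gLap, mul_sum]
  refine sum_congr rfl fun a _ => sum_congr rfl fun b _ => ?_
  rw [pd_congr b (fun y => pd_const_mul a c hf y), pd_const_mul b c (hf.pd a)]; ring

lemma gLap_sq {f : (Fin n → ℝ) → ℝ} (hf : ContDiff ℝ ∞ f) (x : Fin n → ℝ) :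
    gLap H (fun y => 2⁻¹ * f y ^ 2) x =
      f x * gLap H f x + ∑ a, ∑ b, gInv H x a b * (pd a f x * pd b f x) := by
  simp only [gLap, mul_sum, ← sum_add_distrib]
  refine sum_congr rfl fun a _ => sum_congr rfl fun b _ => ?_
  have h1 : ∀ y, pd a (fun y => 2⁻¹ * f y ^ 2) y = f y * pd a f y := by
    intro y
    rw [pd_const_mul a _ (hf.pow 2), pd_congr a (fun y => sq (f y)), pd_mul a hf hf]; ring
  rw [pd_congr b h1, pd_mul b hf (hf.pd a)]; ring

lemma IsEigenFrame.sum_pd_log (hH : IsSLHessian H W) (hU : IsEigenFrame H x U lam) :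
    ∑ a, ∑ b, gInv H x a b *
      (pd a (fun y => Real.log (W y)) x * pd b (fun y => Real.log (W y)) x) =
      gradSq lam (frameThird H x U lam) := by
  simp only [hH.pd_log]
  rw [hU.gInv_eq, sum_inFrame_mul_mul, gradSq]
  refine sum_congr rfl fun c _ => ?_
  have h1 := IsEigenFrame.sum_mul_trace (H := H) (x := x) (U := U) (lam := lam) c lam
  have h2 : √((1 + lam c ^ 2)⁻¹) * √((1 + lam c ^ 2)⁻¹) = (1 + lam c ^ 2)⁻¹ :=
    Real.mul_self_sqrt (by positivity)
  rw [← hU.gInv_eq, hU.mul_gInv_eq, ← h1]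
  linear_combination -(∑ a, U a c * ((inFrame U fun i => lam i * (1 + lam i ^ 2)⁻¹) *
    mpd a H x).trace) ^ 2 * h2

lemma IsEigenFrame.sum_sq_mpd_le (hH : IsSLHessian H W) (hU : IsEigenFrame H x U lam) {L : ℝ}
    (hL : ∀ i, lam i ^ 2 ≤ L) :
    ∑ k, ∑ i, ∑ j, mpd k H x i j ^ 2 ≤ (1 + L) ^ 3 * tensorSq (frameThird H x U lam) := by
  have h1 : ∑ k, ∑ i, ∑ j, mpd k H x i j ^ 2 =
      ∑ a, ∑ b, (1 : Matrix (Fin n) (Fin n) ℝ) a b *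
        (1 * mpd b H x * 1 * mpd a H x).trace := by
    rw [sum_one_apply]
    refine sum_congr rfl fun k _ => ?_
    rw [one_mul, mul_one, Matrix.trace]
    refine sum_congr rfl fun i _ => ?_
    rw [Matrix.diag, Matrix.mul_apply]
    exact sum_congr rfl fun j _ => by rw [hH.mpd_symm k x j i, sq]
  rw [h1, hU.one_apply, IsEigenFrame.sum_trace (lam := lam) hH, tensorSq]
  simp only [mul_sum]
  refine sum_le_sum fun i _ => sum_le_sum fun j _ => sum_le_sum fun k _ => ?_
  refine mul_le_mul_of_nonneg_right ?_ (sq_nonneg _)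
  have h2 : ∀ i, 1 + lam i ^ 2 ≤ 1 + L := fun i => by linarith [hL i]
  have h3 : ∀ i, 0 ≤ 1 + lam i ^ 2 := fun i => by positivity
  have h4 : 0 ≤ 1 + L := (h3 i).trans (h2 i)
  calc _ = (1 + lam i ^ 2) * (1 + lam j ^ 2) * (1 + lam k ^ 2) := by ring
    _ ≤ (1 + L) * (1 + L) * (1 + L) := by
        gcongr
        exacts [hL i, hL j, hL k]
    _ = _ := by ring

lemma IsSLHessian.div_weighted (hH : IsSLHessian H W) (ν : ℕ) (x : Fin n → ℝ) :
    ∑ i, pd i (fun y => W y * (traceWeight ν H y * slopeVec H i y)) x =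
      W x * (traceWeight ν H x * slopeDensityDiv H x +
        ∑ i, pd i (traceWeight ν H) x * slopeVec H i x) := by
  have h1 : ∀ i, pd i (fun y => W y * (traceWeight ν H y * slopeVec H i y)) x =
      pd i (traceWeight ν H) x * (W x * slopeVec H i x) +
      traceWeight ν H x * pd i (fun y => W y * slopeVec H i y) x := by
    intro i
    rw [pd_congr i (fun y => mul_left_comm (W y) (traceWeight ν H y) (slopeVec H i y)),
      pd_mul i (hH.smooth_traceWeight ν) (hH.W_smooth.mul (hH.smooth_slopeVec i))]
  simp only [h1]
  have h2 : ∑ i, pd i (traceWeight ν H) x * (W x * slopeVec H i x) =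
      W x * ∑ i, pd i (traceWeight ν H) x * slopeVec H i x := by
    rw [mul_sum]; exact sum_congr rfl fun i _ => by ring
  rw [sum_add_distrib, ← mul_sum, hH.div_slopeVec, slopeDensityDiv, h2]
  ring

/-- Along the graph, `potential` is a subsolution up to a divergence term, and its defect
controls the third derivatives. -/
theorem exists_potential_bound (n : ℕ) {L : ℝ} (hL : 0 ≤ L) :
    ∃ c > 0, ∀ κ ≥ 0, ∃ (ν : ℕ) (C : ℝ), 0 ≤ C ∧ ∀ (H : (Fin n → ℝ) → Matrix (Fin n) (Fin n) ℝ)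
      (W : (Fin n → ℝ) → ℝ), IsSLHessian H W → (∀ x, 1 ≤ W x) → (∀ x, ∃ U lam,
        IsEigenFrame H x U lam ∧ (∀ i, lam i ^ 2 ≤ L) ∧ CurvNonneg lam) → ∀ x,
      c * ∑ k, ∑ i, ∑ j, mpd k H x i j ^ 2 ≤ gLap H (potential C H W) x +
        (W x)⁻¹ * ∑ i, pd i (fun y => W y * (traceWeight ν H y * slopeVec H i y)) x -
        κ * ∑ i, (traceWeight ν H x * slopeVec H i x) ^ 2 := by
  refine ⟨((1 + L) ^ 2)⁻¹ * ((1 + L) ^ 3)⁻¹, by positivity, fun κ hκ => ?_⟩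
  obtain ⟨ν, C, hC, hb⟩ := exists_slopeDensity_bound n hL hκ
  refine ⟨ν, C, hC, ?_⟩
  intro H W hH hW hfr x
  obtain ⟨U, lam, hU, hlam, hcv⟩ := hfr x
  have hs := IsEigenFrame.isSymTensor (lam := lam) (U := U) (x := x) hH
  have ht := IsEigenFrame.isTraceFree hH hU
  have h1 := hb lam hlam hcv _ hs ht
  have h2 : gLap H (potential C H W) x = metricLap lam (frameThird H x U lam) +
      C * ((1 + Real.log (W x)) * curvForm lam (frameThird H x U lam) (frameThird H x U lam) +
        gradSq lam (frameThird H x U lam)) := by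
    have e : potential C H W = fun y => 2⁻¹ * (gInv H y).trace +
      C * (Real.log (W y) + 2⁻¹ * Real.log (W y) ^ 2) := rfl
    have hs2 : ContDiff ℝ ∞ fun y => 2⁻¹ * Real.log (W y) ^ 2 :=
      contDiff_const.mul (hH.smooth_log.pow 2)
    rw [e, gLap_add (contDiff_const.mul hH.smooth_gInv.trace)
      (contDiff_const.mul (hH.smooth_log.add hs2)), gLap_const_mul C (hH.smooth_log.add hs2),
      gLap_add hH.smooth_log hs2, gLap_sq hH.smooth_log, hU.gLap_half_trace hH, hU.gLap_log hH,
      hU.sum_pd_log hH]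
    ring
  have hp : ∀ i, √((1 + lam i ^ 2)⁻¹) * ∑ a, U a i * pd a (traceWeight ν H) x =
      slopeWeightGrad ν lam (frameThird H x U lam) i := by
    intro c
    have := IsEigenFrame.sum_mul_trace (H := H) (x := x) (U := U) (lam := lam) c
      fun i => lam i * (3 * (1 + lam i ^ 2)⁻¹) ^ ν
    rw [slopeWeightGrad, ← this]
    simp only [hU.pd_traceWeight hH, mul_sum]
    exact sum_congr rfl fun a _ => by ring
  have h3 : ∑ i, pd i (traceWeight ν H) x * slopeVec H i x = ∑ k, (1 + lam k ^ 2) *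
      (slopeWeightGrad ν lam (frameThird H x U lam) k *
        slopeField lam (frameThird H x U lam) k) := by
    rw [hU.sum_sq_mul]
    simp only [hU.sum_slopeVec, hp]
  have h4 : ∑ i, (traceWeight ν H x * slopeVec H i x) ^ 2 = slopeWeight ν lam ^ 2 *
      ∑ k, (1 + lam k ^ 2) * slopeField lam (frameThird H x U lam) k ^ 2 := by
    have : ∑ i, slopeVec H i x * slopeVec H i x =
        ∑ k, (1 + lam k ^ 2) * slopeField lam (frameThird H x U lam) k ^ 2 := by
      rw [hU.sum_sq_mul]
      simp only [hU.sum_slopeVec, ← sq]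
    rw [← this, hU.traceWeight_eq, mul_sum]
    exact sum_congr rfl fun i _ => by ring
  rw [hH.div_weighted, inv_mul_cancel_left₀ (hH.W_pos x).ne', h2, h3, h4, hU.traceWeight_eq,
    hU.slopeDensityDiv_eq hH]
  have h5 := hU.sum_sq_mpd_le hH hlam
  have h6 : ((1 + L) ^ 2)⁻¹ * ((1 + L) ^ 3)⁻¹ * ∑ k, ∑ i, ∑ j, mpd k H x i j ^ 2 ≤
      ((1 + L) ^ 2)⁻¹ * tensorSq (frameThird H x U lam) := by
    rw [mul_assoc]
    refine mul_le_mul_of_nonneg_left ?_ (by positivity)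
    rw [inv_mul_le_iff₀ (by positivity)]
    exact h5
  have h7 : 0 ≤ C * (Real.log (W x) *
      curvForm lam (frameThird H x U lam) (frameThird H x U lam)) :=
    mul_nonneg hC (mul_nonneg (Real.log_nonneg (hW x)) (hcv _ hs ht))
  rw [slopeDensity] at h1
  linarith

end DensityInequality

section Phase

open Finset
open scoped ContDiff

lemma Complex.one_add_I_mul_eq (t : ℝ) :
    1 + Complex.I * t = √(1 + t ^ 2) * Complex.exp (Complex.I * Real.arctan t) := by
  have h : √(1 + t ^ 2) ≠ 0 := by positivity
  rw [mul_comm Complex.I (Real.arctan t : ℂ), Complex.exp_mul_I, ← Complex.ofReal_cos,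
    ← Complex.ofReal_sin, Real.cos_arctan, Real.sin_arctan]
  apply Complex.ext <;> simp <;> field_simp

lemma pd_ofReal {n : ℕ} (k : Fin n) {f : (Fin n → ℝ) → ℝ} (hf : ContDiff ℝ ∞ f)
    (x : Fin n → ℝ) : pd k (fun y => (f y : ℂ)) x = ((pd k f x : ℝ) : ℂ) := by
  have h := (Complex.ofRealCLM.hasFDerivAt (x := f x)).comp x
    (hf.differentiable_of_top x).hasFDerivAt
  have h2 : fderiv ℝ (fun y => (f y : ℂ)) x = Complex.ofRealCLM.comp (fderiv ℝ f x) := h.fderiv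
  simp [pd, h2]

section Density

variable {n : ℕ} {F : (Fin n → ℝ) → ℝ}

lemma MSmooth.hess (hF : ContDiff ℝ ∞ F) : MSmooth (Hess n F) :=
  fun i j => (hF.pd j).pd i

/-- The complexification `1 + iH` of a matrix field. -/
noncomputable def slMatrix (H : (Fin n → ℝ) → Matrix (Fin n) (Fin n) ℝ) (y : Fin n → ℝ) :
    Matrix (Fin n) (Fin n) ℂ :=
  1 + Complex.I • Complex.ofRealHom.mapMatrix (H y)

lemma mapMatrix_inFrame (U : Matrix (Fin n) (Fin n) ℝ) (d : Fin n → ℝ) :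
    Complex.ofRealHom.mapMatrix (inFrame U d) =
      inFrame (Complex.ofRealHom.mapMatrix U) fun i => (d i : ℂ) := by
  have h : Complex.ofRealHom.mapMatrix (Matrix.diagonal d) =
      Matrix.diagonal fun i => (d i : ℂ) := by
    ext i j
    by_cases hij : i = j <;> simp [hij]
  rw [inFrame, inFrame, map_mul, map_mul, h]
  rfl

lemma IsEigenFrame.det_slMatrix {H : (Fin n → ℝ) → Matrix (Fin n) (Fin n) ℝ} {x : Fin n → ℝ}
    {U : Matrix (Fin n) (Fin n) ℝ} {lam : Fin n → ℝ} (hU : IsEigenFrame H x U lam) :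
    (slMatrix H x).det =
      (∏ i, √(1 + lam i ^ 2) : ℝ) * Complex.exp (Complex.I * (∑ i, Real.arctan (lam i) : ℝ)) := by
  have h1 : (Complex.ofRealHom.mapMatrix U).transpose * Complex.ofRealHom.mapMatrix U = 1 := by
    have := congrArg Complex.ofRealHom.mapMatrix hU.left
    rw [map_mul, map_one] at this
    exact this
  have h2 : Complex.ofRealHom.mapMatrix U * (Complex.ofRealHom.mapMatrix U).transpose = 1 := by
    have := congrArg Complex.ofRealHom.mapMatrix hU.right
    rw [map_mul, map_one] at this
    exact this
  rw [slMatrix, hU.eq, mapMatrix_inFrame, inFrame_smul, ← inFrame_one h2, inFrame_add,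
    inFrame_det h1]
  simp only [Complex.one_add_I_mul_eq, prod_mul_distrib]
  rw [← Complex.exp_sum, Complex.ofReal_prod, Complex.ofReal_sum, mul_sum]

/-- The volume density of a special Lagrangian graph of phase `Θ`. -/
noncomputable def slDensity (Θ : ℝ) (H : (Fin n → ℝ) → Matrix (Fin n) (Fin n) ℝ)
    (y : Fin n → ℝ) : ℝ :=
  (Complex.exp (-(Complex.I * Θ)) * (slMatrix H y).det).re

lemma MSmooth.slMatrix {H : (Fin n → ℝ) → Matrix (Fin n) (Fin n) ℝ} (hH : MSmooth H) :
    MSmooth (slMatrix H) := by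
  intro i j
  have : ContDiff ℝ ∞ fun y => (H y i j : ℂ) := Complex.ofRealCLM.contDiff.comp (hH i j)
  exact contDiff_const.add (contDiff_const.mul this)

variable {Θ : ℝ}

lemma exp_mul_det_slMatrix {H : (Fin n → ℝ) → Matrix (Fin n) (Fin n) ℝ}
    (hsymm : ∀ x, (H x).IsHermitian)
    (hSLE : ∀ x, ∑ i, Real.arctan ((hsymm x).eigenvalues i) = Θ) (x : Fin n → ℝ) :
    Complex.exp (-(Complex.I * Θ)) * (slMatrix H x).det =
      (∏ i, √(1 + (hsymm x).eigenvalues i ^ 2) : ℝ) := by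
  obtain ⟨U, hU⟩ := (hsymm x).exists_isEigenFrame
  rw [hU.det_slMatrix, hSLE, mul_left_comm, ← Complex.exp_add]
  simp

lemma slDensity_eq_prod {H : (Fin n → ℝ) → Matrix (Fin n) (Fin n) ℝ}
    (hsymm : ∀ x, (H x).IsHermitian)
    (hSLE : ∀ x, ∑ i, Real.arctan ((hsymm x).eigenvalues i) = Θ) (x : Fin n → ℝ) :
    slDensity Θ H x = ∏ i, √(1 + (hsymm x).eigenvalues i ^ 2) := by
  rw [slDensity, exp_mul_det_slMatrix hsymm hSLE, Complex.ofReal_re]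

theorem isSLHessian_hess (hF : ContDiff ℝ ∞ F) (hsymm : ∀ x, (Hess n F x).IsHermitian)
    (hSLE : ∀ x, ∑ i, Real.arctan ((hsymm x).eigenvalues i) = Θ) :
    IsSLHessian (Hess n F) (slDensity Θ (Hess n F)) := by
  set H := Hess n F with hHdef
  have hH : MSmooth H := MSmooth.hess hF
  set W := slDensity Θ H with hW
  have hWs : ContDiff ℝ ∞ W :=
    Complex.reCLM.contDiff.comp (contDiff_const.mul hH.slMatrix.det)
  have hWpos : ∀ x, 0 < W x := fun x => by
    rw [hW, slDensity_eq_prod hsymm hSLE]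
    exact prod_pos fun i _ => by positivity
  have hWc : ∀ x, (W x : ℂ) = Complex.exp (-(Complex.I * Θ)) * (slMatrix H x).det := fun x => by
    rw [hW, slDensity, exp_mul_det_slMatrix hsymm hSLE, Complex.ofReal_re]
  have hdet : ∀ x, (1 + H x * H x).det ≠ 0 := fun x => by
    obtain ⟨U, hU⟩ := (hsymm x).exists_isEigenFrame
    rw [hU.eq, inFrame_mul hU.left, ← inFrame_one hU.right, inFrame_add, inFrame_det hU.left]
    exact prod_ne_zero_iff.2 fun i _ =>
      (add_pos_of_pos_of_nonneg one_pos (mul_self_nonneg _)).ne'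
  have key : ∀ k x, ((pd k W x : ℝ) : ℂ) =
      W x * (Complex.I * ((gInv H x * mpd k H x).trace : ℝ) +
        ((H x * gInv H x * mpd k H x).trace : ℝ)) := by
    intro k x
    have hs := hH.slMatrix
    have hd0 : (slMatrix H x).det ≠ 0 := fun h => by
      have := hWc x
      rw [h, mul_zero] at this
      exact (hWpos x).ne' (by exact_mod_cast this)
    set φ := Complex.ofRealHom.mapMatrix (m := Fin n) with hφ
    have hinv : (slMatrix H x)⁻¹ = (1 - Complex.I • φ (H x)) * φ (gInv H x) := by
      refine Matrix.inv_eq_right_inv ?_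
      have h1 : (1 + H x * H x) * gInv H x = 1 :=
        Matrix.mul_nonsing_inv _ (isUnit_iff_ne_zero.2 (hdet x))
      have h2 := congrArg φ h1
      rw [map_mul, map_add, map_mul, map_one] at h2
      have h3 : slMatrix H x * (1 - Complex.I • φ (H x)) = 1 + φ (H x) * φ (H x) := by
        change (1 + Complex.I • φ (H x)) * _ = _
        rw [add_mul, one_mul, mul_sub, mul_one, smul_mul_smul_comm, Complex.I_mul_I, neg_one_smul]
        abel
      rw [← mul_assoc, h3, h2]
    have hadj : (slMatrix H x).adjugate = (slMatrix H x).det • (slMatrix H x)⁻¹ := by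
      rw [Matrix.inv_def, Ring.inverse_eq_inv', smul_smul, mul_inv_cancel₀ hd0, one_smul]
    have hm : mpd k (slMatrix H) x = Complex.I • φ (mpd k H x) := by
      have hc : MSmooth fun y => φ (H y) := fun i j => Complex.ofRealCLM.contDiff.comp (hH i j)
      ext i j
      change pd k (fun y => (1 : Matrix (Fin n) (Fin n) ℂ) i j + Complex.I * (H y i j : ℂ)) x = _
      have hij : ContDiff ℝ ∞ fun y => (H y i j : ℂ) := hc i j
      rw [pd_add k (f := fun _ => (1 : Matrix (Fin n) (Fin n) ℂ) i j) contDiff_const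
        (contDiff_const.mul hij), pd_const, zero_add, pd_const_mul k _ hij]
      change Complex.I * pd k (fun y => (H y i j : ℂ)) x = _
      rw [pd_ofReal k (hH i j)]
      rfl
    rw [← pd_ofReal k hWs, pd_congr k hWc x, pd_const_mul k _ hs.det, pd_det k hs, hadj, hm, hinv,
      Matrix.smul_mul, Matrix.trace_smul, smul_eq_mul, ← mul_assoc, ← hWc]
    congr 1
    have htr : ∀ M : Matrix (Fin n) (Fin n) ℝ, ((M.trace : ℝ) : ℂ) = (φ M).trace := fun M => by
      simp [Matrix.trace, hφ]
    rw [htr, htr, map_mul, map_mul, map_mul, Matrix.mul_smul, Matrix.trace_smul, sub_mul, one_mul,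
      sub_mul, Matrix.trace_sub, Matrix.smul_mul, Matrix.smul_mul, Matrix.trace_smul, smul_eq_mul,
      smul_eq_mul, mul_sub, ← mul_assoc Complex.I Complex.I, Complex.I_mul_I]
    ring
  refine ⟨hH, ?_, ?_, hWs, hWpos, hdet, ?_, ?_⟩
  · intro x i j
    exact pd_comm i hF j x
  · intro x i j k
    exact pd_comm k (hF.pd j) i x
  · intro k x
    have h := congrArg Complex.im (key k x)
    simp at h
    exact h.resolve_left (hWpos x).ne'
  · intro k x
    have h := congrArg Complex.re (key k x)
    simpa using h

end Density

end Phase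

section Cutoffs

open Finset
open scoped ContDiff

/-- The truncation profile `s ↦ (1 - s)₊`. -/
noncomputable def cutoff (s : ℝ) : ℝ := max (1 - s) 0

lemma cutoff_nonneg (s : ℝ) : 0 ≤ cutoff s := le_max_right _ _

lemma cutoff_of_one_le {s : ℝ} (h : 1 ≤ s) : cutoff s = 0 := max_eq_right (by linarith)

lemma cutoff_of_le_one {s : ℝ} (h : s ≤ 1) : cutoff s = 1 - s := max_eq_left (by linarith)

lemma cutoff_le_one {s : ℝ} (h : 0 ≤ s) : cutoff s ≤ 1 := max_le (by linarith) one_pos.le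

lemma cutoff_antitone : Antitone cutoff := fun a b h => max_le_max (by linarith) le_rfl

@[fun_prop]
lemma continuous_cutoff : Continuous cutoff := by unfold cutoff; fun_prop

lemma hasDerivAt_cutoff_pow (m : ℕ) (s : ℝ) :
    HasDerivAt (fun t => cutoff t ^ (m + 2)) (-((m + 2) * cutoff s ^ (m + 1))) s := by
  have hpoly : ∀ t, HasDerivAt (fun t : ℝ => (1 - t) ^ (m + 2)) (-((m + 2) * (1 - t) ^ (m + 1))) t :=
    fun t => by
      refine (((hasDerivAt_id t).const_sub 1).pow (m + 2)).congr_deriv ?_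
      simp
  rcases lt_trichotomy s 1 with h | rfl | h
  · rw [cutoff_of_le_one h.le]
    refine (hpoly s).congr_of_eventuallyEq ?_
    filter_upwards [Iio_mem_nhds h] with t ht
    rw [cutoff_of_le_one (le_of_lt ht)]
  · rw [cutoff_of_one_le le_rfl]
    have h1 : HasDerivWithinAt (fun t => cutoff t ^ (m + 2)) (-((m + 2) * 0 ^ (m + 1)))
        (Set.Iic 1) 1 := by
      have := (hpoly 1).hasDerivWithinAt (s := Set.Iic 1)
      rw [sub_self] at this
      exact this.congr (fun t ht => by rw [cutoff_of_le_one ht]) (by simp [cutoff])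
    have h2 : HasDerivWithinAt (fun t => cutoff t ^ (m + 2)) (-((m + 2) * 0 ^ (m + 1)))
        (Set.Ici 1) 1 := by
      have := (hasDerivAt_const (1 : ℝ) (0 : ℝ)).hasDerivWithinAt (s := Set.Ici 1)
      simp only [ne_eq, Nat.add_eq_zero_iff, one_ne_zero, and_false, not_false_eq_true, zero_pow,
        mul_zero, neg_zero]
      exact this.congr (fun t ht => by rw [cutoff_of_one_le ht]; simp) (by simp [cutoff])
    have := h1.union h2
    rwa [Set.Iic_union_Ici, hasDerivWithinAt_univ] at this
  · rw [cutoff_of_one_le h.le]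
    simp only [ne_eq, Nat.add_eq_zero_iff, one_ne_zero, and_false, not_false_eq_true, zero_pow,
        mul_zero, neg_zero]
    refine (hasDerivAt_const s (0 : ℝ)).congr_of_eventuallyEq ?_
    filter_upwards [Ioi_mem_nhds h] with t ht
    rw [cutoff_of_one_le (le_of_lt ht)]
    simp

section IntegrationByParts

open MeasureTheory

variable {n : ℕ}

lemma integral_sum_pd_mul_eq {φ : (Fin n → ℝ) → ℝ} {X : Fin n → (Fin n → ℝ) → ℝ}
    (hφ : ContDiff ℝ 1 φ) (hc : HasCompactSupport φ) (hX : ∀ i, ContDiff ℝ ∞ (X i)) :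
    ∫ x, φ x * ∑ i, pd i (X i) x = -∫ x, ∑ i, pd i φ x * X i x := by
  have hpc : ∀ i, HasCompactSupport (pd i φ) := fun i => hc.fderiv_apply ℝ _
  have hpφ : ∀ i, Continuous (pd i φ) := fun i =>
    (hφ.continuous_fderiv one_ne_zero).clm_apply continuous_const
  have h1 : ∀ i, Integrable fun x => pd i φ x * X i x := fun i =>
    ((hpφ i).mul (hX i).continuous).integrable_of_hasCompactSupport (hpc i).mul_right
  have h2 : ∀ i, Integrable fun x => φ x * pd i (X i) x := fun i =>
    (hφ.continuous.mul ((hX i).pd i).continuous).integrable_of_hasCompactSupport hc.mul_right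
  have h3 : ∀ i, Integrable fun x => φ x * X i x := fun i =>
    (hφ.continuous.mul (hX i).continuous).integrable_of_hasCompactSupport hc.mul_right
  simp only [mul_sum]
  rw [integral_finsetSum _ fun i _ => h2 i, integral_finsetSum _ fun i _ => h1 i,
    ← sum_neg_distrib]
  refine sum_congr rfl fun i _ => ?_
  exact integral_mul_fderiv_eq_neg_fderiv_mul_of_integrable (h1 i) (h2 i) (h3 i)
    (fun x _ => hφ.differentiable one_ne_zero x) fun x _ => (hX i).differentiable_of_top x

variable {r : (Fin n → ℝ) → ℝ}

lemma hasCompactSupport_of_cutoff (hr : ∀ x, ‖x‖ ^ 2 ≤ r x) {τ : ℝ} (hτ : 0 < τ)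
    {f : (Fin n → ℝ) → ℝ} (hf : ∀ x, 1 ≤ τ * r x → f x = 0) : HasCompactSupport f := by
  refine HasCompactSupport.intro (isCompact_closedBall 0 (1 / τ + 1)) fun x hx => hf x ?_
  rw [mem_closedBall_zero_iff, not_le] at hx
  have h0 : 0 < 1 / τ := by positivity
  have h1 : 1 / τ ≤ r x := by nlinarith [hr x]
  calc 1 = τ * (1 / τ) := by field_simp
    _ ≤ _ := by gcongr

lemma contDiff_cutoff_pow (m : ℕ) : ContDiff ℝ 1 fun t => cutoff t ^ (m + 2) := by
  rw [contDiff_one_iff_deriv]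
  refine ⟨fun t => (hasDerivAt_cutoff_pow m t).differentiableAt, ?_⟩
  rw [funext fun t => (hasDerivAt_cutoff_pow m t).deriv]
  fun_prop

lemma integral_cutoff_mul_div (hr : ∀ x, ‖x‖ ^ 2 ≤ r x) (hrs : ContDiff ℝ ∞ r) {τ : ℝ}
    (hτ : 0 < τ) (m : ℕ) {X : Fin n → (Fin n → ℝ) → ℝ} (hX : ∀ i, ContDiff ℝ ∞ (X i)) :
    ∫ x, cutoff (τ * r x) ^ (m + 2) * ∑ i, pd i (X i) x =
      (m + 2) * τ * ∫ x, cutoff (τ * r x) ^ (m + 1) * ∑ i, pd i r x * X i x := by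
  have hφ : ContDiff ℝ 1 fun x => cutoff (τ * r x) ^ (m + 2) :=
    (contDiff_cutoff_pow m).comp (contDiff_const.mul (hrs.of_le (by simp)))
  have hc : HasCompactSupport fun x => cutoff (τ * r x) ^ (m + 2) :=
    hasCompactSupport_of_cutoff hr hτ fun x hx => by rw [cutoff_of_one_le hx]; simp
  rw [integral_sum_pd_mul_eq hφ hc hX, ← integral_const_mul, ← integral_neg]
  congr 1
  ext x
  have h : ∀ i, pd i (fun x => cutoff (τ * r x) ^ (m + 2)) x =
      -((m + 2) * cutoff (τ * r x) ^ (m + 1)) * (τ * pd i r x) := fun i => by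
    have h1 := (hasDerivAt_cutoff_pow m (τ * r x)).comp_hasFDerivAt x
      ((hrs.differentiable_of_top x).hasFDerivAt.const_mul τ)
    have h2 : fderiv ℝ (fun x => cutoff (τ * r x) ^ (m + 2)) x = _ := h1.fderiv
    rw [pd, h2]
    simp [pd]
  simp only [h, mul_sum, ← sum_neg_distrib]
  exact sum_congr rfl fun i _ => by ring

end IntegrationByParts

end Cutoffs

section FirstVariation

open Finset
open scoped ContDiff

section Graph

variable {n : ℕ}

/-- The data of a special Lagrangian graph `y ↦ (y, u y)` through the origin: `H` is the
derivative of `u` and `W` the volume density. -/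
structure IsSLGraph (H : (Fin n → ℝ) → Matrix (Fin n) (Fin n) ℝ) (W : (Fin n → ℝ) → ℝ)
    (u : (Fin n → ℝ) → Fin n → ℝ) : Prop extends IsSLHessian H W where
  u_smooth : ∀ i, ContDiff ℝ ∞ fun y => u y i
  u_pd : ∀ k i x, pd k (fun y => u y i) x = H x k i
  u_zero : u 0 = 0

/-- The squared Euclidean distance of `(x, u x)` from the origin. -/
noncomputable def radius (u : (Fin n → ℝ) → Fin n → ℝ) (x : Fin n → ℝ) : ℝ :=
  ∑ i, (x i ^ 2 + u x i ^ 2)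

/-- The squared length of the normal part of the position vector of the graph. -/
noncomputable def coneDefect (H : (Fin n → ℝ) → Matrix (Fin n) (Fin n) ℝ)
    (u : (Fin n → ℝ) → Fin n → ℝ) (x : Fin n → ℝ) : ℝ :=
  ∑ a, ∑ b, gInv H x a b * ((u x - (H x).mulVec x) a * (u x - (H x).mulVec x) b)

lemma norm_sq_le_sum_sq (x : Fin n → ℝ) : ‖x‖ ^ 2 ≤ ∑ i, x i ^ 2 := by
  have h0 : 0 ≤ ∑ i, x i ^ 2 := sum_nonneg fun i _ => sq_nonneg _
  have h : ‖x‖ ≤ √(∑ i, x i ^ 2) := (pi_norm_le_iff_of_nonneg (Real.sqrt_nonneg _)).2 fun i => by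
    rw [Real.norm_eq_abs, ← Real.sqrt_sq_eq_abs]
    exact Real.sqrt_le_sqrt (single_le_sum (fun j _ => sq_nonneg (x j)) (mem_univ i))
  calc ‖x‖ ^ 2 ≤ √(∑ i, x i ^ 2) ^ 2 := by gcongr
    _ = _ := Real.sq_sqrt h0

lemma norm_sq_le_radius (u : (Fin n → ℝ) → Fin n → ℝ) (x : Fin n → ℝ) : ‖x‖ ^ 2 ≤ radius u x :=
  (norm_sq_le_sum_sq x).trans (sum_le_sum fun i _ => by nlinarith [sq_nonneg (u x i)])

lemma radius_nonneg (u : (Fin n → ℝ) → Fin n → ℝ) (x : Fin n → ℝ) : 0 ≤ radius u x :=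
  (sq_nonneg _).trans (norm_sq_le_radius u x)

lemma contDiff_coord (i : Fin n) : ContDiff ℝ ∞ fun y : Fin n → ℝ => y i :=
  contDiff_apply ℝ ℝ i

lemma pd_coord (k i : Fin n) (x : Fin n → ℝ) :
    pd k (fun y => y i) x = (1 : Matrix (Fin n) (Fin n) ℝ) k i := by
  have : fderiv ℝ (fun y : Fin n → ℝ => y i) x = ContinuousLinearMap.proj i :=
    (ContinuousLinearMap.proj (R := ℝ) (φ := fun _ : Fin n => ℝ) i).fderiv
  rw [pd, this]
  simp [Matrix.one_apply, Pi.single_apply, eq_comm]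

lemma pd_sq (k : Fin n) {f : (Fin n → ℝ) → ℝ} (hf : ContDiff ℝ ∞ f) (x : Fin n → ℝ) :
    pd k (fun y => f y ^ 2) x = 2 * (f x * pd k f x) := by
  simp only [sq]
  rw [pd_mul k hf hf]
  ring

namespace IsSLHessian

variable {H : (Fin n → ℝ) → Matrix (Fin n) (Fin n) ℝ} {W : (Fin n → ℝ) → ℝ}

lemma contDiff_weightedGrad (hH : IsSLHessian H W) {f : (Fin n → ℝ) → ℝ} (hf : ContDiff ℝ ∞ f)
    (i : Fin n) : ContDiff ℝ ∞ fun y => ∑ a, W y * gInv H y a i * pd a f y :=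
  ContDiff.sum fun a _ => (hH.W_smooth.mul (hH.smooth_gInv a i)).mul (hf.pd a)

lemma sum_pd_weightedGrad (hH : IsSLHessian H W) {f : (Fin n → ℝ) → ℝ} (hf : ContDiff ℝ ∞ f)
    (x : Fin n → ℝ) :
    ∑ i, pd i (fun y => ∑ a, W y * gInv H y a i * pd a f y) x = W x * gLap H f x := by
  have hs : ∀ a i, ContDiff ℝ ∞ fun y => W y * gInv H y a i :=
    fun a i => hH.W_smooth.mul (hH.smooth_gInv a i)
  have h1 : ∀ i, pd i (fun y => ∑ a, W y * gInv H y a i * pd a f y) x =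
      ∑ a, (pd i (fun y => W y * gInv H y a i) x * pd a f x +
        W x * gInv H x a i * pd i (pd a f) x) := fun i => by
    rw [pd_sum i _ fun a _ => (hs a i).mul (hf.pd a)]
    exact sum_congr rfl fun a _ => pd_mul i (hs a i) (hf.pd a) x
  simp only [h1]
  rw [sum_comm, gLap, mul_sum]
  refine sum_congr rfl fun a _ => ?_
  rw [sum_add_distrib, ← sum_mul, hH.div_gInv, zero_mul, zero_add, mul_sum]
  exact sum_congr rfl fun b _ => by ring

/-- The inverse metric as a quadratic form is a sum of squares. -/
lemma gInv_quadForm (hH : IsSLHessian H W) (x v : Fin n → ℝ) :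
    ∑ a, ∑ b, gInv H x a b * (v a * v b) = ∑ i, (gInv H x).mulVec v i ^ 2 +
      ∑ i, (H x).mulVec ((gInv H x).mulVec v) i ^ 2 := by
  have e1 : ∑ a, ∑ b, gInv H x a b * (v a * v b) = v ⬝ᵥ (gInv H x).mulVec v := by
    simp only [dotProduct, Matrix.mulVec, mul_sum]
    exact sum_congr rfl fun a _ => sum_congr rfl fun b _ => by ring
  have e2 : ∀ w : Fin n → ℝ, ∑ i, w i ^ 2 = w ⬝ᵥ w := fun w => by simp [dotProduct, sq]
  rw [e1, e2, e2]
  set w := (gInv H x).mulVec v with hw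
  have hv : v = w + (H x).mulVec ((H x).mulVec w) := by
    rw [Matrix.mulVec_mulVec, hw, Matrix.mulVec_mulVec, ← Matrix.add_mulVec]
    rw [← one_add_mul, hH.mul_gInv, Matrix.one_mulVec]
  have h3 : (H x).mulVec w ⬝ᵥ (H x).mulVec w = (H x).mulVec ((H x).mulVec w) ⬝ᵥ w := by
    rw [Matrix.dotProduct_mulVec, ← Matrix.mulVec_transpose, hH.transpose_eq]
  rw [h3, ← add_dotProduct, ← hv]

end IsSLHessian

namespace IsSLGraph

variable {H : (Fin n → ℝ) → Matrix (Fin n) (Fin n) ℝ} {W : (Fin n → ℝ) → ℝ}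
  {u : (Fin n → ℝ) → Fin n → ℝ}

lemma smooth_radius (h : IsSLGraph H W u) : ContDiff ℝ ∞ (radius u) :=
  ContDiff.sum fun i _ => ((contDiff_coord i).pow 2).add ((h.u_smooth i).pow 2)

lemma pd_radius (h : IsSLGraph H W u) (k : Fin n) (x : Fin n → ℝ) :
    pd k (radius u) x = 2 * (x + (H x).mulVec (u x)) k := by
  have e : pd k (radius u) x = ∑ i, (2 * (x i * (1 : Matrix (Fin n) (Fin n) ℝ) k i) +
      2 * (u x i * H x k i)) := by
    unfold radius
    rw [pd_sum k _ fun i _ => ((contDiff_coord i).pow 2).add ((h.u_smooth i).pow 2)]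
    refine sum_congr rfl fun i _ => ?_
    rw [pd_add k ((contDiff_coord i).pow 2) ((h.u_smooth i).pow 2), pd_sq k (contDiff_coord i),
      pd_sq k (h.u_smooth i), pd_coord, h.u_pd]
  rw [e, sum_add_distrib, ← mul_sum, ← mul_sum, ← mul_add]
  congr 1
  simp [Matrix.one_apply, Matrix.mulVec, dotProduct, mul_comm]

lemma gLap_radius (h : IsSLGraph H W u) (x : Fin n → ℝ) : gLap H (radius u) x = 2 * n := by
  have e : ∀ a b, pd b (pd a (radius u)) x = 2 * (1 : Matrix (Fin n) (Fin n) ℝ) b a +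
      2 * ((H x * H x) b a + ∑ i, u x i * mpd i H x b a) := fun a b => by
    have e1 : pd a (radius u) = fun y => 2 * y a + 2 * ∑ i, H y a i * u y i := by
      ext y; rw [h.pd_radius]; simp [Matrix.mulVec, dotProduct]; ring
    have hs : ∀ i, ContDiff ℝ ∞ fun y => H y a i * u y i := fun i =>
      (h.smooth a i).mul (h.u_smooth i)
    rw [e1, pd_add b (contDiff_const.mul (contDiff_coord a))
      (contDiff_const.mul (ContDiff.sum fun i _ => hs i)), pd_const_mul b _ (contDiff_coord a),
      pd_coord, pd_const_mul b _ (ContDiff.sum fun i _ => hs i), pd_sum b _ fun i _ => hs i]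
    congr 2
    rw [Matrix.mul_apply, ← sum_add_distrib]
    refine sum_congr rfl fun i _ => ?_
    rw [pd_mul b (h.smooth a i) (h.u_smooth i), h.u_pd]
    have : pd b (fun y => H y a i) x = mpd i H x b a := by
      have : pd b (fun y => H y a i) x = mpd b H x a i := rfl
      rw [this, h.mpd_symm, h.third]
    rw [this, h.symm x a i]
    ring
  have hsym : ∀ M : Matrix (Fin n) (Fin n) ℝ, ∑ a, ∑ b, gInv H x a b * M b a =
      (gInv H x * M).trace := fun M => by simp [Matrix.trace, Matrix.mul_apply]
  have h1 : gLap H (radius u) x = 2 * ∑ a, ∑ b, gInv H x a b * (1 + H x * H x) b a +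
      2 * ∑ i, u x i * ∑ a, ∑ b, gInv H x a b * mpd i H x b a := by
    rw [gLap]
    simp only [e, Matrix.add_apply, mul_sum]
    rw [sum_comm (s := univ) (t := univ) (γ := Fin n) (f := fun i a => ∑ b, _),
      ← sum_add_distrib]
    refine sum_congr rfl fun a _ => ?_
    rw [sum_comm (s := univ) (t := univ) (γ := Fin n) (f := fun i b => _),
      ← sum_add_distrib]
    refine sum_congr rfl fun b _ => ?_
    simp only [mul_add, mul_sum]
    rw [← add_assoc]
    congr 1
    · ring
    · exact sum_congr rfl fun i _ => by ring
  rw [h1, hsym, h.gInv_mul]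
  simp only [hsym, h.pde]
  simp

lemma gInv_pd_radius (h : IsSLGraph H W u) (x : Fin n → ℝ) :
    ∑ a, ∑ b, gInv H x a b * (pd a (radius u) x * pd b (radius u) x) =
      4 * (radius u x - coneDefect H u x) := by
  have e1 : ∀ v : Fin n → ℝ, ∑ a, ∑ b, gInv H x a b * (v a * v b) =
      v ⬝ᵥ (gInv H x).mulVec v := fun v => by
    simp only [dotProduct, Matrix.mulVec, mul_sum]
    exact sum_congr rfl fun a _ => sum_congr rfl fun b _ => by ring
  have e2 : radius u x = x ⬝ᵥ x + u x ⬝ᵥ u x := by simp [radius, dotProduct, sq, sum_add_distrib]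
  have e3 : ∑ a, ∑ b, gInv H x a b * (pd a (radius u) x * pd b (radius u) x) =
      4 * ∑ a, ∑ b, gInv H x a b * ((x + (H x).mulVec (u x)) a * (x + (H x).mulVec (u x)) b) := by
    simp only [h.pd_radius, mul_sum]
    exact sum_congr rfl fun a _ => sum_congr rfl fun b _ => by ring
  have tr : ∀ v w : Fin n → ℝ, (H x).mulVec v ⬝ᵥ w = v ⬝ᵥ (H x).mulVec w := fun v w => by
    rw [Matrix.dotProduct_mulVec, ← Matrix.mulVec_transpose, h.transpose_eq]
  have trG : ∀ v w : Fin n → ℝ, v ⬝ᵥ (gInv H x).mulVec w = w ⬝ᵥ (gInv H x).mulVec v := fun v w => by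
    rw [Matrix.dotProduct_mulVec, ← Matrix.mulVec_transpose, h.gInv_transpose, dotProduct_comm]
  have hk : ∀ v w : Fin n → ℝ, (H x).mulVec v ⬝ᵥ (gInv H x).mulVec ((H x).mulVec w) =
      v ⬝ᵥ w - v ⬝ᵥ (gInv H x).mulVec w := fun v w => by
    rw [tr, Matrix.mulVec_mulVec, Matrix.mulVec_mulVec, h.mul_gInv_mul, Matrix.sub_mulVec,
      Matrix.one_mulVec, dotProduct_sub]
  have hc : ∀ v w : Fin n → ℝ, v ⬝ᵥ (gInv H x).mulVec ((H x).mulVec w) =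
      w ⬝ᵥ (gInv H x).mulVec ((H x).mulVec v) := fun v w => by
    rw [trG, tr, Matrix.mulVec_mulVec, Matrix.mulVec_mulVec, h.gInv_comm]
  rw [e3, coneDefect, e1, e1, e2]
  simp only [Matrix.mulVec_add, Matrix.mulVec_sub, add_dotProduct, sub_dotProduct, dotProduct_add,
    dotProduct_sub, hk]
  rw [trG ((H x).mulVec (u x)) x, trG ((H x).mulVec x) (u x), hc (u x) x]
  ring

lemma coneDefect_nonneg (h : IsSLGraph H W u) (x : Fin n → ℝ) : 0 ≤ coneDefect H u x := by
  rw [coneDefect, h.gInv_quadForm]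
  positivity

lemma eq_of_coneDefect_eq_zero (h : IsSLGraph H W u) {x : Fin n → ℝ}
    (hx : coneDefect H u x = 0) : u x = (H x).mulVec x := by
  rw [coneDefect, h.gInv_quadForm] at hx
  have h1 : ∑ i, (gInv H x).mulVec (u x - (H x).mulVec x) i ^ 2 = 0 :=
    le_antisymm (by
      have : 0 ≤ ∑ i, (H x).mulVec ((gInv H x).mulVec (u x - (H x).mulVec x)) i ^ 2 := by positivity
      linarith) (by positivity)
  have h2 : (gInv H x).mulVec (u x - (H x).mulVec x) = 0 := by
    ext i
    exact pow_eq_zero_iff two_ne_zero |>.1 ((sum_eq_zero_iff_of_nonneg fun i _ => sq_nonneg _).1 h1 i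
      (mem_univ i))
  have h3 := congrArg (1 + H x * H x).mulVec h2
  rw [Matrix.mulVec_mulVec, h.mul_gInv, Matrix.one_mulVec, Matrix.mulVec_zero] at h3
  exact sub_eq_zero.1 h3

end IsSLGraph

end Graph

end FirstVariation

section Monotonicity

open Finset
open scoped ContDiff

section ConeMass

open MeasureTheory

variable {n : ℕ} {H : (Fin n → ℝ) → Matrix (Fin n) (Fin n) ℝ} {W : (Fin n → ℝ) → ℝ}
  {u : (Fin n → ℝ) → Fin n → ℝ}

/-- The scale invariant weighted mass of the graph at scale `σ⁻¹`. -/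
noncomputable def coneMass (W : (Fin n → ℝ) → ℝ) (u : (Fin n → ℝ) → Fin n → ℝ)
    (f : (Fin n → ℝ) → ℝ) (σ : ℝ) : ℝ :=
  σ ^ n * ∫ x, cutoff (σ ^ 2 * radius u x) ^ 3 * (W x * f x)

namespace IsSLGraph

lemma integrable_cutoff_mul (h : IsSLGraph H W u) {τ : ℝ} (hτ : 0 < τ) (m : ℕ)
    {g : (Fin n → ℝ) → ℝ} (hg : Continuous g) :
    Integrable fun x => cutoff (τ * radius u x) ^ (m + 1) * g x := by
  have hr := h.smooth_radius.continuous
  refine Continuous.integrable_of_hasCompactSupport (by fun_prop) ?_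
  exact hasCompactSupport_of_cutoff (norm_sq_le_radius u) hτ fun x hx => by
    rw [cutoff_of_one_le hx]; simp

lemma _root_.IsSLHessian.contDiff_gLap (hH : IsSLHessian H W) {f : (Fin n → ℝ) → ℝ} (hf : ContDiff ℝ ∞ f) :
    ContDiff ℝ ∞ (gLap H f) :=
  ContDiff.sum fun a _ => ContDiff.sum fun b _ => (hH.smooth_gInv a b).mul ((hf.pd a).pd b)

lemma contDiff_coneDefect (h : IsSLGraph H W u) : ContDiff ℝ ∞ (coneDefect H u) := by
  have hs : ∀ i, ContDiff ℝ ∞ fun y => (u y - (H y).mulVec y) i := fun i =>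
    (h.u_smooth i).sub (g := fun y => ∑ j, H y i j * y j)
      (ContDiff.sum fun j _ => (h.smooth i j).mul (contDiff_coord j))
  exact ContDiff.sum fun a _ => ContDiff.sum fun b _ =>
    (h.smooth_gInv a b).mul ((hs a).mul (hs b))

lemma integral_cutoff_gLap (h : IsSLGraph H W u) {f : (Fin n → ℝ) → ℝ} (hf : ContDiff ℝ ∞ f)
    {τ : ℝ} (hτ : 0 < τ) :
    ∫ x, cutoff (τ * radius u x) ^ 4 * (W x * gLap H f x) =
      8 * τ * (6 * τ * (∫ x, cutoff (τ * radius u x) ^ 2 * (W x * f x * radius u x)) -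
        6 * τ * (∫ x, cutoff (τ * radius u x) ^ 2 * (W x * f x * coneDefect H u x)) -
        n * ∫ x, cutoff (τ * radius u x) ^ 3 * (W x * f x)) := by
  have hr := h.smooth_radius
  have hd := h.contDiff_coneDefect
  have hW := h.W_smooth
  set grad : (Fin n → ℝ) → ℝ := fun x =>
    ∑ i, pd i (radius u) x * ∑ a, W x * gInv H x a i * pd a f x with hgrad
  have hgs : ContDiff ℝ ∞ grad :=
    ContDiff.sum fun i _ => (hr.pd i).mul (h.contDiff_weightedGrad hf i)
  have e1 := integral_cutoff_mul_div (norm_sq_le_radius u) hr hτ 2 (h.contDiff_weightedGrad hf)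
  simp only [h.sum_pd_weightedGrad hf] at e1
  have e2 := integral_cutoff_mul_div (norm_sq_le_radius u) hr hτ 1
    (X := fun i y => f y * ∑ a, W y * gInv H y a i * pd a (radius u) y)
    fun i => hf.mul (h.contDiff_weightedGrad hr i)
  have e3 : ∀ x, ∑ i, pd i (fun y => f y * ∑ a, W y * gInv H y a i * pd a (radius u) y) x =
      grad x + 2 * n * (W x * f x) := fun x => by
    simp only [pd_mul _ hf (h.contDiff_weightedGrad hr _), sum_add_distrib, ← mul_sum,
      h.sum_pd_weightedGrad hr, h.gLap_radius]
    rw [hgrad]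
    simp only [mul_sum]
    rw [sum_comm]
    congr 1
    · exact sum_congr rfl fun a _ => sum_congr rfl fun b _ => by rw [h.gInv_symm]; ring
    · ring
  have e4 : ∀ x, ∑ i, pd i (radius u) x * (f x * ∑ a, W x * gInv H x a i * pd a (radius u) x) =
      4 * (W x * f x * radius u x - W x * f x * coneDefect H u x) := fun x => by
    rw [← mul_sub, mul_left_comm, ← h.gInv_pd_radius, sum_comm, mul_sum]
    refine sum_congr rfl fun i _ => ?_
    simp only [mul_sum]
    exact sum_congr rfl fun a _ => by ring
  simp only [e3, e4] at e2
  have i1 := h.integrable_cutoff_mul hτ 2 hgs.continuous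
  have i2 := h.integrable_cutoff_mul hτ 2 (hW.mul hf).continuous
  have i3 := h.integrable_cutoff_mul hτ 1 ((hW.mul hf).mul hr).continuous
  have i4 := h.integrable_cutoff_mul hτ 1 ((hW.mul hf).mul hd).continuous
  have e5 : ∫ x, cutoff (τ * radius u x) ^ (1 + 2) * (grad x + 2 * n * (W x * f x)) =
      (∫ x, cutoff (τ * radius u x) ^ 3 * grad x) +
        2 * n * ∫ x, cutoff (τ * radius u x) ^ 3 * (W x * f x) := by
    rw [← integral_const_mul, ← integral_add i1 (i2.const_mul _)]
    exact integral_congr_ae (.of_forall fun x => by ring)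
  have e6 : ∫ x, cutoff (τ * radius u x) ^ (1 + 1) *
        (4 * (W x * f x * radius u x - W x * f x * coneDefect H u x)) =
      4 * ((∫ x, cutoff (τ * radius u x) ^ 2 * (W x * f x * radius u x)) -
        ∫ x, cutoff (τ * radius u x) ^ 2 * (W x * f x * coneDefect H u x)) := by
    rw [← integral_sub i3 i4, ← integral_const_mul]
    exact integral_congr_ae (.of_forall fun x => by ring)
  rw [e5, e6] at e2
  push_cast at e1 e2
  have e1' : ∫ x, cutoff (τ * radius u x) ^ 4 * (W x * gLap H f x) =
      (2 + 2) * τ * ∫ x, cutoff (τ * radius u x) ^ 3 * grad x := e1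
  rw [e1']
  linear_combination (4 * τ) * e2

lemma hasDerivAt_coneMass (h : IsSLGraph H W u) {f : (Fin n → ℝ) → ℝ} (hf : ContDiff ℝ ∞ f)
    {σ : ℝ} (hσ : 0 < σ) :
    HasDerivAt (coneMass W u f) (-(σ⁻¹ * σ ^ n * ((8 * σ ^ 2)⁻¹ *
      (∫ x, cutoff (σ ^ 2 * radius u x) ^ 4 * (W x * gLap H f x)) + 6 * σ ^ 2 *
        ∫ x, cutoff (σ ^ 2 * radius u x) ^ 2 * (W x * f x * coneDefect H u x)))) σ := by
  have hr := h.smooth_radius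
  have hW := h.W_smooth
  have hrc := hr.continuous
  have hWf : Continuous fun x => W x * f x := (hW.mul hf).continuous
  have hd : HasDerivAt (fun t => ∫ x, cutoff (t ^ 2 * radius u x) ^ 3 * (W x * f x))
      (∫ x, cutoff (σ ^ 2 * radius u x) ^ 2 * (-6 * σ * (W x * f x * radius u x))) σ := by
    refine (hasDerivAt_integral_of_dominated_loc_of_deriv_le (𝕜 := ℝ)
      (F := fun t x => cutoff (t ^ 2 * radius u x) ^ 3 * (W x * f x))
      (F' := fun t x => cutoff (t ^ 2 * radius u x) ^ 2 * (-6 * t * (W x * f x * radius u x)))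
      (s := Set.Ioo (σ / 2) (2 * σ))
      (bound := fun x => cutoff ((σ / 2) ^ 2 * radius u x) ^ 2 *
        (12 * σ * (|W x * f x| * radius u x))) (Ioo_mem_nhds (by linarith) (by linarith))
      ?_ ?_ ?_ ?_ ?_ ?_).2
    · exact .of_forall fun t => Continuous.aestronglyMeasurable (by fun_prop)
    · exact h.integrable_cutoff_mul (by positivity) 2 hWf
    · exact Continuous.aestronglyMeasurable (by fun_prop)
    · refine .of_forall fun x t ht => ?_
      have hr0 := radius_nonneg u x
      have ht0 : 0 < t := by linarith [ht.1]
      rw [Real.norm_eq_abs, abs_mul, abs_of_nonneg (sq_nonneg (cutoff _)), abs_mul (-6 * t), abs_mul _ (radius u x),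
        abs_of_nonneg hr0, abs_of_neg (by linarith : -6 * t < 0)]
      have h1 : (σ / 2) ^ 2 ≤ t ^ 2 := pow_le_pow_left₀ (by positivity) ht.1.le 2
      have h2 : cutoff (t ^ 2 * radius u x) ≤ cutoff ((σ / 2) ^ 2 * radius u x) :=
        cutoff_antitone (mul_le_mul_of_nonneg_right h1 hr0)
      have h3 : -(-6 * t) ≤ 12 * σ := by linarith [ht.2]
      have := cutoff_nonneg (t ^ 2 * radius u x)
      gcongr
      exact mul_nonneg (by linarith) (by positivity)
    · exact h.integrable_cutoff_mul (by positivity) 1 (by fun_prop)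
    · refine .of_forall fun x t _ => ?_
      have h1 : HasDerivAt (fun t : ℝ => t ^ 2 * radius u x) (2 * t * radius u x) t := by
        simpa using (hasDerivAt_pow 2 t).mul_const (radius u x)
      have h2 := ((hasDerivAt_cutoff_pow 1 (t ^ 2 * radius u x)).comp t h1).mul_const (W x * f x)
      refine h2.congr_deriv ?_
      norm_num
      ring
  have h2 := (hasDerivAt_pow n σ).mul hd
  refine h2.congr_deriv ?_
  have e : ∫ x, cutoff (σ ^ 2 * radius u x) ^ 2 * (-6 * σ * (W x * f x * radius u x)) =
      -6 * σ * ∫ x, cutoff (σ ^ 2 * radius u x) ^ 2 * (W x * f x * radius u x) := by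
    rw [← integral_const_mul]
    exact integral_congr_ae (.of_forall fun x => by ring)
  rw [e, h.integral_cutoff_gLap hf (by positivity)]
  have hn : (n : ℝ) * σ ^ (n - 1) = n * σ ^ n * σ⁻¹ := by
    rcases n with _ | n
    · simp
    · field_simp; simp [pow_succ]
  rw [hn]
  field_simp
  ring

end IsSLGraph

end ConeMass

end Monotonicity

section EnergyEstimate

open Finset
open scoped ContDiff

section Energy

open MeasureTheory

variable {n : ℕ} {H : (Fin n → ℝ) → Matrix (Fin n) (Fin n) ℝ} {W : (Fin n → ℝ) → ℝ}
  {u : (Fin n → ℝ) → Fin n → ℝ} {L B : ℝ}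

/-- A special Lagrangian graph with bounded Hessian whose curvature form is nonnegative. -/
structure IsControlledGraph (H : (Fin n → ℝ) → Matrix (Fin n) (Fin n) ℝ) (W : (Fin n → ℝ) → ℝ)
    (u : (Fin n → ℝ) → Fin n → ℝ) (L B : ℝ) : Prop extends IsSLGraph H W u where
  L_nonneg : 0 ≤ L
  one_le_W : ∀ x, 1 ≤ W x
  W_le : ∀ x, W x ≤ B
  W_eq : ∀ x, W x = √(1 + H x * H x).det
  frame : ∀ x, ∃ U lam, IsEigenFrame H x U lam ∧ (∀ i, lam i ^ 2 ≤ L) ∧ CurvNonneg lam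

/-- A bounded function cannot have logarithmically divergent slope at the origin. -/
lemma exists_lt_mul_deriv_of_bounded {Z Z' : ℝ → ℝ} {M a s₀ : ℝ} (ha : 0 < a) (hs₀ : 0 < s₀)
    (hZ : ∀ s, 0 < s → HasDerivAt Z (Z' s) s) (hM : ∀ s, 0 < s → |Z s| ≤ M) :
    ∃ s, 0 < s ∧ s < s₀ ∧ -a < s * Z' s := by
  by_contra! hcon
  have hd : ∀ s ∈ Set.Ioo 0 s₀, HasDerivAt (fun t => Z t + a * Real.log t) (Z' s + a * s⁻¹) s :=
    fun s hs => (hZ s hs.1).add ((Real.hasDerivAt_log hs.1.ne').const_mul a)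
  have hanti : AntitoneOn (fun t => Z t + a * Real.log t) (Set.Ioo 0 s₀) := by
    refine antitoneOn_of_deriv_nonpos (convex_Ioo _ _)
      (fun s hs => (hd s hs).continuousAt.continuousWithinAt) ?_ ?_
    · rw [interior_Ioo]
      exact fun s hs => (hd s hs).differentiableAt.differentiableWithinAt
    · rw [interior_Ioo]
      intro s hs
      rw [(hd s hs).deriv]
      have h := hcon s hs.1 hs.2
      have hs1 := hs.1
      have : Z' s + a * s⁻¹ = s⁻¹ * (s * Z' s + a) := by field_simp
      rw [this]
      exact mul_nonpos_of_nonneg_of_nonpos (by positivity) (by linarith)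
  have hM0 : 0 ≤ M := (abs_nonneg _).trans (hM s₀ hs₀)
  set N := (2 * M + 1) / a with hN
  have hN0 : 0 ≤ N := by positivity
  have h1 : s₀ / 2 ∈ Set.Ioo 0 s₀ := ⟨by linarith, by linarith⟩
  have h3 : s₀ / 2 * Real.exp (-N) ≤ s₀ / 2 :=
    mul_le_of_le_one_right h1.1.le (Real.exp_le_one_iff.2 (by linarith))
  have h2 : s₀ / 2 * Real.exp (-N) ∈ Set.Ioo 0 s₀ :=
    ⟨mul_pos h1.1 (Real.exp_pos _), h3.trans_lt h1.2⟩
  have h4 := hanti h2 h1 h3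
  simp only at h4
  rw [Real.log_mul h1.1.ne' (Real.exp_pos _).ne', Real.log_exp] at h4
  have h5 := abs_le.1 (hM _ h1.1)
  have h6 := abs_le.1 (hM _ h2.1)
  have h7 : a * N = 2 * M + 1 := by rw [hN]; field_simp
  nlinarith

lemma abs_scaled_integral_le {r : (Fin n → ℝ) → ℝ} (hr : ∀ x, ‖x‖ ^ 2 ≤ r x) {σ : ℝ} (hσ : 0 < σ)
    (m : ℕ) {g : (Fin n → ℝ) → ℝ} {M : ℝ} (hg : ∀ x, |g x| ≤ M) :
    |σ ^ n * ∫ x, cutoff (σ ^ 2 * r x) ^ (m + 1) * g x| ≤ 2 ^ n * M := by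
  have hM : 0 ≤ M := (abs_nonneg _).trans (hg 0)
  have hr0 : ∀ x, 0 ≤ σ ^ 2 * r x := fun x =>
    mul_nonneg (sq_nonneg _) ((sq_nonneg _).trans (hr x))
  have h1 : ∫ x, cutoff (σ ^ 2 * r x) ^ (m + 1) * g x =
      ∫ x in Metric.closedBall 0 σ⁻¹, cutoff (σ ^ 2 * r x) ^ (m + 1) * g x := by
    refine (setIntegral_eq_integral_of_forall_compl_eq_zero fun x hx => ?_).symm
    rw [mem_closedBall_zero_iff, not_le] at hx
    have : 1 ≤ σ ^ 2 * r x := by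
      calc 1 = σ ^ 2 * σ⁻¹ ^ 2 := by field_simp
        _ ≤ σ ^ 2 * ‖x‖ ^ 2 := by gcongr
        _ ≤ _ := by gcongr; exact hr x
    rw [cutoff_of_one_le this]
    simp
  have hvol : volume.real (Metric.closedBall (0 : Fin n → ℝ) σ⁻¹) = (2 * σ⁻¹) ^ n := by
    rw [Measure.real, Real.volume_pi_closedBall _ (by positivity), Fintype.card_fin,
      ENNReal.toReal_ofReal (by positivity)]
  have h2 : ‖∫ x in Metric.closedBall 0 σ⁻¹, cutoff (σ ^ 2 * r x) ^ (m + 1) * g x‖ ≤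
      M * volume.real (Metric.closedBall (0 : Fin n → ℝ) σ⁻¹) := by
    refine norm_setIntegral_le_of_norm_le_const
      (isCompact_closedBall _ _).measure_lt_top fun x _ => ?_
    rw [norm_mul, Real.norm_eq_abs, Real.norm_eq_abs,
      abs_of_nonneg (pow_nonneg (cutoff_nonneg _) _)]
    calc _ ≤ 1 * M := mul_le_mul (pow_le_one₀ (cutoff_nonneg _) (cutoff_le_one (hr0 x))) (hg x)
          (abs_nonneg _) one_pos.le
      _ = M := one_mul M
  rw [abs_mul, abs_of_pos (pow_pos hσ n), h1]
  calc _ ≤ σ ^ n * (M * (2 * σ⁻¹) ^ n) := by rw [← hvol]; gcongr; exact h2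
    _ = (σ * (2 * σ⁻¹)) ^ n * M := by rw [mul_pow σ]; ring
    _ = 2 ^ n * M := by rw [mul_left_comm, mul_inv_cancel₀ hσ.ne', mul_one]

namespace IsControlledGraph

lemma abs_coneMass_le (h : IsControlledGraph H W u L B) {f : (Fin n → ℝ) → ℝ} {M : ℝ}
    (hf : ∀ x, |f x| ≤ M) {σ : ℝ} (hσ : 0 < σ) : |coneMass W u f σ| ≤ 2 ^ n * (B * M) := by
  refine abs_scaled_integral_le (norm_sq_le_radius u) hσ 2 fun x => ?_
  rw [abs_mul, abs_of_pos (h.W_pos x)]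
  exact mul_le_mul (h.W_le x) (hf x) (abs_nonneg _) ((h.W_pos x).le.trans (h.W_le x))

lemma trace_gInv_mem (h : IsControlledGraph H W u L B) (x : Fin n → ℝ) :
    0 ≤ (gInv H x).trace ∧ (gInv H x).trace ≤ n := by
  obtain ⟨U, lam, hU, -, -⟩ := h.frame x
  rw [hU.gInv_eq, inFrame_trace hU.left]
  refine ⟨sum_nonneg fun i _ => by positivity, ?_⟩
  calc ∑ i, (1 + lam i ^ 2)⁻¹ ≤ ∑ _i : Fin n, (1 : ℝ) :=
        sum_le_sum fun i _ => inv_le_one_of_one_le₀ (by nlinarith [sq_nonneg (lam i)])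
    _ = n := by simp

lemma potential_mem (h : IsControlledGraph H W u L B) {C : ℝ} (hC : 0 ≤ C) (x : Fin n → ℝ) :
    0 ≤ potential C H W x ∧
      potential C H W x ≤ 2⁻¹ * n + C * (Real.log B + 2⁻¹ * Real.log B ^ 2) := by
  obtain ⟨h1, h2⟩ := h.trace_gInv_mem x
  have h3 := Real.log_nonneg (h.one_le_W x)
  have h4 := Real.log_le_log (h.W_pos x) (h.W_le x)
  unfold potential
  constructor
  · positivity
  · gcongr

lemma sum_sq_pd_radius_le (h : IsControlledGraph H W u L B) (x : Fin n → ℝ) :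
    ∑ i, pd i (radius u) x ^ 2 ≤ 4 * (1 + L) * radius u x := by
  obtain ⟨U, lam, hU, hlam, -⟩ := h.frame x
  have h1 := h.gInv_pd_radius x
  have h2 := sum_inFrame_mul_mul U (fun _ => 1) (fun a => pd a (radius u) x)
    fun a => pd a (radius u) x
  have h3 : ∑ i, pd i (radius u) x ^ 2 = ∑ c, (∑ a, U a c * pd a (radius u) x) ^ 2 := by
    rw [inFrame_one hU.right] at h2
    simpa [Matrix.one_apply, sq] using h2
  rw [hU.gInv_eq, sum_inFrame_mul_mul] at h1
  have hL := h.L_nonneg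
  rw [h3]
  calc _ ≤ ∑ c, (1 + L) * ((1 + lam c ^ 2)⁻¹ * ((∑ a, U a c * pd a (radius u) x) *
        ∑ a, U a c * pd a (radius u) x)) := sum_le_sum fun c _ => by
        have h5 : 1 ≤ (1 + L) * (1 + lam c ^ 2)⁻¹ := by
          rw [← div_eq_mul_inv, one_le_div (by positivity)]
          linarith [hlam c]
        rw [← mul_assoc, ← sq]
        exact le_mul_of_one_le_left (sq_nonneg _) h5
    _ = (1 + L) * (4 * (radius u x - coneDefect H u x)) := by rw [← mul_sum, h1]
    _ ≤ _ := by nlinarith [h.coneDefect_nonneg x]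

/-- The third derivatives have small scale invariant energy at arbitrarily large scales. -/
theorem exists_small_energy (h : IsControlledGraph H W u L B) {δ σ₀ : ℝ} (hδ : 0 < δ)
    (hσ₀ : 0 < σ₀) : ∃ σ, 0 < σ ∧ σ < σ₀ ∧ σ ^ n * ∫ x, cutoff (σ ^ 2 * radius u x) ^ 4 *
      (W x * ∑ k, ∑ i, ∑ j, mpd k H x i j ^ 2) < δ * σ ^ 2 := by
  have hL := h.L_nonneg
  have hB : 0 < B := one_pos.trans_le ((h.one_le_W 0).trans (h.W_le 0))
  obtain ⟨c, hc, hκ⟩ := exists_potential_bound n hL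
  set κ := 2 * (16 * (1 + L) * (2 ^ n * B)) / (c * δ) with hκdef
  have hκ0 : 0 < κ := by positivity
  obtain ⟨ν, C, hC, hpot⟩ := hκ κ hκ0.le
  set f := potential C H W with hfdef
  have hf : ContDiff ℝ ∞ f := h.smooth_potential C
  set Y : Fin n → (Fin n → ℝ) → ℝ := fun i y => traceWeight ν H y * slopeVec H i y with hY
  have hYs : ∀ i, ContDiff ℝ ∞ (Y i) := fun i =>
    (h.smooth_traceWeight ν).mul (h.smooth_slopeVec i)
  set P : (Fin n → ℝ) → ℝ := fun x => ∑ k, ∑ i, ∑ j, mpd k H x i j ^ 2 with hP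
  have hpt : ∀ x, c * P x ≤ gLap H f x + (W x)⁻¹ * (∑ i, pd i (fun y => W y * Y i y) x) -
      κ * ∑ i, Y i x ^ 2 := hpot H W h.toIsSLHessian h.one_le_W h.frame
  have hPs : ContDiff ℝ ∞ P := ContDiff.sum fun k _ => ContDiff.sum fun i _ =>
    ContDiff.sum fun j _ => (h.smooth.mpd k i j).pow 2
  have hfM : ∀ x, |f x| ≤ 2⁻¹ * n + C * (Real.log B + 2⁻¹ * Real.log B ^ 2) := fun x => by
    have := h.potential_mem hC x
    rw [abs_of_nonneg this.1]
    exact this.2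
  have hr := h.smooth_radius
  have hW := h.W_smooth
  obtain ⟨σ, hσ, hσ1, hσ2⟩ := exists_lt_mul_deriv_of_bounded (a := c * δ / 16) (by positivity) hσ₀
    (fun s hs => h.hasDerivAt_coneMass hf hs) fun s hs => h.abs_coneMass_le hfM hs
  refine ⟨σ, hσ, hσ1, ?_⟩
  set τ := σ ^ 2 with hτ
  have hτ0 : 0 < τ := by positivity
  have key : c * ∫ x, cutoff (τ * radius u x) ^ 4 * (W x * P x) ≤
      (∫ x, cutoff (τ * radius u x) ^ 4 * (W x * gLap H f x)) +
        16 * (1 + L) / κ * τ * ∫ x, cutoff (τ * radius u x) ^ 2 * W x := by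
    have hX : ∀ i, ContDiff ℝ ∞ fun y => W y * Y i y := fun i => hW.mul (hYs i)
    have e1 := integral_cutoff_mul_div (norm_sq_le_radius u) hr hτ0 2 hX
    push_cast at e1
    have hdiv : ContDiff ℝ ∞ fun x => ∑ i, pd i (fun y => W y * Y i y) x :=
      ContDiff.sum fun i _ => (hX i).pd i
    have hrX : ContDiff ℝ ∞ fun x => ∑ i, pd i (radius u) x * (W x * Y i x) :=
      ContDiff.sum fun i _ => (hr.pd i).mul (hX i)
    have i1 := h.integrable_cutoff_mul hτ0 3 (hW.mul hPs).continuous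
    have i2 := h.integrable_cutoff_mul hτ0 3 (hW.mul (h.contDiff_gLap hf)).continuous
    have i3 := h.integrable_cutoff_mul hτ0 3 hdiv.continuous
    have i4 := h.integrable_cutoff_mul hτ0 2 hrX.continuous
    have i5 := h.integrable_cutoff_mul hτ0 1 hW.continuous
    have i6 : Integrable fun x => cutoff (τ * radius u x) ^ 4 * (W x * gLap H f x) +
        cutoff (τ * radius u x) ^ 4 * ∑ i, pd i (fun y => W y * Y i y) x := i2.add i3
    have hle : ∫ x, (c * (cutoff (τ * radius u x) ^ 4 * (W x * P x)) +
        4 * τ * (cutoff (τ * radius u x) ^ 3 * ∑ i, pd i (radius u) x * (W x * Y i x))) ≤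
      ∫ x, (cutoff (τ * radius u x) ^ 4 * (W x * gLap H f x) +
        cutoff (τ * radius u x) ^ 4 * (∑ i, pd i (fun y => W y * Y i y) x) +
        16 * (1 + L) / κ * τ * (cutoff (τ * radius u x) ^ 2 * W x)) := by
      refine integral_mono ((i1.const_mul c).add (i4.const_mul _))
        ((i2.add i3).add (i5.const_mul _)) fun x => ?_
      simp only
      set p := cutoff (τ * radius u x) with hp
      have hp0 : 0 ≤ p := cutoff_nonneg _
      have hWx := h.W_pos x
      have h1 : p ^ 4 * (W x * (c * P x)) ≤ p ^ 4 * (W x * gLap H f x) +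
          p ^ 4 * (∑ i, pd i (fun y => W y * Y i y) x) -
          κ * (p ^ 4 * W x) * ∑ i, Y i x ^ 2 := by
        have h2 := mul_le_mul_of_nonneg_left (hpt x) (by positivity : 0 ≤ p ^ 4 * W x)
        rw [← mul_assoc]
        refine h2.trans_eq ?_
        linear_combination (p ^ 4 * ∑ i, pd i (fun y => W y * Y i y) x) *
          mul_inv_cancel₀ hWx.ne'
      have h3 : 4 * τ * (p ^ 3 * ∑ i, pd i (radius u) x * (W x * Y i x)) ≤
          κ * (p ^ 4 * W x) * (∑ i, Y i x ^ 2) +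
            4 / κ * τ ^ 2 * p ^ 2 * W x * ∑ i, pd i (radius u) x ^ 2 := by
        simp only [mul_sum]
        rw [← sum_add_distrib]
        refine sum_le_sum fun i _ => ?_
        have h4 : κ * (p ^ 4 * W x) * Y i x ^ 2 +
            4 / κ * τ ^ 2 * p ^ 2 * W x * pd i (radius u) x ^ 2 -
            4 * τ * (p ^ 3 * (pd i (radius u) x * (W x * Y i x))) =
            W x / κ * (κ * p ^ 2 * Y i x - 2 * τ * p * pd i (radius u) x) ^ 2 := by
          field_simp; ring
        have : 0 ≤ W x / κ * (κ * p ^ 2 * Y i x - 2 * τ * p * pd i (radius u) x) ^ 2 := by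
          positivity
        linarith
      have h5 : 4 / κ * τ ^ 2 * p ^ 2 * W x * ∑ i, pd i (radius u) x ^ 2 ≤
          16 * (1 + L) / κ * τ * (p ^ 2 * W x) := by
        have h6 : p ^ 2 * (τ * radius u x) ≤ p ^ 2 := by
          rcases le_total 1 (τ * radius u x) with hh | hh
          · rw [hp, cutoff_of_one_le hh]; simp
          · exact mul_le_of_le_one_right (sq_nonneg _) hh
        calc _ ≤ 4 / κ * τ ^ 2 * p ^ 2 * W x * (4 * (1 + L) * radius u x) := by
              gcongr; exact h.sum_sq_pd_radius_le x
          _ = 16 * (1 + L) / κ * τ * W x * (p ^ 2 * (τ * radius u x)) := by ring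
          _ ≤ 16 * (1 + L) / κ * τ * W x * p ^ 2 := by gcongr
          _ = _ := by ring
      linarith
    rw [integral_add (i1.const_mul c) (i4.const_mul _),
      integral_add i6 (i5.const_mul _), integral_add i2 i3, integral_const_mul,
      integral_const_mul, integral_const_mul] at hle
    have e2 : ∫ x, cutoff (τ * radius u x) ^ (3 + 1) * ∑ i, pd i (fun y => W y * Y i y) x =
      (2 + 2) * τ * ∫ x, cutoff (τ * radius u x) ^ (2 + 1) *
        ∑ i, pd i (radius u) x * (W x * Y i x) := e1
    norm_num at hle e2
    linarith
  have hpos : 0 ≤ ∫ x, cutoff (τ * radius u x) ^ 2 * (W x * f x * coneDefect H u x) :=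
    integral_nonneg fun x => mul_nonneg (sq_nonneg _) (mul_nonneg
      (mul_nonneg (h.W_pos x).le (h.potential_mem hC x).1) (h.coneDefect_nonneg x))
  have hvol : σ ^ n * ∫ x, cutoff (τ * radius u x) ^ 2 * W x ≤ 2 ^ n * B :=
    (le_abs_self _).trans (abs_scaled_integral_le (norm_sq_le_radius u) hσ 1 fun x => by
      rw [abs_of_pos (h.W_pos x)]; exact h.W_le x)
  have hσn : 0 < σ ^ n := by positivity
  have h1 : σ ^ n * (∫ x, cutoff (τ * radius u x) ^ 4 * (W x * gLap H f x)) <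
      8 * τ * (c * δ / 16) := by
    set I := ∫ x, cutoff (τ * radius u x) ^ 4 * (W x * gLap H f x)
    set J := ∫ x, cutoff (τ * radius u x) ^ 2 * (W x * f x * coneDefect H u x)
    have h3 : σ * -(σ⁻¹ * σ ^ n * ((8 * τ)⁻¹ * I + 6 * τ * J)) =
        -((8 * τ)⁻¹ * (σ ^ n * I) + 6 * τ * (σ ^ n * J)) := by field_simp
    rw [h3] at hσ2
    have h4 : 0 ≤ 6 * τ * (σ ^ n * J) := by positivity
    have h5 : (8 * τ)⁻¹ * (σ ^ n * I) < c * δ / 16 := by linarith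
    rwa [inv_mul_lt_iff₀ (by positivity)] at h5
  have h2 : 16 * (1 + L) / κ * (2 ^ n * B) = c * δ / 2 := by
    rw [hκdef]; field_simp
  have h3 := mul_le_mul_of_nonneg_left key hσn.le
  have h4 : 16 * (1 + L) / κ * τ * (σ ^ n * ∫ x, cutoff (τ * radius u x) ^ 2 * W x) ≤
      16 * (1 + L) / κ * τ * (2 ^ n * B) := by gcongr
  have h5 : 16 * (1 + L) / κ * τ * (2 ^ n * B) = τ * (c * δ / 2) := by rw [← h2]; ring
  have h6 : c * (σ ^ n * ∫ x, cutoff (τ * radius u x) ^ 4 * (W x * P x)) < c * (δ * τ) := by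
    nlinarith
  exact lt_of_mul_lt_mul_left h6 hc.le

end IsControlledGraph

end Energy

end EnergyEstimate

section ConeModel

open Finset
open scoped ContDiff

section Model

open MeasureTheory

variable {n : ℕ}

/-- The area-density integrand of the graph with slope `M` through `(y, p)`, truncated to the
unit ball. -/
noncomputable def areaIntegrand (M : Matrix (Fin n) (Fin n) ℝ) (y p : Fin n → ℝ) : ℝ :=
  √(1 + M * M).det * cutoff (∑ i, (y i ^ 2 + p i ^ 2)) ^ 3

/-- The truncated mass of a flat `n`-plane. -/
noncomputable def flatMass (n : ℕ) : ℝ := ∫ y : Fin n → ℝ, cutoff (∑ i, y i ^ 2) ^ 3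

lemma continuous_areaIntegrand : Continuous fun q : (Fin n → Fin n → ℝ) × (Fin n → ℝ) × (Fin n → ℝ) =>
    areaIntegrand (Matrix.of q.1) q.2.1 q.2.2 := by
  have : Continuous fun q : (Fin n → Fin n → ℝ) × (Fin n → ℝ) × (Fin n → ℝ) =>
      (1 + Matrix.of q.1 * Matrix.of q.1 : Matrix (Fin n) (Fin n) ℝ) :=
    continuous_const.add (Continuous.matrix_mul continuous_fst continuous_fst)
  have := this.matrix_det
  unfold areaIntegrand
  fun_prop

lemma areaIntegrand_eq_zero {M : Matrix (Fin n) (Fin n) ℝ} {y p : Fin n → ℝ}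
    (hy : y ∉ Metric.closedBall (0 : Fin n → ℝ) 1) : areaIntegrand M y p = 0 := by
  rw [mem_closedBall_zero_iff, not_le] at hy
  have h1 : ‖y‖ ^ 2 ≤ ∑ i, (y i ^ 2 + p i ^ 2) :=
    (norm_sq_le_sum_sq y).trans (sum_le_sum fun i _ => le_add_of_nonneg_right (sq_nonneg _))
  rw [areaIntegrand, cutoff_of_one_le (by nlinarith)]
  simp

lemma sqrt_det_one_add_sq {U : Matrix (Fin n) (Fin n) ℝ} {lam : Fin n → ℝ}
    (hU : U.transpose * U = 1) (hU' : U * U.transpose = 1) :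
    √(1 + inFrame U lam * inFrame U lam).det = ∏ i, √(1 + lam i ^ 2) := by
  rw [inFrame_mul hU, ← inFrame_one hU', inFrame_add, inFrame_det hU]
  rw [Real.sqrt_prod _ fun i _ => by nlinarith [mul_self_nonneg (lam i)]]
  exact prod_congr rfl fun i _ => by simp [sq]

lemma integrable_cutoff_of_norm_sq_le {r : (Fin n → ℝ) → ℝ} (hr : Continuous r)
    (h : ∀ x, ‖x‖ ^ 2 ≤ r x) : Integrable fun x => cutoff (r x) ^ 3 := by
  refine Continuous.integrable_of_hasCompactSupport (by fun_prop) ?_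
  refine hasCompactSupport_of_cutoff h one_pos fun x hx => ?_
  rw [one_mul] at hx
  rw [cutoff_of_one_le hx]; simp

lemma integral_comp_mulVec_add {M : Matrix (Fin n) (Fin n) ℝ} (hM : M.det ≠ 0) (c : Fin n → ℝ)
    {g : (Fin n → ℝ) → ℝ} (hg : Continuous g) :
    ∫ y, |M.det| * g (M.mulVec y + c) = ∫ z, g z := by
  have h1 := integral_map (μ := volume) (φ := Matrix.toLin' M)
    (LinearMap.continuous_of_finiteDimensional _).aemeasurable
    (f := fun z => g (z + c)) (by
      exact (hg.comp (continuous_id.add continuous_const)).aestronglyMeasurable)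
  rw [Real.map_matrix_volume_pi_eq_smul_volume_pi hM, integral_smul_measure,
    integral_add_right_eq_self, ENNReal.toReal_ofReal (abs_nonneg _)] at h1
  simp only [Matrix.toLin'_apply] at h1
  rw [integral_const_mul, ← h1, smul_eq_mul, abs_inv, mul_inv_cancel_left₀ (abs_ne_zero.2 hM)]

lemma integrable_comp_mulVec_add {M : Matrix (Fin n) (Fin n) ℝ} (hM : M.det ≠ 0) (c : Fin n → ℝ)
    {g : (Fin n → ℝ) → ℝ} (hg : Integrable g) : Integrable fun y => g (M.mulVec y + c) := by
  have h1 : Integrable (fun z => g (z + c)) (Measure.map (Matrix.toLin' M) volume) := by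
    rw [Real.map_matrix_volume_pi_eq_smul_volume_pi hM]
    exact (hg.comp_add_right c).smul_measure ENNReal.ofReal_ne_top
  exact h1.comp_measurable (LinearMap.continuous_of_finiteDimensional _).measurable

lemma sum_sq_transpose_mulVec {U : Matrix (Fin n) (Fin n) ℝ} (hU' : U * U.transpose = 1)
    (v : Fin n → ℝ) : ∑ i, (U.transpose.mulVec v i) ^ 2 = ∑ i, v i ^ 2 := by
  have h : U.transpose.mulVec v ⬝ᵥ U.transpose.mulVec v = v ⬝ᵥ v := by
    rw [Matrix.dotProduct_mulVec, Matrix.vecMul_transpose, Matrix.mulVec_mulVec, hU', Matrix.one_mulVec]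
  simpa [dotProduct, sq] using h

section Affine

variable {U : Matrix (Fin n) (Fin n) ℝ} {lam : Fin n → ℝ}

/-- The isometric parametrisation of the plane with slope `inFrame U lam`. -/
noncomputable def planeChart (U : Matrix (Fin n) (Fin n) ℝ) (lam : Fin n → ℝ) :
    Matrix (Fin n) (Fin n) ℝ := Matrix.diagonal (fun i => √(1 + lam i ^ 2)) * U.transpose

lemma abs_det_planeChart (hU : U.transpose * U = 1) :
    |(planeChart U lam).det| = ∏ i, √(1 + lam i ^ 2) := by
  have h1 : |U.det| = 1 := by
    have := congrArg Matrix.det hU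
    rw [Matrix.det_mul, Matrix.det_transpose, Matrix.det_one] at this
    rcases mul_self_eq_one_iff.1 this with h | h <;> simp [h]
  rw [planeChart, Matrix.det_mul, Matrix.det_diagonal, Matrix.det_transpose, abs_mul, h1, mul_one,
    abs_of_nonneg (prod_nonneg fun i _ => Real.sqrt_nonneg _)]

lemma sum_sq_planeChart_add (hU : U.transpose * U = 1) (hU' : U * U.transpose = 1) (y b : Fin n → ℝ) :
    ∑ i, (y i ^ 2 + ((inFrame U lam).mulVec y i + b i) ^ 2) =
      ∑ i, ((planeChart U lam).mulVec y i +
        lam i * (U.transpose.mulVec b i) / √(1 + lam i ^ 2)) ^ 2 +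
      ∑ i, (U.transpose.mulVec b i) ^ 2 / (1 + lam i ^ 2) := by
  have h1 : U.transpose.mulVec ((inFrame U lam).mulVec y + b) =
      (Matrix.diagonal lam).mulVec (U.transpose.mulVec y) + U.transpose.mulVec b := by
    rw [Matrix.mulVec_add, inFrame]
    simp only [Matrix.mulVec_mulVec, ← Matrix.mul_assoc]
    rw [hU, Matrix.one_mul]
  rw [sum_add_distrib, ← sum_sq_transpose_mulVec hU' y,
    show ∑ i, ((inFrame U lam).mulVec y i + b i) ^ 2 =
      ∑ i, (((inFrame U lam).mulVec y + b) i) ^ 2 from rfl,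
    ← sum_sq_transpose_mulVec hU' ((inFrame U lam).mulVec y + b), h1, ← sum_add_distrib,
    ← sum_add_distrib]
  refine sum_congr rfl fun i _ => ?_
  rw [planeChart, ← Matrix.mulVec_mulVec, Matrix.mulVec_diagonal, Pi.add_apply,
    Matrix.mulVec_diagonal]
  have h2 : 0 < √(1 + lam i ^ 2) := Real.sqrt_pos.2 (by positivity)
  have h3 : √(1 + lam i ^ 2) ^ 2 = 1 + lam i ^ 2 := Real.sq_sqrt (by positivity)
  generalize √(1 + lam i ^ 2) = s at h2 h3
  have h4 : 1 + lam i ^ 2 ≠ 0 := by positivity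
  generalize U.transpose.mulVec y i = η
  generalize U.transpose.mulVec b i = β
  have h5 : (s * η + lam i * β / s) ^ 2 =
      s ^ 2 * η ^ 2 + 2 * lam i * η * β + lam i ^ 2 * β ^ 2 / s ^ 2 := by
    field_simp
    ring
  rw [h5, h3]
  field_simp
  ring

lemma continuous_mulVec_apply (M : Matrix (Fin n) (Fin n) ℝ) (i : Fin n) :
    Continuous fun y : Fin n → ℝ => M.mulVec y i :=
  (continuous_apply i).comp (Continuous.matrix_mulVec continuous_const continuous_id)

lemma integral_areaIntegrand_affine_le (hU : U.transpose * U = 1) (hU' : U * U.transpose = 1)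
    (b : Fin n → ℝ) :
    ∫ y, areaIntegrand (inFrame U lam) y ((inFrame U lam).mulVec y + b) ≤ flatMass n := by
  have hd := abs_det_planeChart (lam := lam) hU
  have hpos : 0 < ∏ i, √(1 + lam i ^ 2) :=
    prod_pos fun i _ => Real.sqrt_pos.2 (by positivity)
  have hne : (planeChart U lam).det ≠ 0 := abs_pos.1 (hd ▸ hpos)
  set c : Fin n → ℝ := fun i => lam i * (U.transpose.mulVec b i) / √(1 + lam i ^ 2) with hc
  rw [flatMass, ← integral_comp_mulVec_add hne c
    (g := fun z => cutoff (∑ i, z i ^ 2) ^ 3) (by fun_prop), hd]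
  have hle : ∀ y, ∑ i, ((planeChart U lam).mulVec y + c) i ^ 2 ≤
      ∑ i, (y i ^ 2 + ((inFrame U lam).mulVec y + b) i ^ 2) := fun y => by
    have := sum_sq_planeChart_add (lam := lam) hU hU' y b
    simp only [Pi.add_apply, hc]
    rw [this]
    exact le_add_of_nonneg_right (sum_nonneg fun i _ => by positivity)
  have hcont := fun M : Matrix (Fin n) (Fin n) ℝ => continuous_mulVec_apply M
  refine integral_mono_of_nonneg (.of_forall fun y => ?_) ?_ (.of_forall fun y => ?_)
  · exact mul_nonneg (Real.sqrt_nonneg _) (pow_nonneg (cutoff_nonneg _) _)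
  · exact (integrable_comp_mulVec_add hne c
      (integrable_cutoff_of_norm_sq_le (by fun_prop) norm_sq_le_sum_sq)).const_mul _
  · simp only [areaIntegrand]
    rw [sqrt_det_one_add_sq hU hU']
    gcongr
    · exact cutoff_nonneg _
    · exact cutoff_antitone (hle y)

lemma integral_areaIntegrand_linear (hU : U.transpose * U = 1) (hU' : U * U.transpose = 1) :
    ∫ y, areaIntegrand (inFrame U lam) y ((inFrame U lam).mulVec y) = flatMass n := by
  have hd := abs_det_planeChart (lam := lam) hU
  have hpos : 0 < ∏ i, √(1 + lam i ^ 2) :=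
    prod_pos fun i _ => Real.sqrt_pos.2 (by positivity)
  have hne : (planeChart U lam).det ≠ 0 := abs_pos.1 (hd ▸ hpos)
  rw [flatMass, ← integral_comp_mulVec_add hne 0
    (g := fun z => cutoff (∑ i, z i ^ 2) ^ 3) (by fun_prop), hd]
  refine integral_congr_ae (.of_forall fun y => ?_)
  have := sum_sq_planeChart_add (lam := lam) hU hU' y 0
  simp only [areaIntegrand]
  rw [sqrt_det_one_add_sq hU hU']
  simp only [Matrix.mulVec_zero, Pi.zero_apply, add_zero, mul_zero, zero_div, ne_eq,
    OfNat.ofNat_ne_zero, not_false_eq_true, zero_pow, sum_const_zero] at this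
  rw [this, add_zero (Matrix.mulVec _ _)]

end Affine

end Model

section Rescale

open MeasureTheory

variable {n : ℕ} {H : (Fin n → ℝ) → Matrix (Fin n) (Fin n) ℝ} {W : (Fin n → ℝ) → ℝ}
  {u : (Fin n → ℝ) → Fin n → ℝ} {L B : ℝ}

lemma IsControlledGraph.coneMass_one_eq (h : IsControlledGraph H W u L B) {σ : ℝ} (hσ : 0 < σ) :
    coneMass W u (fun _ => 1) σ =
      ∫ y, areaIntegrand (H (σ⁻¹ • y)) y (σ • u (σ⁻¹ • y)) := by
  have h1 := Measure.integral_comp_smul (volume : Measure (Fin n → ℝ))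
    (fun x => cutoff (σ ^ 2 * radius u x) ^ 3 * (W x * 1)) σ⁻¹
  rw [Module.finrank_fin_fun, inv_pow, inv_inv, abs_of_pos (by positivity), smul_eq_mul] at h1
  rw [coneMass, ← h1]
  refine integral_congr_ae (.of_forall fun y => ?_)
  simp only [areaIntegrand, ← h.W_eq, mul_one, radius]
  rw [mul_comm, mul_sum]
  refine congrArg (fun s => W (σ⁻¹ • y) * cutoff s ^ 3) (sum_congr rfl fun i _ => ?_)
  simp only [Pi.smul_apply, smul_eq_mul]
  field_simp

lemma gLap_const (c : ℝ) (x : Fin n → ℝ) : gLap H (fun _ => c) x = 0 := by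
  have hp : ∀ a : Fin n, pd a (fun _ => c) = fun _ => 0 := fun a => funext fun y => pd_const a c y
  simp [gLap, hp]

lemma IsControlledGraph.antitoneOn_coneMass (h : IsControlledGraph H W u L B) :
    AntitoneOn (coneMass W u fun _ => 1) (Set.Ioi 0) := by
  have hd := fun (σ : ℝ) (hσ : σ ∈ Set.Ioi (0 : ℝ)) =>
    h.toIsSLGraph.hasDerivAt_coneMass (contDiff_const (c := (1 : ℝ))) hσ
  refine antitoneOn_of_deriv_nonpos (convex_Ioi 0)
    (fun s hs => (hd s hs).continuousAt.continuousWithinAt) ?_ ?_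
  · rw [interior_Ioi]
    exact fun s hs => (hd s hs).differentiableAt.differentiableWithinAt
  · rw [interior_Ioi]
    intro σ hσ
    have hσ' : 0 < σ := hσ
    rw [(hd σ hσ).deriv]
    simp only [gLap_const, mul_zero, integral_zero, zero_add, mul_one]
    have : 0 ≤ ∫ x, cutoff (σ ^ 2 * radius u x) ^ 2 * (W x * coneDefect H u x) :=
      integral_nonneg fun x => mul_nonneg (sq_nonneg _)
        (mul_nonneg (h.W_pos x).le (h.coneDefect_nonneg x))
    exact neg_nonpos.2 (by positivity)

end Rescale

end ConeModel

section BlowdownAnalysis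

open Finset
open scoped ContDiff

section Blowdown

open MeasureTheory Filter Topology

variable {n : ℕ} {H : (Fin n → ℝ) → Matrix (Fin n) (Fin n) ℝ} {W : (Fin n → ℝ) → ℝ}
  {u : (Fin n → ℝ) → Fin n → ℝ} {L B : ℝ}

lemma fderiv_apply_eq_sum_pd {f : (Fin n → ℝ) → ℝ} (x v : Fin n → ℝ) :
    fderiv ℝ f x v = ∑ k, v k * pd k f x := by
  have hv : v = ∑ k, v k • (Pi.single k 1 : Fin n → ℝ) := by
    ext j
    simp [Finset.sum_apply, Pi.single_apply]
  conv_lhs => rw [hv]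
  simp [map_sum, pd]

namespace IsSLGraph

lemma hasFDerivAt_coord (h : IsSLGraph H W u) (i : Fin n) (x : Fin n → ℝ) :
    HasFDerivAt (fun y => u y i) (fderiv ℝ (fun y => u y i) x) x :=
  ((h.u_smooth i).differentiable (by simp) x).hasFDerivAt

lemma fderiv_coord_apply (h : IsSLGraph H W u) (i : Fin n) (x v : Fin n → ℝ) :
    fderiv ℝ (fun y => u y i) x v = (H x).mulVec v i := by
  rw [fderiv_apply_eq_sum_pd, Matrix.mulVec, dotProduct]
  exact sum_congr rfl fun k _ => by rw [h.u_pd, h.symm, mul_comm]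

lemma hasDerivAt_ray (h : IsSLGraph H W u) (y : Fin n → ℝ) (t : ℝ) :
    HasDerivAt (fun s : ℝ => u (s • y)) ((H (t • y)).mulVec y) t := by
  rw [hasDerivAt_pi]
  intro i
  rw [← h.fderiv_coord_apply i]
  have h1 : HasDerivAt (fun s : ℝ => s • y) y t := by
    simpa using (hasDerivAt_id t).smul_const y
  exact (h.hasFDerivAt_coord i (t • y)).comp_hasDerivAt t h1

lemma continuous_u (h : IsSLGraph H W u) : Continuous u :=
  continuous_pi fun i => (h.u_smooth i).continuous

lemma continuous_H (h : IsSLGraph H W u) : Continuous H :=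
  continuous_pi fun i => continuous_pi fun j => (h.smooth i j).continuous

lemma tendsto_smul_u (h : IsSLGraph H W u) (y : Fin n → ℝ) :
    Tendsto (fun σ : ℝ => σ • u (σ⁻¹ • y)) atTop (𝓝 ((H 0).mulVec y)) := by
  have h1 := (h.hasDerivAt_ray y 0).tendsto_slope_zero_right
  simp only [zero_smul, zero_add, h.u_zero, sub_zero] at h1
  have := h1.comp tendsto_inv_atTop_nhdsGT_zero
  simpa [Function.comp_def] using this

/-- A graph on which the cone defect vanishes identically is a plane. -/
lemma eq_linear_of_coneDefect_eq_zero (h : IsSLGraph H W u) (h0 : ∀ x, coneDefect H u x = 0)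
    (x : Fin n → ℝ) : u x = (H 0).mulVec x := by
  have hconst : ∀ σ : ℝ, 0 < σ → HasDerivAt (fun s : ℝ => s • u (s⁻¹ • x)) 0 σ := fun σ hσ => by
    have h1 : HasDerivAt (fun s : ℝ => u (s⁻¹ • x))
        ((-(σ ^ 2)⁻¹) • (H (σ⁻¹ • x)).mulVec x) σ :=
      (h.hasDerivAt_ray x σ⁻¹).scomp σ (hasDerivAt_inv hσ.ne')
    refine ((hasDerivAt_id σ).smul h1).congr_deriv ?_
    rw [h.eq_of_coneDefect_eq_zero (h0 _), Matrix.mulVec_smul, smul_smul, one_smul, ← add_smul]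
    simp only [id]
    rw [show σ * -(σ ^ 2)⁻¹ + σ⁻¹ = 0 by field_simp; ring, zero_smul]
  have h2 : ∀ σ ∈ Set.Ioi (0 : ℝ), σ • u (σ⁻¹ • x) = u x := fun σ hσ => by
    have := (convex_Ioi (0 : ℝ)).is_const_of_fderivWithin_eq_zero (𝕜 := ℝ)
      (f := fun s : ℝ => s • u (s⁻¹ • x))
      (fun s hs => (hconst s hs).differentiableAt.differentiableWithinAt)
      (fun s hs => by
        rw [fderivWithin_of_isOpen isOpen_Ioi hs, (hconst s hs).hasFDerivAt.fderiv]
        ext; simp) hσ (Set.mem_Ioi.2 one_pos)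
    simpa using this
  refine tendsto_nhds_unique (tendsto_const_nhds.congr' ?_) (h.tendsto_smul_u x)
  filter_upwards [Ioi_mem_atTop 0] with σ hσ using (h2 σ hσ).symm

lemma eq_const_of_coneDefect_eq_zero (h : IsSLGraph H W u) (h0 : ∀ x, coneDefect H u x = 0)
    (x : Fin n → ℝ) : H x = H 0 := by
  have h1 : ∀ v, (H x).mulVec v = (H 0).mulVec v := fun v => by
    have h2 : ∀ t : ℝ, u (x + t • v) = (H 0).mulVec x + t • (H 0).mulVec v := fun t => by
      rw [h.eq_linear_of_coneDefect_eq_zero h0, Matrix.mulVec_add, Matrix.mulVec_smul]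
    funext i
    have h3 : HasDerivAt (fun t : ℝ => u (x + t • v) i) ((H x).mulVec v i) 0 := by
      rw [← h.fderiv_coord_apply i]
      have h4 : HasDerivAt (fun s : ℝ => x + s • v) v 0 := by
        simpa using ((hasDerivAt_id (0 : ℝ)).smul_const v).const_add x
      have h5 := h.hasFDerivAt_coord i (x + (0 : ℝ) • v)
      rw [zero_smul, add_zero] at h5
      exact HasFDerivAt.comp_hasDerivAt_of_eq 0 h5 h4 (by simp)
    have h6 : HasDerivAt (fun t : ℝ => u (x + t • v) i) ((H 0).mulVec v i) 0 := by
      simp only [h2, Pi.add_apply, Pi.smul_apply, smul_eq_mul]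
      simpa using ((hasDerivAt_id (0 : ℝ)).mul_const ((H 0).mulVec v i)).const_add
        ((H 0).mulVec x i)
    exact h3.unique h6
  exact Matrix.ext_of_mulVec_single fun i => h1 _

end IsSLGraph

namespace IsControlledGraph

lemma abs_areaIntegrand_le (h : IsControlledGraph H W u L B) (x y p : Fin n → ℝ) :
    |areaIntegrand (H x) y p| ≤ B := by
  rw [areaIntegrand, ← h.W_eq, abs_of_nonneg
    (mul_nonneg (h.W_pos x).le (pow_nonneg (cutoff_nonneg _) _))]
  refine (mul_le_of_le_one_right (h.W_pos x).le ?_).trans (h.W_le x)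
  exact pow_le_one₀ (cutoff_nonneg _) (cutoff_le_one (sum_nonneg fun i _ => by positivity))

lemma continuous_areaIntegrand_scaled (h : IsControlledGraph H W u L B) (σ : ℝ) :
    Continuous fun y => areaIntegrand (H (σ⁻¹ • y)) y (σ • u (σ⁻¹ • y)) := by
  have hu := h.toIsSLGraph.continuous_u
  have hH : Continuous fun y => H (σ⁻¹ • y) := h.toIsSLGraph.continuous_H.comp (by fun_prop)
  exact continuous_areaIntegrand.comp
    (Continuous.prodMk hH (continuous_id.prodMk (by fun_prop)))

lemma _root_.tendsto_areaIntegrand {ι : Type*} {l : Filter ι} {M : ι → Fin n → Fin n → ℝ}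
    {y p : ι → Fin n → ℝ} {M₀ : Fin n → Fin n → ℝ} {y₀ p₀ : Fin n → ℝ} (hM : Tendsto M l (𝓝 M₀))
    (hy : Tendsto y l (𝓝 y₀)) (hp : Tendsto p l (𝓝 p₀)) :
    Tendsto (fun i => areaIntegrand (Matrix.of (M i)) (y i) (p i)) l
      (𝓝 (areaIntegrand (Matrix.of M₀) y₀ p₀)) := by
  have h1 := hM.prodMk_nhds (hy.prodMk_nhds hp)
  have h2 := (continuous_areaIntegrand (n := n)).tendsto (M₀, y₀, p₀)
  have h3 := h2.comp h1
  exact h3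

lemma tendsto_coneMass_atTop (h : IsControlledGraph H W u L B) :
    Tendsto (coneMass W u fun _ => 1) atTop (𝓝 (flatMass n)) := by
  obtain ⟨U, lam, hU, -⟩ := h.frame 0
  rw [← integral_areaIntegrand_linear hU.left hU.right (lam := lam), ← hU.eq]
  have hev : (fun σ => ∫ y, areaIntegrand (H (σ⁻¹ • y)) y (σ • u (σ⁻¹ • y))) =ᶠ[atTop]
      coneMass W u fun _ => 1 := by
    filter_upwards [Ioi_mem_atTop 0] with σ hσ using (h.coneMass_one_eq hσ).symm
  refine Tendsto.congr' hev ?_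
  refine tendsto_integral_filter_of_dominated_convergence
    ((Metric.closedBall 0 1).indicator fun _ => B)
    (.of_forall fun σ => (h.continuous_areaIntegrand_scaled σ).aestronglyMeasurable)
    (.of_forall fun σ => .of_forall fun y => ?_)
    ((integrable_indicator_iff measurableSet_closedBall).2
      (integrableOn_const (isCompact_closedBall _ _).measure_lt_top.ne))
    (.of_forall fun y => ?_)
  · by_cases hy : y ∈ Metric.closedBall (0 : Fin n → ℝ) 1
    · rw [Set.indicator_of_mem hy]
      exact h.abs_areaIntegrand_le _ _ _
    · rw [Set.indicator_of_notMem hy, areaIntegrand_eq_zero hy, norm_zero]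
  · have h1 : Tendsto (fun σ : ℝ => σ⁻¹ • y) atTop (𝓝 0) := by
      simpa using (tendsto_inv_atTop_zero (𝕜 := ℝ)).smul_const y
    have h2 : Tendsto (fun σ : ℝ => H (σ⁻¹ • y)) atTop (𝓝 (H 0)) :=
      (h.toIsSLGraph.continuous_H.tendsto 0).comp h1
    exact tendsto_areaIntegrand h2 tendsto_const_nhds (h.toIsSLGraph.tendsto_smul_u y)

lemma flatMass_le_coneMass (h : IsControlledGraph H W u L B) {σ : ℝ} (hσ : 0 < σ) :
    flatMass n ≤ coneMass W u (fun _ => 1) σ := by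
  refine le_of_tendsto h.tendsto_coneMass_atTop ?_
  filter_upwards [Ici_mem_atTop σ] with τ hτ
  exact h.antitoneOn_coneMass hσ (hσ.trans_le hτ) hτ

/-- If the truncated mass is nearly flat at arbitrarily large scales, the graph is a plane. -/
lemma const_of_coneMass_le (h : IsControlledGraph H W u L B)
    (hle : ∀ ε > 0, ∀ σ₀ > 0, ∃ σ, 0 < σ ∧ σ < σ₀ ∧ coneMass W u (fun _ => 1) σ ≤ flatMass n + ε)
    (x : Fin n → ℝ) : H x = H 0 := by
  have hZ : ∀ σ, 0 < σ → coneMass W u (fun _ => 1) σ = flatMass n := fun σ hσ => by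
    refine le_antisymm (le_of_forall_pos_le_add fun ε hε => ?_) (h.flatMass_le_coneMass hσ)
    obtain ⟨τ, hτ, hτσ, h1⟩ := hle ε hε σ hσ
    exact (h.antitoneOn_coneMass hτ hσ hτσ.le).trans h1
  refine h.toIsSLGraph.eq_const_of_coneDefect_eq_zero (fun z => ?_) x
  by_contra hne
  set r := radius u z with hr
  have hr0 : 0 ≤ r := radius_nonneg u z
  obtain ⟨σ, hσ, hσr⟩ : ∃ σ : ℝ, 0 < σ ∧ σ ^ 2 * r < 1 := by
    refine ⟨(1 + r)⁻¹, by positivity, ?_⟩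
    rw [inv_pow, inv_mul_lt_iff₀ (by positivity)]
    nlinarith
  have hd := h.toIsSLGraph.hasDerivAt_coneMass (contDiff_const (c := (1 : ℝ))) hσ
  have hd0 : HasDerivAt (coneMass W u fun _ => 1) 0 σ := by
    refine (hasDerivAt_const σ (flatMass n)).congr_of_eventuallyEq ?_
    filter_upwards [Ioi_mem_nhds hσ] with τ hτ using hZ τ hτ
  have h1 := hd.unique hd0
  simp only [gLap_const, mul_zero, integral_zero, zero_add, mul_one] at h1
  have hcont : Continuous fun x => W x * coneDefect H u x :=
    (h.W_smooth.mul h.toIsSLGraph.contDiff_coneDefect).continuous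
  have hpos : 0 < ∫ x, cutoff (σ ^ 2 * radius u x) ^ 2 * (W x * coneDefect H u x) := by
    have hrc := h.toIsSLGraph.smooth_radius.continuous
    refine Continuous.integral_pos_of_hasCompactSupport_nonneg_nonzero (x := z) (by fun_prop) ?_ ?_ ?_
    · exact hasCompactSupport_of_cutoff (norm_sq_le_radius u) (pow_pos hσ 2) fun x hx => by
        rw [cutoff_of_one_le hx]; simp
    · exact fun x => mul_nonneg (sq_nonneg _)
        (mul_nonneg (h.W_pos x).le (h.coneDefect_nonneg x))
    · rw [cutoff_of_le_one hσr.le]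
      exact mul_ne_zero (pow_ne_zero _ (by linarith)) (mul_ne_zero (h.W_pos z).ne' hne)
  have : 0 < σ⁻¹ * σ ^ n * (6 * σ ^ 2 *
    ∫ x, cutoff (σ ^ 2 * radius u x) ^ 2 * (W x * coneDefect H u x)) := by positivity
  linarith

end IsControlledGraph

end Blowdown

end BlowdownAnalysis

section PoincareInequality

open Finset
open scoped ContDiff

section Poincare

open MeasureTheory ENNReal

variable {n : ℕ}

lemma setLIntegral_comp_convexComb_le {s : Set (Fin n → ℝ)} (hs : Convex ℝ s)
    (hms : MeasurableSet s) {g : (Fin n → ℝ) → ℝ≥0∞} (hg : Measurable g) {y : Fin n → ℝ} (hy : y ∈ s)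
    {c : ℝ} (hc : 1 / 2 ≤ c) (hc1 : c ≤ 1) :
    ∫⁻ x in s, g (c • x + (1 - c) • y) ≤ 2 ^ n * ∫⁻ x in s, g x := by
  have hc0 : 0 < c := by linarith
  have h1 : ∀ x, s.indicator (fun x => g (c • x + (1 - c) • y)) x ≤
      s.indicator g (c • x + (1 - c) • y) := fun x => by
    by_cases hx : x ∈ s
    · rw [Set.indicator_of_mem hx,
        Set.indicator_of_mem (hs hx hy hc0.le (by linarith) (by ring))]
    · rw [Set.indicator_of_notMem hx]
      exact zero_le
  have hmap : ∫⁻ x, s.indicator g (c • x + (1 - c) • y) =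
      ENNReal.ofReal |(c ^ n)⁻¹| * ∫⁻ x, s.indicator g x := by
    have hm : Measurable fun z => s.indicator g (z + (1 - c) • y) :=
      (hg.indicator hms).comp (measurable_add_const _)
    have := lintegral_map (μ := volume) hm (measurable_const_smul c : Measurable fun x : Fin n → ℝ => c • x)
    rw [← this, Measure.map_addHaar_smul _ hc0.ne', lintegral_smul_measure,
      lintegral_add_right_eq_self, Module.finrank_fin_fun, smul_eq_mul]
  calc ∫⁻ x in s, g (c • x + (1 - c) • y)
      = ∫⁻ x, s.indicator (fun x => g (c • x + (1 - c) • y)) x := (lintegral_indicator hms _).symm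
    _ ≤ ∫⁻ x, s.indicator g (c • x + (1 - c) • y) := lintegral_mono h1
    _ = ENNReal.ofReal |(c ^ n)⁻¹| * ∫⁻ x, s.indicator g x := hmap
    _ ≤ 2 ^ n * ∫⁻ x in s, g x := by
        rw [lintegral_indicator hms]
        gcongr
        rw [abs_of_pos (by positivity), show (2 : ℝ≥0∞) ^ n = ENNReal.ofReal (2 ^ n) by
          rw [ENNReal.ofReal_pow (by norm_num)]; simp]
        refine ENNReal.ofReal_le_ofReal ?_
        rw [← inv_pow]
        refine pow_le_pow_left₀ (by positivity) ?_ n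
        rw [inv_le_comm₀ hc0 (by norm_num)]
        linarith

variable {E : Type*} [NormedAddCommGroup E] [NormedSpace ℝ E] [CompleteSpace E]

lemma enorm_sub_midpoint_le {w : (Fin n → ℝ) → E} (hw : ContDiff ℝ 1 w) {x y : Fin n → ℝ}
    (hxy : ‖x - y‖ ≤ 2) :
    ‖w x - w (midpoint ℝ x y)‖ₑ ≤
      ∫⁻ t in Set.Ioc (0 : ℝ) 1, ‖fderiv ℝ w ((1 - t / 2) • x + (1 - (1 - t / 2)) • y)‖ₑ := by
  set γ : ℝ → Fin n → ℝ := fun t => (1 - t / 2) • x + (1 - (1 - t / 2)) • y with hγ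
  have hγc : Continuous γ := by fun_prop
  have hγd : ∀ t, HasDerivAt γ ((1 / 2 : ℝ) • (y - x)) t := fun t => by
    have h1 : HasDerivAt (fun t : ℝ => 1 - t / 2) (-(1 / 2)) t :=
      ((hasDerivAt_id t).div_const 2).const_sub 1
    refine ((h1.smul_const x).add ((h1.const_sub 1).smul_const y)).congr_deriv ?_
    rw [neg_neg, smul_sub, neg_smul]
    abel
  have hfd : Continuous fun t => fderiv ℝ w (γ t) := (hw.continuous_fderiv one_ne_zero).comp hγc
  have hd : ∀ t ∈ Set.uIcc (0 : ℝ) 1, HasDerivAt (fun t => w (γ t))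
      (fderiv ℝ w (γ t) ((1 / 2 : ℝ) • (y - x))) t := fun t _ =>
    ((hw.differentiable one_ne_zero (γ t)).hasFDerivAt).comp_hasDerivAt t (hγd t)
  have hint := intervalIntegral.integral_eq_sub_of_hasDerivAt hd
    ((hfd.clm_apply continuous_const).intervalIntegrable _ _)
  have h0 : γ 0 = x := by simp [hγ]
  have h1 : γ 1 = midpoint ℝ x y := by
    rw [midpoint_eq_smul_add, hγ]
    simp only
    norm_num
  rw [h0, h1, intervalIntegral.integral_of_le zero_le_one] at hint
  rw [← enorm_neg, neg_sub, ← hint]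
  refine (enorm_integral_le_lintegral_enorm _).trans (lintegral_mono fun t => ?_)
  rw [← ofReal_norm, ← ofReal_norm]
  refine ENNReal.ofReal_le_ofReal ((ContinuousLinearMap.le_opNorm _ _).trans ?_)
  refine mul_le_of_le_one_right (norm_nonneg _) ?_
  rw [norm_smul, norm_sub_rev]
  norm_num
  linarith

/-- **Poincaré inequality** on a convex set of sup-norm diameter at most `2`. -/
theorem exists_setLIntegral_enorm_sub_le {s : Set (Fin n → ℝ)} (hs : Convex ℝ s)
    (hms : MeasurableSet s) (hs0 : volume s ≠ 0) (hs1 : volume s ≠ ⊤)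
    (hdiam : ∀ x ∈ s, ∀ y ∈ s, ‖x - y‖ ≤ 2) {w : (Fin n → ℝ) → E} (hw : ContDiff ℝ 1 w) :
    ∃ y ∈ s, ∫⁻ x in s, ‖w x - w y‖ₑ ≤ 2 ^ (n + 1) * ∫⁻ x in s, ‖fderiv ℝ w x‖ₑ := by
  set G := ∫⁻ x in s, ‖fderiv ℝ w x‖ₑ with hG
  have hwc := hw.continuous
  have hfd := hw.continuous_fderiv one_ne_zero
  set A : (Fin n → ℝ) → (Fin n → ℝ) → ℝ≥0∞ := fun x y => ‖w x - w (midpoint ℝ x y)‖ₑ with hA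
  have hmid : Continuous fun q : (Fin n → ℝ) × (Fin n → ℝ) => midpoint ℝ q.1 q.2 := by
    simp only [midpoint_eq_smul_add]
    fun_prop
  have hAc : Continuous (Function.uncurry A) :=
    ((hwc.comp continuous_fst).sub (hwc.comp hmid)).enorm
  have hA1 : ∀ y ∈ s, ∫⁻ x in s, A x y ≤ 2 ^ n * G := fun y hy => by
    calc ∫⁻ x in s, A x y
        ≤ ∫⁻ x in s, ∫⁻ t in Set.Ioc (0 : ℝ) 1,
            ‖fderiv ℝ w ((1 - t / 2) • x + (1 - (1 - t / 2)) • y)‖ₑ :=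
          setLIntegral_mono' hms fun x hx => enorm_sub_midpoint_le hw (hdiam x hx y hy)
      _ = ∫⁻ t in Set.Ioc (0 : ℝ) 1, ∫⁻ x in s,
            ‖fderiv ℝ w ((1 - t / 2) • x + (1 - (1 - t / 2)) • y)‖ₑ := by
          refine lintegral_lintegral_swap (Continuous.aemeasurable ?_)
          exact (hfd.comp (by fun_prop)).enorm
      _ ≤ ∫⁻ t in Set.Ioc (0 : ℝ) 1, 2 ^ n * G :=
          setLIntegral_mono' measurableSet_Ioc fun t ht =>
            setLIntegral_comp_convexComb_le hs hms hfd.enorm.measurable hy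
              (by linarith [ht.2]) (by linarith [ht.1])
      _ = 2 ^ n * G := by simp
  have hsum : ∫⁻ y in s, ∫⁻ x in s, ‖w x - w y‖ₑ ≤ 2 ^ (n + 1) * G * volume s := by
    calc ∫⁻ y in s, ∫⁻ x in s, ‖w x - w y‖ₑ
        ≤ ∫⁻ y in s, ∫⁻ x in s, (A x y + A y x) := by
          refine lintegral_mono fun y => lintegral_mono fun x => ?_
          have : w x - w y = (w x - w (midpoint ℝ x y)) - (w y - w (midpoint ℝ y x)) := by
            rw [midpoint_comm y x]; abel
          rw [this]
          exact enorm_sub_le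
      _ = ∫⁻ y in s, ((∫⁻ x in s, A x y) + ∫⁻ x in s, A y x) := by
          refine lintegral_congr fun y => ?_
          refine lintegral_add_left (Continuous.measurable ?_) _
          exact hAc.comp (continuous_id.prodMk continuous_const)
      _ = (∫⁻ y in s, ∫⁻ x in s, A x y) + ∫⁻ y in s, ∫⁻ x in s, A y x := by
          refine lintegral_add_left ?_ _
          exact (hAc.comp continuous_swap).measurable.lintegral_prod_right'
      _ = (∫⁻ y in s, ∫⁻ x in s, A x y) + ∫⁻ x in s, ∫⁻ y in s, A y x := by
          congr 1
          exact lintegral_lintegral_swap hAc.aemeasurable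
      _ ≤ (∫⁻ _y in s, 2 ^ n * G) + ∫⁻ _x in s, 2 ^ n * G :=
          add_le_add (setLIntegral_mono' hms hA1) (setLIntegral_mono' hms hA1)
      _ = 2 ^ (n + 1) * G * volume s := by
          rw [setLIntegral_const]
          ring
  have hmeas : Measurable fun y => ∫⁻ x in s, ‖w x - w y‖ₑ := by
    have : Continuous fun q : (Fin n → ℝ) × (Fin n → ℝ) => ‖w q.2 - w q.1‖ₑ :=
      ((hwc.comp continuous_snd).sub (hwc.comp continuous_fst)).enorm
    exact this.measurable.lintegral_prod_right'
  obtain ⟨y, hy, hle⟩ := exists_le_setLAverage hs0 hs1 hmeas.aemeasurable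
  refine ⟨y, hy, hle.trans ?_⟩
  rw [setLAverage_eq]
  exact ENNReal.div_le_of_le_mul hsum

/-- **Poincaré inequality** on the unit sup-norm ball. -/
lemma exists_setIntegral_norm_sub_le {w : (Fin n → ℝ) → E} (hw : ContDiff ℝ 1 w) :
    ∃ y ∈ Metric.closedBall (0 : Fin n → ℝ) 1, ∫ x in Metric.closedBall 0 1, ‖w x - w y‖ ≤
      2 ^ (n + 1) * ∫ x in Metric.closedBall 0 1, ‖fderiv ℝ w x‖ := by
  have hcpt := isCompact_closedBall (0 : Fin n → ℝ) 1
  obtain ⟨y, hy, hle⟩ := exists_setLIntegral_enorm_sub_le (convex_closedBall (0 : Fin n → ℝ) 1)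
    measurableSet_closedBall (Metric.measure_closedBall_pos _ _ one_pos).ne'
    hcpt.measure_lt_top.ne (fun x hx y hy => by
      rw [mem_closedBall_zero_iff] at hx hy
      linarith [norm_sub_le x y]) hw
  refine ⟨y, hy, ?_⟩
  have h1 : Integrable (fun x => w x - w y) (volume.restrict (Metric.closedBall 0 1)) :=
    (hw.continuous.sub continuous_const).continuousOn.integrableOn_compact hcpt
  have h2 : Integrable (fun x => fderiv ℝ w x) (volume.restrict (Metric.closedBall 0 1)) :=
    (hw.continuous_fderiv one_ne_zero).continuousOn.integrableOn_compact hcpt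
  rw [← ofReal_integral_norm_eq_lintegral_enorm h1, ← ofReal_integral_norm_eq_lintegral_enorm h2,
    show (2 : ℝ≥0∞) ^ (n + 1) = ENNReal.ofReal (2 ^ (n + 1)) by
      rw [ENNReal.ofReal_pow (by norm_num)]; simp,
    ← ENNReal.ofReal_mul (by positivity)] at hle
  exact (ENNReal.ofReal_le_ofReal_iff
    (mul_nonneg (by positivity) (integral_nonneg fun _ => norm_nonneg _))).1 hle

end Poincare

end PoincareInequality

section SlopeApproximation

open Finset
open scoped ContDiff

section Slope

open MeasureTheory

variable {n : ℕ} {H : (Fin n → ℝ) → Matrix (Fin n) (Fin n) ℝ} {W : (Fin n → ℝ) → ℝ}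
  {u : (Fin n → ℝ) → Fin n → ℝ} {L B : ℝ}

lemma norm_mulVec_le (M : Matrix (Fin n) (Fin n) ℝ) (v : Fin n → ℝ) :
    ‖M.mulVec v‖ ≤ n * ‖Matrix.of.symm M‖ * ‖v‖ := by
  refine (pi_norm_le_iff_of_nonneg (by positivity)).2 fun i => ?_
  calc ‖M.mulVec v i‖ ≤ ∑ j, ‖M i j * v j‖ := norm_sum_le univ fun j => M i j * v j
    _ ≤ ∑ _j : Fin n, ‖Matrix.of.symm M‖ * ‖v‖ := sum_le_sum fun j _ => by
        rw [norm_mul]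
        gcongr
        · exact (norm_le_pi_norm (Matrix.of.symm M i) j).trans (norm_le_pi_norm (Matrix.of.symm M) i)
        · exact norm_le_pi_norm v j
    _ = _ := by simp [mul_assoc]

lemma norm_mulVecLin_le (M : Matrix (Fin n) (Fin n) ℝ) :
    ‖(Matrix.toLin' M).toContinuousLinearMap‖ ≤ n * ‖Matrix.of.symm M‖ :=
  ContinuousLinearMap.opNorm_le_bound _ (by positivity) fun v => norm_mulVec_le M v

lemma norm_of_symm_le {M : Matrix (Fin n) (Fin n) ℝ} {R : ℝ} (hR : 0 ≤ R)
    (hM : ∀ i j, |M i j| ≤ R) : ‖Matrix.of.symm M‖ ≤ R :=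
  (pi_norm_le_iff_of_nonneg hR).2 fun i => (pi_norm_le_iff_of_nonneg hR).2 fun j => hM i j

namespace IsSLGraph

lemma contDiff_u (h : IsSLGraph H W u) : ContDiff ℝ ∞ u := contDiff_pi.2 h.u_smooth

lemma hasFDerivAt_u (h : IsSLGraph H W u) (x : Fin n → ℝ) :
    HasFDerivAt u (Matrix.toLin' (H x)).toContinuousLinearMap x := by
  rw [hasFDerivAt_pi']
  intro i
  refine (h.hasFDerivAt_coord i x).congr_fderiv ?_
  ext v
  simp only [h.fderiv_coord_apply]
  rfl

lemma contDiff_of_symm_H (h : IsSLGraph H W u) : ContDiff ℝ ∞ fun x => Matrix.of.symm (H x) :=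
  contDiff_pi.2 fun i => contDiff_pi.2 fun j => h.smooth i j

lemma norm_fderiv_H_le (h : IsSLGraph H W u) (x : Fin n → ℝ) :
    ‖fderiv ℝ (fun x => Matrix.of.symm (H x)) x‖ ≤
      n * √(∑ k, ∑ i, ∑ j, mpd k H x i j ^ 2) := by
  refine ContinuousLinearMap.opNorm_le_bound _ (by positivity) fun v => ?_
  refine (pi_norm_le_iff_of_nonneg (by positivity)).2 fun i =>
    (pi_norm_le_iff_of_nonneg (by positivity)).2 fun j => ?_
  have h1 := (h.contDiff_of_symm_H.differentiable (by simp) x).hasFDerivAt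
  have h2 := hasFDerivAt_pi'.1 (hasFDerivAt_pi'.1 h1 i) j
  have h3 : fderiv ℝ (fun x => Matrix.of.symm (H x)) x v i j = ∑ k, v k * mpd k H x i j := by
    have := fderiv_apply_eq_sum_pd (f := fun y => H y i j) x v
    have h4 : fderiv ℝ (fun y => H y i j) x = _ := h2.fderiv
    rw [h4] at this
    exact this
  rw [h3]
  calc ‖∑ k, v k * mpd k H x i j‖ ≤ ∑ k, ‖v k * mpd k H x i j‖ := norm_sum_le _ _
    _ ≤ ∑ _k : Fin n, ‖v‖ * √(∑ k, ∑ i, ∑ j, mpd k H x i j ^ 2) := sum_le_sum fun k _ => by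
        rw [norm_mul]
        gcongr
        · exact norm_le_pi_norm v k
        · refine Real.abs_le_sqrt ?_
          refine le_trans ?_ (single_le_sum (f := fun k => ∑ i, ∑ j, mpd k H x i j ^ 2)
            (fun k _ => by positivity) (mem_univ k))
          refine le_trans ?_ (single_le_sum (f := fun i => ∑ j, mpd k H x i j ^ 2)
            (fun k _ => by positivity) (mem_univ i))
          exact single_le_sum (f := fun j => mpd k H x i j ^ 2)
            (fun k _ => by positivity) (mem_univ j)
    _ = _ := by simp; ring

end IsSLGraph

namespace IsControlledGraph

lemma norm_H_le (h : IsControlledGraph H W u L B) (x : Fin n → ℝ) :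
    ‖Matrix.of.symm (H x)‖ ≤ √(n * L) := by
  refine norm_of_symm_le (Real.sqrt_nonneg _) fun i j => Real.abs_le_sqrt ?_
  obtain ⟨U, lam, hU, hlam, -⟩ := h.frame x
  have h1 : (H x * H x).trace = ∑ i, lam i ^ 2 := by
    rw [hU.eq, inFrame_mul hU.left, inFrame_trace hU.left]
    exact sum_congr rfl fun i _ => (sq _).symm
  have h2 : (H x * H x).trace = ∑ i, ∑ j, H x i j ^ 2 := by
    simp only [Matrix.trace, Matrix.diag, Matrix.mul_apply]
    exact sum_congr rfl fun i _ => sum_congr rfl fun j _ => by rw [h.symm x j i, sq]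
  calc H x i j ^ 2 ≤ ∑ j, H x i j ^ 2 :=
        single_le_sum (f := fun j => H x i j ^ 2) (fun _ _ => sq_nonneg _) (mem_univ j)
    _ ≤ ∑ i, ∑ j, H x i j ^ 2 := single_le_sum (f := fun i => ∑ j, H x i j ^ 2)
        (fun _ _ => by positivity) (mem_univ i)
    _ = ∑ i, lam i ^ 2 := by rw [← h2, h1]
    _ ≤ ∑ _i : Fin n, L := sum_le_sum fun i _ => hlam i
    _ = n * L := by simp

lemma norm_u_le (h : IsControlledGraph H W u L B) (x : Fin n → ℝ) :
    ‖u x‖ ≤ n * √(n * L) * ‖x‖ := by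
  have := (convex_univ (𝕜 := ℝ) (E := Fin n → ℝ)).norm_image_sub_le_of_norm_hasFDerivWithin_le
    (f := u) (C := n * √(n * L)) (fun y _ => (h.toIsSLGraph.hasFDerivAt_u y).hasFDerivWithinAt)
    (fun y _ => (norm_mulVecLin_le _).trans (by gcongr; exact h.norm_H_le y))
    (Set.mem_univ 0) (Set.mem_univ x)
  simpa [h.u_zero] using this

lemma radius_le (h : IsControlledGraph H W u L B) (x : Fin n → ℝ) :
    radius u x ≤ n * (1 + (n * √(n * L)) ^ 2) * ‖x‖ ^ 2 := by
  have h1 : ∀ i, x i ^ 2 + u x i ^ 2 ≤ (1 + (n * √(n * L)) ^ 2) * ‖x‖ ^ 2 := fun i => by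
    have h2 : x i ^ 2 ≤ ‖x‖ ^ 2 := sq_le_sq' (abs_le.1 (norm_le_pi_norm x i)).1
      (abs_le.1 (norm_le_pi_norm x i)).2
    have h3 : u x i ^ 2 ≤ (n * √(n * L) * ‖x‖) ^ 2 := by
      have := abs_le.1 ((norm_le_pi_norm (u x) i).trans (h.norm_u_le x))
      exact sq_le_sq' this.1 this.2
    rw [mul_pow] at h3
    linarith
  calc radius u x ≤ ∑ _i : Fin n, (1 + (n * √(n * L)) ^ 2) * ‖x‖ ^ 2 := sum_le_sum fun i _ => h1 i
    _ = _ := by simp [mul_assoc]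

/-- The energy of the Hessian is small on suitable large balls. -/
lemma exists_small_energy_closedBall (h : IsControlledGraph H W u L B) {δ σ₀ : ℝ} (hδ : 0 < δ)
    (hσ₀ : 0 < σ₀) : ∃ σ, 0 < σ ∧ σ < σ₀ ∧ ∫ y in Metric.closedBall (0 : Fin n → ℝ) 1,
      (∑ k, ∑ i, ∑ j, mpd k H (σ⁻¹ • y) i j ^ 2) ≤ δ * σ ^ 2 := by
  set C : ℝ := n * (1 + (n * √(n * L)) ^ 2) with hC
  have hC0 : 0 ≤ C := by positivity
  obtain ⟨ρ, hρ, hρC⟩ : ∃ ρ : ℝ, 0 < ρ ∧ C * ρ ^ 2 ≤ 1 / 2 := by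
    refine ⟨(1 + 2 * C)⁻¹, by positivity, ?_⟩
    rw [inv_pow, ← div_eq_mul_inv, div_le_iff₀ (by positivity)]
    nlinarith
  set S : (Fin n → ℝ) → ℝ := fun x => ∑ k, ∑ i, ∑ j, mpd k H x i j ^ 2 with hS
  have hS0 : ∀ x, 0 ≤ S x := fun x => by positivity
  have hSc : Continuous S := by
    have : ∀ k i j, Continuous fun x => mpd k H x i j := fun k i j =>
      (h.smooth.mpd k i j).continuous
    fun_prop
  obtain ⟨τ, hτ, hτσ, hle⟩ := h.exists_small_energy (δ := δ * ρ ^ n / (16 * ρ ^ 2)) (σ₀ := ρ * σ₀)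
    (by positivity) (by positivity)
  set f : (Fin n → ℝ) → ℝ := fun x => cutoff (τ ^ 2 * radius u x) ^ 4 * (W x * S x) with hf
  have hf0 : ∀ x, 0 ≤ f x := fun x =>
    mul_nonneg (pow_nonneg (cutoff_nonneg _) _) (mul_nonneg (h.W_pos x).le (hS0 x))
  have hfi : Integrable f := h.toIsSLGraph.integrable_cutoff_mul (pow_pos hτ 2) 3
    (h.W_smooth.continuous.mul hSc)
  set σ := τ / ρ with hσ
  have hσ0 : 0 < σ := by positivity
  refine ⟨σ, hσ0, by rw [hσ, div_lt_iff₀ hρ]; linarith, ?_⟩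
  have hfi' : Integrable fun y => f (σ⁻¹ • y) := hfi.comp_smul (inv_ne_zero hσ0.ne')
  have hcpt := isCompact_closedBall (0 : Fin n → ℝ) 1
  have hpt : ∀ y ∈ Metric.closedBall (0 : Fin n → ℝ) 1, S (σ⁻¹ • y) ≤ 16 * f (σ⁻¹ • y) := by
    intro y hy
    rw [mem_closedBall_zero_iff] at hy
    have h1 : τ ^ 2 * radius u (σ⁻¹ • y) ≤ 1 / 2 := by
      calc τ ^ 2 * radius u (σ⁻¹ • y) ≤ τ ^ 2 * (C * ‖σ⁻¹ • y‖ ^ 2) := by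
            gcongr; exact h.radius_le _
        _ = C * ρ ^ 2 * ‖y‖ ^ 2 := by
            rw [norm_smul, Real.norm_eq_abs, abs_of_pos (by positivity), hσ]
            field_simp
        _ ≤ C * ρ ^ 2 * 1 := by gcongr; exact pow_le_one₀ (norm_nonneg _) hy
        _ ≤ 1 / 2 := by linarith
    have h2 : 1 / 2 ≤ cutoff (τ ^ 2 * radius u (σ⁻¹ • y)) := by
      rw [cutoff_of_le_one (by linarith)]; linarith
    have h3 : (1 / 2 : ℝ) ^ 4 ≤ cutoff (τ ^ 2 * radius u (σ⁻¹ • y)) ^ 4 := by gcongr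
    have h4 : S (σ⁻¹ • y) ≤ W (σ⁻¹ • y) * S (σ⁻¹ • y) :=
      le_mul_of_one_le_left (hS0 _) (h.one_le_W _)
    have h5 := mul_le_mul h3 h4 (hS0 _) ((by positivity : (0 : ℝ) ≤ (1 / 2) ^ 4).trans h3)
    norm_num at h5
    simp only [hf]
    linarith
  calc ∫ y in Metric.closedBall (0 : Fin n → ℝ) 1, S (σ⁻¹ • y)
      ≤ ∫ y in Metric.closedBall (0 : Fin n → ℝ) 1, 16 * f (σ⁻¹ • y) :=
        setIntegral_mono_on ((hSc.comp (by fun_prop)).continuousOn.integrableOn_compact hcpt)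
          (hfi'.const_mul 16).integrableOn measurableSet_closedBall hpt
    _ ≤ ∫ y, 16 * f (σ⁻¹ • y) := setIntegral_le_integral (hfi'.const_mul 16)
        (.of_forall fun y => mul_nonneg (by norm_num) (hf0 _))
    _ = 16 * (σ ^ n * ∫ x, f x) := by
        rw [integral_const_mul, Measure.integral_comp_smul, Module.finrank_fin_fun, inv_pow,
          inv_inv, abs_of_pos (by positivity), smul_eq_mul]
    _ = 16 * (ρ ^ n)⁻¹ * (τ ^ n * ∫ x, f x) := by
        rw [hσ, div_pow]; field_simp
    _ ≤ 16 * (ρ ^ n)⁻¹ * (δ * ρ ^ n / (16 * ρ ^ 2) * τ ^ 2) := by gcongr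
    _ = δ * σ ^ 2 := by rw [hσ]; field_simp

end IsControlledGraph

end Slope

end SlopeApproximation

section Rigidity

open Finset
open scoped ContDiff

section Flatness

open MeasureTheory

lemma IsCompact.exists_abs_sub_le_add_mul_dist {X : Type*} [PseudoMetricSpace X] {s : Set X}
    (hs : IsCompact s) {f : X → ℝ} (hf : ContinuousOn f s) {ε : ℝ} (hε : 0 < ε) :
    ∃ C, 0 ≤ C ∧ ∀ p ∈ s, ∀ q ∈ s, |f p - f q| ≤ ε + C * dist p q := by
  obtain ⟨M, hM⟩ := hs.exists_bound_of_continuousOn hf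
  obtain ⟨δ, hδ, huc⟩ := Metric.uniformContinuousOn_iff.1
    (hs.uniformContinuousOn_of_continuous hf) ε hε
  refine ⟨2 * |M| / δ, by positivity, fun p hp q hq => ?_⟩
  rcases lt_or_ge (dist p q) δ with h | h
  · have := huc p hp q hq h
    rw [Real.dist_eq] at this
    exact this.le.trans (le_add_of_nonneg_right (by positivity))
  · have h1 : |f p - f q| ≤ 2 * |M| := by
      have := hM p hp
      have := hM q hq
      rw [Real.norm_eq_abs] at *
      linarith [abs_sub (f p) (f q), le_abs_self M]
    have h2 : 2 * |M| ≤ 2 * |M| / δ * dist p q := by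
      rw [div_mul_eq_mul_div, le_div_iff₀ hδ]
      gcongr
    linarith

variable {n : ℕ} {H : (Fin n → ℝ) → Matrix (Fin n) (Fin n) ℝ} {W : (Fin n → ℝ) → ℝ}
  {u : (Fin n → ℝ) → Fin n → ℝ} {L B : ℝ}

namespace IsSLGraph

lemma hasFDerivAt_scaled_sub (h : IsSLGraph H W u) {σ : ℝ} (hσ : 0 < σ)
    (A : Matrix (Fin n) (Fin n) ℝ) (y : Fin n → ℝ) :
    HasFDerivAt (fun y => σ • u (σ⁻¹ • y) - A.mulVec y)
      (Matrix.toLin' (H (σ⁻¹ • y) - A)).toContinuousLinearMap y := by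
  have h1 := ((h.hasFDerivAt_u (σ⁻¹ • y)).comp y
    ((hasFDerivAt_id (𝕜 := ℝ) y).const_smul σ⁻¹)).const_smul σ
  refine (h1.sub (Matrix.toLin' A).toContinuousLinearMap.hasFDerivAt).congr_fderiv ?_
  ext1 v
  simp [smul_smul, hσ.ne']

/-- The rescaled gradient map is close to an affine map when the rescaled energy is small. -/
lemma exists_affine_approx (h : IsSLGraph H W u) {σ : ℝ} (hσ : 0 < σ) {η : ℝ} (hη : 0 < η)
    (hle : ∫ y in Metric.closedBall (0 : Fin n → ℝ) 1,
      (∑ k, ∑ i, ∑ j, mpd k H (σ⁻¹ • y) i j ^ 2) ≤ η ^ 2 * σ ^ 2) :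
    ∃ y₀ ∈ Metric.closedBall (0 : Fin n → ℝ) 1, ∃ y₁ ∈ Metric.closedBall (0 : Fin n → ℝ) 1,
      (∫ y in Metric.closedBall (0 : Fin n → ℝ) 1,
        ‖Matrix.of.symm (H (σ⁻¹ • y)) - Matrix.of.symm (H (σ⁻¹ • y₀))‖ ≤
          2 ^ (n + 1) * (n * (2 ^ n + 1)) * η) ∧
      (∫ y in Metric.closedBall (0 : Fin n → ℝ) 1,
        ‖(σ • u (σ⁻¹ • y) - (H (σ⁻¹ • y₀)).mulVec y) -
          (σ • u (σ⁻¹ • y₁) - (H (σ⁻¹ • y₀)).mulVec y₁)‖ ≤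
          2 ^ (n + 1) * (n * (2 ^ (n + 1) * (n * (2 ^ n + 1)))) * η) := by
  have hcpt := isCompact_closedBall (0 : Fin n → ℝ) 1
  have hvol : volume.real (Metric.closedBall (0 : Fin n → ℝ) 1) = 2 ^ n := by
    rw [Measure.real, Real.volume_pi_closedBall _ (by positivity), Fintype.card_fin,
      ENNReal.toReal_ofReal (by positivity), mul_one]
  have hI : ∀ {E : Type} [NormedAddCommGroup E] {g : (Fin n → ℝ) → E}, Continuous g →
      IntegrableOn g (Metric.closedBall 0 1) := fun hg => hg.continuousOn.integrableOn_compact hcpt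
  set S : (Fin n → ℝ) → ℝ := fun x => ∑ k, ∑ i, ∑ j, mpd k H x i j ^ 2 with hS
  have hS0 : ∀ x, 0 ≤ S x := fun x => by positivity
  have hSc : Continuous S := by
    have : ∀ k i j, Continuous fun x => mpd k H x i j := fun k i j =>
      (h.smooth.mpd k i j).continuous
    fun_prop
  have hG : ContDiff ℝ 1 fun y => Matrix.of.symm (H (σ⁻¹ • y)) :=
    (h.contDiff_of_symm_H.of_le (by simp)).comp (contDiff_const_smul σ⁻¹)
  have hD : ∫ y in Metric.closedBall (0 : Fin n → ℝ) 1,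
      ‖fderiv ℝ (fun y => Matrix.of.symm (H (σ⁻¹ • y))) y‖ ≤ n * (2 ^ n + 1) * η := by
    have hpt : ∀ y, ‖fderiv ℝ (fun y => Matrix.of.symm (H (σ⁻¹ • y))) y‖ ≤
        n * (η + η⁻¹ * (σ ^ 2)⁻¹ * S (σ⁻¹ • y)) := fun y => by
      rw [fderiv_comp_smul (f := fun x => Matrix.of.symm (H x)), norm_smul, Real.norm_eq_abs,
        abs_of_pos (by positivity)]
      have h1 := h.norm_fderiv_H_le (σ⁻¹ • y)
      have h2 : σ⁻¹ * √(S (σ⁻¹ • y)) ≤ η + η⁻¹ * (σ ^ 2)⁻¹ * S (σ⁻¹ • y) := by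
        have h3 := Real.sq_sqrt (hS0 (σ⁻¹ • y))
        set s := √(S (σ⁻¹ • y))
        rw [← h3]
        have h4 : η + η⁻¹ * (σ ^ 2)⁻¹ * s ^ 2 - σ⁻¹ * s =
            η⁻¹ * ((η - σ⁻¹ * s / 2) ^ 2 + 3 / 4 * (σ⁻¹ * s) ^ 2) := by
          field_simp
          ring
        have h5 : 0 ≤ η⁻¹ * ((η - σ⁻¹ * s / 2) ^ 2 + 3 / 4 * (σ⁻¹ * s) ^ 2) := by positivity
        linarith
      calc σ⁻¹ * ‖fderiv ℝ (fun x => Matrix.of.symm (H x)) (σ⁻¹ • y)‖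
          ≤ σ⁻¹ * (n * √(S (σ⁻¹ • y))) := by gcongr
        _ = n * (σ⁻¹ * √(S (σ⁻¹ • y))) := by ring
        _ ≤ _ := by gcongr
    have hSσ : Continuous fun y : Fin n → ℝ => S (σ⁻¹ • y) := hSc.comp (by fun_prop)
    calc _ ≤ ∫ y in Metric.closedBall (0 : Fin n → ℝ) 1,
          n * (η + η⁻¹ * (σ ^ 2)⁻¹ * S (σ⁻¹ • y)) :=
          setIntegral_mono (hI (hG.continuous_fderiv one_ne_zero).norm) (hI (by fun_prop)) hpt
      _ = n * (2 ^ n * η + η⁻¹ * (σ ^ 2)⁻¹ *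
            ∫ y in Metric.closedBall (0 : Fin n → ℝ) 1, S (σ⁻¹ • y)) := by
          rw [integral_const_mul, integral_add (hI continuous_const) (hI (by fun_prop)),
            integral_const_mul, setIntegral_const, hvol, smul_eq_mul]
      _ ≤ n * (2 ^ n * η + η⁻¹ * (σ ^ 2)⁻¹ * (η ^ 2 * σ ^ 2)) := by gcongr
      _ = _ := by field_simp
  obtain ⟨y₀, hy₀, h1⟩ := exists_setIntegral_norm_sub_le hG
  have h1' := h1.trans (mul_le_mul_of_nonneg_left hD (by positivity))
  set A := H (σ⁻¹ • y₀) with hA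
  have hw : ContDiff ℝ 1 fun y => σ • u (σ⁻¹ • y) - A.mulVec y :=
    (((h.contDiff_u.of_le (by simp)).comp (contDiff_const_smul σ⁻¹)).const_smul σ).sub
      (Matrix.toLin' A).toContinuousLinearMap.contDiff
  obtain ⟨y₁, hy₁, h2⟩ := exists_setIntegral_norm_sub_le hw
  refine ⟨y₀, hy₀, y₁, hy₁, h1'.trans_eq (by ring), h2.trans ?_⟩
  have h3 : ∫ y in Metric.closedBall (0 : Fin n → ℝ) 1,
      ‖fderiv ℝ (fun y => σ • u (σ⁻¹ • y) - A.mulVec y) y‖ ≤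
      n * ∫ y in Metric.closedBall (0 : Fin n → ℝ) 1,
        ‖Matrix.of.symm (H (σ⁻¹ • y)) - Matrix.of.symm A‖ := by
    rw [← integral_const_mul]
    have hGc := hG.continuous
    refine setIntegral_mono (hI (hw.continuous_fderiv one_ne_zero).norm)
      (hI (by fun_prop)) fun y => ?_
    rw [(h.hasFDerivAt_scaled_sub hσ A y).fderiv]
    exact norm_mulVecLin_le _
  calc _ ≤ 2 ^ (n + 1) * (n * (2 ^ (n + 1) * (n * (2 ^ n + 1) * η))) := by
        gcongr
        exact h3.trans (by gcongr)
    _ = _ := by ring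

end IsSLGraph

namespace IsControlledGraph

theorem exists_coneMass_le (h : IsControlledGraph H W u L B) {ε σ₀ : ℝ} (hε : 0 < ε)
    (hσ₀ : 0 < σ₀) :
    ∃ σ, 0 < σ ∧ σ < σ₀ ∧ coneMass W u (fun _ => 1) σ ≤ flatMass n + ε := by
  set R : ℝ := √(n * L) with hR
  have hR0 : 0 ≤ R := Real.sqrt_nonneg _
  have hcpt := isCompact_closedBall (0 : Fin n → ℝ) 1
  obtain ⟨C, hC, hlip⟩ := ((isCompact_closedBall (0 : Fin n → Fin n → ℝ) R).prod
    (hcpt.prod (isCompact_closedBall (0 : Fin n → ℝ) (3 * (n * R))))).exists_abs_sub_le_add_mul_dist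
    continuous_areaIntegrand.continuousOn (ε := ε / 2 / 2 ^ n) (by positivity)
  set P : ℝ := 2 ^ (n + 1) * (n * (2 ^ n + 1)) with hP
  set P' : ℝ := 2 ^ (n + 1) * (n * P) with hP'
  obtain ⟨η, hη, hηε⟩ : ∃ η : ℝ, 0 < η ∧ C * (P * η + P' * η) ≤ ε / 2 := by
    refine ⟨ε / 2 / (1 + C * (P + P')), by positivity, ?_⟩
    rw [← add_mul, ← mul_assoc, ← mul_div_assoc, div_le_iff₀ (by positivity), mul_comm (ε / 2)]
    gcongr
    linarith
  obtain ⟨σ, hσ, hσσ, hen⟩ := h.exists_small_energy_closedBall (δ := η ^ 2) (by positivity) hσ₀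
  refine ⟨σ, hσ, hσσ, ?_⟩
  obtain ⟨y₀, hy₀, y₁, hy₁, h1, h2⟩ := h.toIsSLGraph.exists_affine_approx hσ hη hen
  set A := H (σ⁻¹ • y₀) with hA
  set b := σ • u (σ⁻¹ • y₁) - A.mulVec y₁ with hb
  obtain ⟨U, lam, hU, -⟩ := h.frame (σ⁻¹ • y₀)
  have hflat : ∫ y, areaIntegrand A y (A.mulVec y + b) ≤ flatMass n := by
    rw [hA, hU.eq]
    exact integral_areaIntegrand_affine_le hU.left hU.right b
  have hvol : volume.real (Metric.closedBall (0 : Fin n → ℝ) 1) = 2 ^ n := by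
    rw [Measure.real, Real.volume_pi_closedBall _ (by positivity), Fintype.card_fin,
      ENNReal.toReal_ofReal (by positivity), mul_one]
  have hI : ∀ {g : (Fin n → ℝ) → ℝ}, Continuous g →
      IntegrableOn g (Metric.closedBall 0 1) := fun hg => hg.continuousOn.integrableOn_compact hcpt
  have hball : ∀ {M : (Fin n → ℝ) → Matrix (Fin n) (Fin n) ℝ} {p : (Fin n → ℝ) → Fin n → ℝ},
      ∫ y, areaIntegrand (M y) y (p y) =
        ∫ y in Metric.closedBall 0 1, areaIntegrand (M y) y (p y) := fun {M p} =>
    (setIntegral_eq_integral_of_forall_compl_eq_zero fun y hy => areaIntegrand_eq_zero hy).symm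
  have hus : ∀ y ∈ Metric.closedBall (0 : Fin n → ℝ) 1, ‖σ • u (σ⁻¹ • y)‖ ≤ n * R := by
    intro y hy
    rw [mem_closedBall_zero_iff] at hy
    calc ‖σ • u (σ⁻¹ • y)‖ ≤ σ * (n * R * (σ⁻¹ * ‖y‖)) := by
          rw [norm_smul, Real.norm_eq_abs, abs_of_pos hσ]
          have := h.norm_u_le (σ⁻¹ • y)
          rw [norm_smul, Real.norm_eq_abs, abs_of_pos (inv_pos.2 hσ)] at this
          gcongr
      _ = n * R * ‖y‖ := by field_simp
      _ ≤ n * R := mul_le_of_le_one_right (by positivity) hy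
  have hAy : ∀ y ∈ Metric.closedBall (0 : Fin n → ℝ) 1, ‖A.mulVec y‖ ≤ n * R := by
    intro y hy
    rw [mem_closedBall_zero_iff] at hy
    calc ‖A.mulVec y‖ ≤ n * ‖Matrix.of.symm A‖ * ‖y‖ := norm_mulVec_le A y
      _ ≤ n * R * 1 := by gcongr; exact h.norm_H_le _
      _ = n * R := mul_one _
  have hpt : ∀ y ∈ Metric.closedBall (0 : Fin n → ℝ) 1,
      areaIntegrand (H (σ⁻¹ • y)) y (σ • u (σ⁻¹ • y)) ≤ areaIntegrand A y (A.mulVec y + b) +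
        (ε / 2 / 2 ^ n + C * (‖Matrix.of.symm (H (σ⁻¹ • y)) - Matrix.of.symm A‖ +
          ‖(σ • u (σ⁻¹ • y) - A.mulVec y) - b‖)) := by
    intro y hy
    have hnR : 0 ≤ n * R := by positivity
    have h3 := hlip (Matrix.of.symm (H (σ⁻¹ • y)), y, σ • u (σ⁻¹ • y))
      ⟨mem_closedBall_zero_iff.2 (h.norm_H_le _), hy, mem_closedBall_zero_iff.2
        ((hus y hy).trans (by linarith))⟩
      (Matrix.of.symm A, y, A.mulVec y + b)
      ⟨mem_closedBall_zero_iff.2 (h.norm_H_le _), hy, mem_closedBall_zero_iff.2 (by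
        have := norm_add_le (A.mulVec y) b
        have := norm_sub_le (σ • u (σ⁻¹ • y₁)) (A.mulVec y₁)
        have := hAy y hy
        have := hAy y₁ hy₁
        have := hus y₁ hy₁
        linarith)⟩
    have h4 : dist (Matrix.of.symm (H (σ⁻¹ • y)), y, σ • u (σ⁻¹ • y))
        (Matrix.of.symm A, y, A.mulVec y + b) ≤
        ‖Matrix.of.symm (H (σ⁻¹ • y)) - Matrix.of.symm A‖ +
          ‖(σ • u (σ⁻¹ • y) - A.mulVec y) - b‖ := by
      rw [Prod.dist_eq, Prod.dist_eq, dist_self, dist_eq_norm, dist_eq_norm, sub_sub]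
      exact max_le (le_add_of_nonneg_right (norm_nonneg _))
        (max_le (by positivity) (le_add_of_nonneg_left (norm_nonneg _)))
    have h5 := (le_abs_self _).trans (h3.trans (add_le_add_right (mul_le_mul_of_nonneg_left h4 hC) _))
    exact sub_le_iff_le_add'.1 h5
  have hHc : Continuous fun y : Fin n → ℝ => Matrix.of.symm (H (σ⁻¹ • y)) :=
    h.toIsSLGraph.contDiff_of_symm_H.continuous.comp (by fun_prop)
  have huc : Continuous fun y : Fin n → ℝ => σ • u (σ⁻¹ • y) :=
    (h.toIsSLGraph.continuous_u.comp (by fun_prop)).const_smul σ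
  have hAc : Continuous fun y : Fin n → ℝ => A.mulVec y :=
    continuous_pi fun i => continuous_mulVec_apply A i
  have hflatc : Continuous fun y => areaIntegrand A y (A.mulVec y + b) :=
    continuous_areaIntegrand.comp (f := fun y => (Matrix.of.symm A, y, A.mulVec y + b)) (by fun_prop)
  have hc1 : Continuous fun y => ‖Matrix.of.symm (H (σ⁻¹ • y)) - Matrix.of.symm A‖ := by fun_prop
  have hc2 : Continuous fun y => ‖(σ • u (σ⁻¹ • y) - A.mulVec y) - b‖ := by fun_prop
  have hc3 : Continuous fun y => C * (‖Matrix.of.symm (H (σ⁻¹ • y)) - Matrix.of.symm A‖ +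
      ‖(σ • u (σ⁻¹ • y) - A.mulVec y) - b‖) := by fun_prop
  have hc4 : Continuous fun y => ε / 2 / 2 ^ n +
      C * (‖Matrix.of.symm (H (σ⁻¹ • y)) - Matrix.of.symm A‖ +
        ‖(σ • u (σ⁻¹ • y) - A.mulVec y) - b‖) := by fun_prop
  calc coneMass W u (fun _ => 1) σ
      = ∫ y in Metric.closedBall 0 1, areaIntegrand (H (σ⁻¹ • y)) y (σ • u (σ⁻¹ • y)) := by
        rw [h.coneMass_one_eq hσ, hball]
    _ ≤ ∫ y in Metric.closedBall 0 1, (areaIntegrand A y (A.mulVec y + b) +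
        (ε / 2 / 2 ^ n + C * (‖Matrix.of.symm (H (σ⁻¹ • y)) - Matrix.of.symm A‖ +
          ‖(σ • u (σ⁻¹ • y) - A.mulVec y) - b‖))) :=
        setIntegral_mono_on (hI (h.continuous_areaIntegrand_scaled σ))
          (hI (hflatc.add hc4))
          measurableSet_closedBall hpt
    _ = (∫ y, areaIntegrand A y (A.mulVec y + b)) + (ε / 2 + C * (
        (∫ y in Metric.closedBall 0 1, ‖Matrix.of.symm (H (σ⁻¹ • y)) - Matrix.of.symm A‖) +
          ∫ y in Metric.closedBall 0 1, ‖(σ • u (σ⁻¹ • y) - A.mulVec y) - b‖)) := by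
        rw [integral_add (hI hflatc) (hI hc4), integral_add (hI continuous_const) (hI hc3),
          integral_const_mul, integral_add (hI hc1) (hI hc2), setIntegral_const, hvol,
          smul_eq_mul, mul_div_cancel₀ _ (by positivity), ← hball]
    _ ≤ flatMass n + (ε / 2 + C * (P * η + P' * η)) := by
        gcongr
    _ ≤ flatMass n + ε := by linarith

theorem hessian_const (h : IsControlledGraph H W u L B) (x : Fin n → ℝ) : H x = H 0 :=
  h.const_of_coneMass_le (fun _ hε _ hσ₀ => h.exists_coneMass_le hε hσ₀) x

end IsControlledGraph

end Flatness

end Rigidity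

section EntireSolutions

open Finset
open scoped ContDiff

section Entire

variable {n : ℕ} {F : (Fin n → ℝ) → ℝ} {Θ K : ℝ}

lemma isControlledGraph_hess (hF : ContDiff ℝ ∞ F) (hsymm : ∀ x, (Hess n F x).IsHermitian)
    (hSLE : ∀ x, ∑ i, Real.arctan ((hsymm x).eigenvalues i) = Θ)
    (hbdd : ∀ x i, |(hsymm x).eigenvalues i| ≤ K)
    (hcurv : ∀ x, CurvNonneg (hsymm x).eigenvalues) :
    IsControlledGraph (Hess n F) (slDensity Θ (Hess n F)) (fun y i => pd i F y - pd i F 0)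
      (K ^ 2) (√(1 + K ^ 2) ^ n) := by
  have hsq : ∀ x i, (hsymm x).eigenvalues i ^ 2 ≤ K ^ 2 := fun x i =>
    sq_le_sq.2 ((hbdd x i).trans (le_abs_self K))
  exact
    { isSLHessian_hess hF hsymm hSLE with
      u_smooth := fun i => (hF.pd i).sub contDiff_const
      u_pd := fun k i x => by
        rw [pd, fderiv_sub_const]
        rfl
      u_zero := by
        funext i
        simp
      L_nonneg := sq_nonneg K
      one_le_W := fun x => by
        rw [slDensity_eq_prod hsymm hSLE]
        calc (1 : ℝ) = ∏ _i : Fin n, 1 := prod_const_one.symm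
          _ ≤ _ := prod_le_prod (fun _ _ => zero_le_one) fun i _ =>
              Real.one_le_sqrt.2 (le_add_of_nonneg_right (sq_nonneg _))
      W_le := fun x => by
        rw [slDensity_eq_prod hsymm hSLE]
        calc ∏ i, √(1 + (hsymm x).eigenvalues i ^ 2) ≤ ∏ _i : Fin n, √(1 + K ^ 2) :=
              prod_le_prod (fun i _ => by positivity) fun i _ =>
                Real.sqrt_le_sqrt (by linarith [hsq x i])
          _ = √(1 + K ^ 2) ^ n := by simp
      W_eq := fun x => by
        obtain ⟨U, hU⟩ := (hsymm x).exists_isEigenFrame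
        rw [slDensity_eq_prod hsymm hSLE, ← sqrt_det_one_add_sq hU.left hU.right, ← hU.eq]
      frame := fun x => by
        obtain ⟨U, hU⟩ := (hsymm x).exists_isEigenFrame
        exact ⟨U, _, hU, hsq x, hcurv x⟩ }

end Entire

end EntireSolutions

/-- **Theorem B (graphical form).** If `F : ℝⁿ → ℝ` is a smooth entire solution of the
special Lagrangian equation `∑ᵢ arctan λᵢ(x) = Θ`, where `λᵢ(x)` are the eigenvalues of
`D²F(x)`, and at every point: `|λᵢ| ≤ K`, and for every trace-free symmetric 3-tensor `h`
one has `Q_λ(h) ≥ 0` with equality only when `h = 0`, then `D²F` is constant, i.e. `F` is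
a quadratic polynomial. -/
theorem bernstein_special_lagrangian_positive_curvature_form
    (n : ℕ) (hn : 1 ≤ n) (K : ℝ) (hK : 0 < K)
    (F : (Fin n → ℝ) → ℝ) (hF : ContDiff ℝ (⊤ : ℕ∞) F)
    (hsymm : ∀ x, (Hess n F x).IsHermitian)
    (Θ : ℝ)
    (hSLE : ∀ x, ∑ i, Real.arctan ((hsymm x).eigenvalues i) = Θ)
    (hbdd : ∀ x, ∀ i, |(hsymm x).eigenvalues i| ≤ K)
    (hQ : ∀ x, ∀ h : Fin n → Fin n → Fin n → ℝ,
      (∀ i j k, h i j k = h j i k) → (∀ i j k, h i j k = h i k j) →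
      (∀ k, ∑ i, h i i k = 0) →
      0 ≤ Qform n ((hsymm x).eigenvalues) h ∧
        (Qform n ((hsymm x).eigenvalues) h = 0 → ∀ i j k, h i j k = 0)) :
    ∀ x y, Hess n F x = Hess n F y := by
  have hG := isControlledGraph_hess hF hsymm hSLE hbdd fun x h hs ht => by
    rw [← Qform_eq_curvForm _ hs]
    exact (hQ x h hs.1 hs.2 ht).1
  exact fun x y => (hG.hessian_const x).trans (hG.hessian_const y).symm
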